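/- The Hilbert transform H, defined by Hf(x) = lim_{ε→0⁺} ∫_{|x−y|>ε} f(y)/(x−y) dy, is bounded on a rearrangement invariant quasi-Banach space X on ℝ (i.e., for every f ∈ X the principal value Hf(x) exists for a.e. x and there is a constant c with ‖Hf‖_X ≤ c ‖f‖_X) if and only if the Boyd indices satisfy p_X > 1 and q_X < ∞. -/

import Mathlib

open MeasureTheory Set Filter Topology ENNReal

noncomputable section

/-- The decreasing rearrangement of an `ℝ≥0∞`-valued function with respect to a measure `μ`:
`g⁎(s) = sup {t : μ {x | g x > t} > s}`. -/
def distRearr {α : Type*} [MeasurableSpace α] (μ : Measure α) (g : α → ℝ≥0∞) (s : ℝ) : ℝ≥0∞ :=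
  sSup {t : ℝ≥0∞ | ENNReal.ofReal s < μ {x | t < g x}}

/-- Decreasing rearrangement of an `ℝ≥0∞`-valued function on `ℝ` (Lebesgue measure). -/
def rearrE (g : ℝ → ℝ≥0∞) : ℝ → ℝ≥0∞ := distRearr (volume : Measure ℝ) g

/-- Decreasing rearrangement `f^*` of a real-valued function on `ℝ`:
`f^*(s) = sup {t ≥ 0 : volume {x : |f x| > t} > s}`. -/
def rearr (f : ℝ → ℝ) : ℝ → ℝ≥0∞ := rearrE fun x => ENNReal.ofReal |f x|

/-- The dilation operator `D_a f (t) = f (a t)`. -/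
def dil (a : ℝ) (f : ℝ → ℝ) : ℝ → ℝ := fun t => f (a * t)

/-- The dilation operator on `ℝ≥0∞`-valued functions. -/
def dilE (a : ℝ) (g : ℝ → ℝ≥0∞) : ℝ → ℝ≥0∞ := fun t => g (a * t)

/-- A rearrangement invariant quasi-Banach function space on `ℝ` (with Lebesgue measure).
The quasi-norm `N` is defined on all `ℝ≥0∞`-valued functions (a signed function `f`
is measured via `|f|`, embedded into `ℝ≥0∞`; this is harmless since the quasi-norm of a
rearrangement invariant space depends only on `|f|`).  Membership of a signed function
`f` in the space means `f` is measurable with `N (|f|) < ∞`. -/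
structure RIQB where
  /-- the quasi-norm -/
  N : (ℝ → ℝ≥0∞) → ℝ≥0∞
  /-- the quasi-triangle inequality constant -/
  C : ℝ
  one_le_C : 1 ≤ C
  /-- homogeneity of the quasi-norm -/
  norm_smul : ∀ (c : ℝ≥0∞) (g : ℝ → ℝ≥0∞), N (fun x => c * g x) = c * N g
  /-- the quasi-triangle inequality -/
  quasi_triangle : ∀ g h : ℝ → ℝ≥0∞, AEMeasurable g volume → AEMeasurable h volume →
    N (fun x => g x + h x) ≤ ENNReal.ofReal C * (N g + N h)
  /-- definiteness (functions are identified a.e.) -/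
  definite : ∀ g : ℝ → ℝ≥0∞, AEMeasurable g volume → (N g = 0 ↔ g =ᵐ[volume] 0)
  /-- property (i): if `h^* ≤ g^*` then `‖h‖ ≤ ‖g‖` -/
  rearr_mono : ∀ g h : ℝ → ℝ≥0∞, AEMeasurable g volume → AEMeasurable h volume →
    (∀ s : ℝ, 0 < s → rearrE h s ≤ rearrE g s) → N h ≤ N g
  /-- property (ii): simple functions with support of finite measure belong to the space -/
  simple_mem : ∀ f : MeasureTheory.SimpleFunc ℝ ℝ,
    volume (Function.support (f : ℝ → ℝ)) < ∞ → N (fun x => ENNReal.ofReal |f x|) < ∞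
  /-- property (iii) or (iii′) -/
  fatou :
    (∀ g : ℕ → ℝ → ℝ≥0∞, (∀ n, AEMeasurable (g n) volume ∧ N (g n) < ∞) →
      (∀ x, Antitone fun n => g n x) → (∀ x, Tendsto (fun n => g n x) atTop (𝓝 0)) →
      Tendsto (fun n => N (g n)) atTop (𝓝 0)) ∨
    (∀ (g : ℕ → ℝ → ℝ≥0∞) (h : ℝ → ℝ≥0∞),
      (∀ n, AEMeasurable (g n) volume ∧ N (g n) < ∞) →
      (∀ x, Monotone fun n => g n x) → (∀ x, Tendsto (fun n => g n x) atTop (𝓝 (h x))) →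
      (⨆ n, N (g n)) < ∞ → N h = ⨆ n, N (g n))
  /-- completeness of the quasi-norm -/
  complete : ∀ f : ℕ → ℝ → ℝ,
    (∀ n, AEMeasurable (f n) volume ∧ N (fun x => ENNReal.ofReal |f n x|) < ∞) →
    (∀ ε : ℝ, 0 < ε → ∃ M : ℕ, ∀ m ≥ M, ∀ n ≥ M,
      N (fun x => ENNReal.ofReal |f m x - f n x|) < ENNReal.ofReal ε) →
    ∃ g : ℝ → ℝ, AEMeasurable g volume ∧ N (fun x => ENNReal.ofReal |g x|) < ∞ ∧
      Tendsto (fun n => N (fun x => ENNReal.ofReal |f n x - g x|)) atTop (𝓝 0)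

/-- The quasi-norm of a signed function. -/
def RIQB.Nr (X : RIQB) (f : ℝ → ℝ) : ℝ≥0∞ := X.N fun x => ENNReal.ofReal |f x|

/-- Membership in the space. -/
def RIQB.mem (X : RIQB) (f : ℝ → ℝ) : Prop := AEMeasurable f volume ∧ X.Nr f < ∞

/-- The lower Boyd index of a quasi-norm functional:
`sup {p > 0 : ∃ c > 0, ∀ 0 < a < 1, ∀ f ∈ X, ‖D_a f‖ ≤ c a^(-1/p) ‖f‖}`. -/
def lowerBoydOf (N : (ℝ → ℝ) → ℝ≥0∞) : ℝ≥0∞ :=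
  ⨆ p ∈ {p : ℝ | 0 < p ∧ ∃ c : ℝ, 0 < c ∧ ∀ a : ℝ, 0 < a → a < 1 →
      ∀ f : ℝ → ℝ, AEMeasurable f volume → N f < ∞ →
        N (dil a f) ≤ ENNReal.ofReal (c * a ^ (-(1/p))) * N f},
    ENNReal.ofReal p

/-- The upper Boyd index of a quasi-norm functional:
`inf {q > 0 : ∃ c > 0, ∀ a > 1, ∀ f ∈ X, ‖D_a f‖ ≤ c a^(-1/q) ‖f‖}`. -/
def upperBoydOf (N : (ℝ → ℝ) → ℝ≥0∞) : ℝ≥0∞ :=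
  ⨅ q ∈ {q : ℝ | 0 < q ∧ ∃ c : ℝ, 0 < c ∧ ∀ a : ℝ, 1 < a →
      ∀ f : ℝ → ℝ, AEMeasurable f volume → N f < ∞ →
        N (dil a f) ≤ ENNReal.ofReal (c * a ^ (-(1/q))) * N f},
    ENNReal.ofReal q

/-- The lower Boyd index `p_X`. -/
def lowerBoyd (X : RIQB) : ℝ≥0∞ := lowerBoydOf X.Nr

/-- The upper Boyd index `q_X`. -/
def upperBoyd (X : RIQB) : ℝ≥0∞ := upperBoydOf X.Nr

/-- The Hardy operator `H^{(p,r)}` acting on a nonnegative (`ℝ≥0∞`-valued) function: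
`t^{-1/p} ((r/p) ∫₀ᵗ g(s)^r s^{r/p-1} ds)^{1/r}` for `t > 0`, and `0` for `t ≤ 0`. -/
def hardyUE (p r : ℝ) (g : ℝ → ℝ≥0∞) : ℝ → ℝ≥0∞ := fun t =>
  if 0 < t then
    ENNReal.ofReal t ^ (-(1/p)) *
      (ENNReal.ofReal (r/p) *
        ∫⁻ s in Ioo (0:ℝ) t, g s ^ r * ENNReal.ofReal (s ^ (r/p - 1))) ^ (1/r)
  else 0

/-- The Hardy operator `H^{(p,r)} f (t) = t^{-1/p} ((r/p) ∫₀ᵗ f^*(s)^r s^{r/p-1} ds)^{1/r}`. -/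
def hardyU (p r : ℝ) (f : ℝ → ℝ) : ℝ → ℝ≥0∞ := hardyUE p r (rearr f)

/-- The Hardy operator `H^{(p,∞)} f (t) = sup_{0<s<t} (s/t)^{1/p} f^*(s)`. -/
def hardyUSup (p : ℝ) (f : ℝ → ℝ) : ℝ → ℝ≥0∞ := fun t =>
  if 0 < t then ⨆ s ∈ Ioo (0:ℝ) t, ENNReal.ofReal ((s/t) ^ (1/p)) * rearr f s else 0

/-- The Hardy operator
`H_{(q,r)} f (t) = t^{-1/q} ((r/q) ∫_t^∞ f^*(s)^r s^{r/q-1} ds)^{1/r}` for finite `q`. -/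
def hardyL (q r : ℝ) (f : ℝ → ℝ) : ℝ → ℝ≥0∞ := fun t =>
  if 0 < t then
    ENNReal.ofReal t ^ (-(1/q)) *
      (ENNReal.ofReal (r/q) *
        ∫⁻ s in Ioi t, rearr f s ^ r * ENNReal.ofReal (s ^ (r/q - 1))) ^ (1/r)
  else 0

/-- The Hardy operator `H_{(∞,r)} f (t) = (∫_t^∞ f^*(s)^r s⁻¹ ds)^{1/r}`. -/
def hardyLInf (r : ℝ) (f : ℝ → ℝ) : ℝ → ℝ≥0∞ := fun t =>
  if 0 < t then (∫⁻ s in Ioi t, rearr f s ^ r * ENNReal.ofReal s⁻¹) ^ (1/r) else 0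

/-- The Hardy operator `H_{(q,r)}` for `0 < q ≤ ∞`, `0 < r < ∞`. -/
def hardyLG (q : ℝ≥0∞) (r : ℝ) (f : ℝ → ℝ) : ℝ → ℝ≥0∞ :=
  if q = ∞ then hardyLInf r f else hardyL q.toReal r f

/-- The Hardy operator `H_{(q,∞)} f (t) = sup_{s>t} (s/t)^{1/q} f^*(s)`. -/
def hardyLSup (q : ℝ) (f : ℝ → ℝ) : ℝ → ℝ≥0∞ := fun t =>
  if 0 < t then ⨆ s ∈ Ioi t, ENNReal.ofReal ((s/t) ^ (1/q)) * rearr f s else 0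

/-- The Hardy operator `H^{(p,r)}` for `0 < p < ∞`, `0 < r ≤ ∞`. -/
def hardyUG (p : ℝ) (r : ℝ≥0∞) (f : ℝ → ℝ) : ℝ → ℝ≥0∞ :=
  if r = ∞ then hardyUSup p f else hardyU p r.toReal f

/-- The Hardy operator `H_{(q,s)}` for `0 < q ≤ ∞`, `0 < s ≤ ∞`
(with `H_{(∞,∞)} f = f^*`). -/
def hardyLGG (q s : ℝ≥0∞) (f : ℝ → ℝ) : ℝ → ℝ≥0∞ :=
  if q = ∞ then
    (if s = ∞ then (fun t => if 0 < t then rearr f t else 0) else hardyLInf s.toReal f)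
  else
    (if s = ∞ then hardyLSup q.toReal f else hardyL q.toReal s.toReal f)

/-- The Lorentz quasi-norm `‖f‖_{p,r}` for `0 < p ≤ ∞`, `0 < r ≤ ∞`. -/
def lorentz (p r : ℝ≥0∞) (f : ℝ → ℝ) : ℝ≥0∞ :=
  if p = ∞ then
    (if r = ∞ then essSup (fun x => ENNReal.ofReal |f x|) volume
     else (∫⁻ t in Ioi (0:ℝ), rearr f t ^ r.toReal * ENNReal.ofReal t⁻¹) ^ (1/r.toReal))
  else
    (if r = ∞ then ⨆ t ∈ Ioi (0:ℝ), ENNReal.ofReal t ^ (1/p.toReal) * rearr f t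
     else (∫⁻ t in Ioi (0:ℝ),
        (ENNReal.ofReal t ^ (1/p.toReal) * rearr f t) ^ r.toReal * ENNReal.ofReal t⁻¹) ^
          (1/r.toReal))

/-- The weak-`L_p` (Lorentz `(p,∞)`) quasi-norm of an `ℝ≥0∞`-valued function on `ℝ`:
`sup_{t>0} t^{1/p} g^*(t)`. -/
def lorentzWE (p : ℝ) (g : ℝ → ℝ≥0∞) : ℝ≥0∞ :=
  ⨆ t ∈ Ioi (0:ℝ), ENNReal.ofReal t ^ (1/p) * rearrE g t
/-! ### Rearrangements and distribution functions -/

/-- The decreasing rearrangement as a function on `ℝ`, extended by zero to `(-∞, 0]`. -/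
def starHL (g : ℝ → ℝ≥0∞) : ℝ → ℝ≥0∞ := fun x => if 0 < x then rearrE g x else 0

lemma rearrE_le_of_dist {g h : ℝ → ℝ≥0∞} (H : ∀ τ, volume {x | τ < h x} ≤ volume {x | τ < g x})
    (s : ℝ) : rearrE h s ≤ rearrE g s :=
  sSup_le_sSup fun τ (hτ : _ < _) => lt_of_lt_of_le hτ (H τ)

lemma rearrE_antitone (g : ℝ → ℝ≥0∞) : Antitone (rearrE g) := fun _ _ hst =>
  sSup_le_sSup fun _ (hτ : _ < _) => lt_of_le_of_lt (ENNReal.ofReal_le_ofReal hst) hτ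

lemma volume_pos_lt (m : ℝ≥0∞) : volume {x : ℝ | 0 < x ∧ ENNReal.ofReal x < m} = m := by
  rcases eq_or_ne m ∞ with rfl | hm
  · have : {x : ℝ | 0 < x ∧ ENNReal.ofReal x < ∞} = Ioi 0 := by ext; simp
    rw [this, Real.volume_Ioi]
  · have : {x : ℝ | 0 < x ∧ ENNReal.ofReal x < m} = Ioo 0 m.toReal := by
      ext x
      simp only [mem_ofPred_eq, mem_Ioo]
      refine and_congr_right fun hx => ?_
      rw [ENNReal.ofReal_lt_iff_lt_toReal hx.le hm]
    rw [this, Real.volume_Ioo, sub_zero, ENNReal.ofReal_toReal hm]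

lemma lt_rearrE_iff (g : ℝ → ℝ≥0∞) (s : ℝ) (τ : ℝ≥0∞) :
    τ < rearrE g s ↔ ENNReal.ofReal s < volume {x | τ < g x} := by
  constructor
  · intro h
    obtain ⟨t, ht, hτ⟩ := lt_sSup_iff.1 h
    exact lt_of_lt_of_le ht (measure_mono fun x (hx : t < g x) => hτ.trans hx)
  · intro h
    have hτ : τ ≠ ∞ := by rintro rfl; simp at h
    obtain ⟨u, hu, hτu, hlim⟩ := exists_seq_strictAnti_tendsto' (lt_top_iff_ne_top.2 hτ)
    have hU : {x | τ < g x} = ⋃ n, {x | u n < g x} := by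
      ext x
      simp only [mem_ofPred_eq, mem_iUnion]
      constructor
      · intro hx
        exact ((tendsto_order.1 hlim).2 _ hx).exists
      · rintro ⟨n, hn⟩
        exact (hτu n).1.trans hn
    have hmono : Monotone fun n => {x | u n < g x} := fun m n hmn x (hx : u m < g x) =>
      lt_of_le_of_lt (hu.antitone hmn) hx
    rw [hU, hmono.measure_iUnion] at h
    obtain ⟨n, hn⟩ := lt_iSup_iff.1 h
    exact lt_of_lt_of_le (hτu n).1 (le_sSup hn)

lemma lt_starHL_iff (g : ℝ → ℝ≥0∞) (τ : ℝ≥0∞) :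
    {x | τ < starHL g x} = {x | 0 < x ∧ ENNReal.ofReal x < volume {x | τ < g x}} := by
  ext x
  simp only [mem_ofPred_eq, starHL]
  split_ifs with hx
  · simp [hx, lt_rearrE_iff]
  · simp [hx]

lemma volume_lt_starHL (g : ℝ → ℝ≥0∞) (τ : ℝ≥0∞) :
    volume {x | τ < starHL g x} = volume {x | τ < g x} := by
  rw [lt_starHL_iff, volume_pos_lt]

lemma measurable_starHL (g : ℝ → ℝ≥0∞) : Measurable (starHL g) := by
  refine measurable_of_Ioi fun τ => ?_
  change MeasurableSet {x | τ < starHL g x}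
  rw [lt_starHL_iff]
  exact measurableSet_Ioi.inter (measurableSet_lt ENNReal.measurable_ofReal measurable_const)

lemma starHL_antitoneOn (g : ℝ → ℝ≥0∞) {s t : ℝ} (hs : 0 < s) (hst : s ≤ t) :
    starHL g t ≤ starHL g s := by
  simp only [starHL, hs, hs.trans_le hst, if_true]
  exact rearrE_antitone g hst

lemma volume_starHL_lt_le (g : ℝ → ℝ≥0∞) {t : ℝ} (ht : 0 < t) :
    volume {x | starHL g t < g x} ≤ ENNReal.ofReal t := by
  by_contra! h
  simp only [starHL, ht, if_true] at h
  exact lt_irrefl _ ((lt_rearrE_iff g t _).2 h)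

lemma dist_le_of_forall_volume_le {g G : ℝ → ℝ≥0∞}
    (H : ∀ x, 0 < x → volume {y | G x < g y} ≤ ENNReal.ofReal x) (τ : ℝ≥0∞) :
    volume {x | τ < g x} ≤ volume {x | τ < G x} := by
  conv_lhs => rw [← volume_pos_lt (volume {x | τ < g x})]
  refine measure_mono fun x hx => ?_
  by_contra! hG
  have hG : G x ≤ τ := not_lt.1 hG
  exact lt_irrefl _ (hx.2.trans_le
    ((measure_mono fun y (hy : τ < g y) => lt_of_le_of_lt hG hy).trans (H x hx.1)))

lemma volume_lt_comp_mul (g : ℝ → ℝ≥0∞) {a : ℝ} (ha : 0 < a) (τ : ℝ≥0∞) :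
    volume {x | τ < g (a * x)} = ENNReal.ofReal a⁻¹ * volume {x | τ < g x} := by
  have := Real.volume_preimage_mul_left ha.ne' {x | τ < g x}
  rwa [abs_of_pos (inv_pos.2 ha)] at this

/-! ### Elementary properties of the quasi-norm -/

namespace RIQB

variable (X : RIQB)

lemma C_pos : 0 < X.C := zero_lt_one.trans_le X.one_le_C

lemma N_le_of_dist {g h : ℝ → ℝ≥0∞} (hg : AEMeasurable g volume) (hh : AEMeasurable h volume)
    (H : ∀ τ, volume {x | τ < h x} ≤ volume {x | τ < g x}) : X.N h ≤ X.N g :=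
  X.rearr_mono g h hg hh fun s _ => rearrE_le_of_dist H s

lemma N_mono_ae {g h : ℝ → ℝ≥0∞} (hg : AEMeasurable g volume) (hh : AEMeasurable h volume)
    (H : h ≤ᵐ[volume] g) : X.N h ≤ X.N g := by
  refine X.N_le_of_dist hg hh fun τ => measure_mono_ae ?_
  filter_upwards [H] with x hx (h1 : τ < h x)
  exact lt_of_lt_of_le h1 hx

lemma N_mono {g h : ℝ → ℝ≥0∞} (hg : AEMeasurable g volume) (hh : AEMeasurable h volume)
    (H : ∀ x, h x ≤ g x) : X.N h ≤ X.N g :=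
  X.N_mono_ae hg hh (Eventually.of_forall H)

lemma N_congr_ae {g h : ℝ → ℝ≥0∞} (hg : AEMeasurable g volume) (H : h =ᵐ[volume] g) :
    X.N h = X.N g :=
  le_antisymm (X.N_mono_ae hg (hg.congr H.symm) H.le) (X.N_mono_ae (hg.congr H.symm) hg H.symm.le)

lemma N_starHL {g : ℝ → ℝ≥0∞} (hg : AEMeasurable g volume) : X.N (starHL g) = X.N g :=
  le_antisymm
    (X.N_le_of_dist hg (measurable_starHL g).aemeasurable fun τ => (volume_lt_starHL g τ).le)
    (X.N_le_of_dist (measurable_starHL g).aemeasurable hg fun τ => (volume_lt_starHL g τ).ge)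

lemma N_indicator_ne_zero {s : ℝ} (hs : 0 < s) : X.N ((Ioo 0 s).indicator 1) ≠ 0 := by
  have hm : AEMeasurable ((Ioo 0 s).indicator (1 : ℝ → ℝ≥0∞)) volume :=
    (measurable_one.indicator measurableSet_Ioo).aemeasurable
  rw [Ne, X.definite _ hm]
  intro h
  have h0 : volume (Ioo 0 s) = 0 := by
    refine measure_mono_null (fun x hx => ?_) h
    simpa using hx
  simp only [Real.volume_Ioo, sub_zero, ENNReal.ofReal_eq_zero] at h0
  linarith

lemma mul_N_indicator_le {g : ℝ → ℝ≥0∞} (hg : AEMeasurable g volume) (s : ℝ) :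
    starHL g s * X.N ((Ioo 0 s).indicator 1) ≤ X.N g := by
  rw [← X.norm_smul, ← X.N_starHL hg]
  refine X.N_mono (measurable_starHL g).aemeasurable ?_ fun x => ?_
  · exact ((measurable_one.indicator measurableSet_Ioo).const_mul _).aemeasurable
  · by_cases hx : x ∈ Ioo 0 s
    · simp only [hx, indicator_of_mem, Pi.one_apply, mul_one]
      exact starHL_antitoneOn g hx.1 hx.2.le
    · simp [hx]

lemma starHL_lt_top {g : ℝ → ℝ≥0∞} (hg : AEMeasurable g volume) (h : X.N g < ∞) (s : ℝ) :
    starHL g s < ∞ := by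
  by_cases hs : 0 < s
  · by_contra! h1
    have := X.mul_N_indicator_le hg s
    rw [top_le_iff.1 h1, ENNReal.top_mul (X.N_indicator_ne_zero hs)] at this
    exact absurd h (not_lt.2 this)
  · simp [starHL, hs]

lemma ae_lt_top_of_N_lt_top {g : ℝ → ℝ≥0∞} (hg : AEMeasurable g volume) (h : X.N g < ∞) :
    ∀ᵐ x, g x < ∞ := by
  have h0 : ∀ n : ℕ, volume {x | ¬ g x < ∞} ≤ ENNReal.ofReal (1 / ((n : ℝ) + 1)) := fun n => by
    have hn : (0 : ℝ) < 1 / ((n : ℝ) + 1) := by positivity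
    refine (measure_mono fun x hx => ?_).trans (volume_starHL_lt_le g hn)
    exact lt_of_lt_of_le (X.starHL_lt_top hg h _) (not_lt.1 hx)
  have hlim : Tendsto (fun n : ℕ => ENNReal.ofReal (1 / ((n : ℝ) + 1))) atTop (𝓝 0) := by
    simpa using ENNReal.tendsto_ofReal tendsto_one_div_add_atTop_nhds_zero_nat
  exact le_antisymm (ge_of_tendsto' hlim h0) bot_le

lemma N_add_le {g h : ℝ → ℝ≥0∞} (hg : AEMeasurable g volume) (hh : AEMeasurable h volume) :
    X.N (fun x => g x + h x) ≤ ENNReal.ofReal X.C * (X.N g + X.N h) := X.quasi_triangle g h hg hh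

end RIQB
/-! ### Dilations -/

lemma aemeasurable_ofReal_abs {f : ℝ → ℝ} (hf : AEMeasurable f volume) :
    AEMeasurable (fun x => ENNReal.ofReal |f x|) volume :=
  (measurable_norm.comp_aemeasurable hf).ennreal_ofReal

lemma aemeasurable_dil {f : ℝ → ℝ} (hf : AEMeasurable f volume) {a : ℝ} (ha : a ≠ 0) :
    AEMeasurable (dil a f) volume := by
  refine AEMeasurable.comp_quasiMeasurePreserving hf ⟨measurable_const_mul a, ?_⟩
  rw [Real.map_volume_mul_left ha]
  exact Measure.smul_absolutelyContinuous

lemma dil_dil (a b : ℝ) (f : ℝ → ℝ) : dil a (dil b f) = dil (b * a) f := by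
  ext x; simp [dil, mul_assoc]

namespace RIQB

variable (X : RIQB)

lemma Nr_le_of_abs_le {f g : ℝ → ℝ} (hf : AEMeasurable f volume) (hg : AEMeasurable g volume)
    (H : ∀ x, |g x| ≤ |f x|) : X.Nr g ≤ X.Nr f :=
  X.N_mono (aemeasurable_ofReal_abs hf) (aemeasurable_ofReal_abs hg)
    fun x => ENNReal.ofReal_le_ofReal (H x)

/-- The dilation operator `D_a` is bounded on the space with constant `K`. -/
def DilBound (a K : ℝ) : Prop :=
  ∀ f : ℝ → ℝ, AEMeasurable f volume → X.Nr f < ∞ → X.Nr (dil a f) ≤ ENNReal.ofReal K * X.Nr f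

variable {X}

lemma DilBound.mono_const {a K K' : ℝ} (h : X.DilBound a K) (hK : K ≤ K') : X.DilBound a K' :=
  fun f hf hN => (h f hf hN).trans (by gcongr)

variable (X) in
lemma Nr_dil_antitone {f : ℝ → ℝ} (hf : AEMeasurable f volume) {a b : ℝ} (ha : 0 < a)
    (hab : a ≤ b) : X.Nr (dil b f) ≤ X.Nr (dil a f) := by
  have hb := ha.trans_le hab
  refine X.N_le_of_dist (aemeasurable_ofReal_abs (aemeasurable_dil hf ha.ne'))
    (aemeasurable_ofReal_abs (aemeasurable_dil hf hb.ne')) fun τ => ?_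
  simp only [dil]
  rw [volume_lt_comp_mul (fun x => ENNReal.ofReal |f x|) ha,
    volume_lt_comp_mul (fun x => ENNReal.ofReal |f x|) hb]
  gcongr

lemma DilBound.mono {a b K : ℝ} (h : X.DilBound a K) (ha : 0 < a) (hab : a ≤ b) :
    X.DilBound b K := fun f hf hN => (X.Nr_dil_antitone hf ha hab).trans (h f hf hN)

lemma dilBound_one : X.DilBound 1 1 := fun f _ _ => by simp [dil, Nr]

lemma DilBound.mul {a b K L : ℝ} (h : X.DilBound a K) (h' : X.DilBound b L) (ha : a ≠ 0)
    (hL : 0 ≤ L) : X.DilBound (a * b) (L * K) := fun f hf hN => by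
  rw [← dil_dil]
  refine (h' _ (aemeasurable_dil hf ha) ((h f hf hN).trans_lt
    (ENNReal.mul_lt_top ENNReal.ofReal_lt_top hN))).trans ?_
  rw [ENNReal.ofReal_mul hL, mul_assoc]
  gcongr
  exact h f hf hN

lemma DilBound.pow {a K : ℝ} (h : X.DilBound a K) (ha : a ≠ 0) (hK : 0 ≤ K) (n : ℕ) :
    X.DilBound (a ^ n) (K ^ n) := by
  induction n with
  | zero => simpa using dilBound_one
  | succ n ih =>
    rw [pow_succ, pow_succ']
    exact ih.mul h (pow_ne_zero _ ha) hK

variable (X) in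
lemma dilBound_half : X.DilBound (1 / 2) (2 * X.C) := fun f hf _ => by
  set g : ℝ → ℝ≥0∞ := fun x => ENNReal.ofReal |f x|
  have hg : AEMeasurable g volume := aemeasurable_ofReal_abs hf
  have hS := measurable_starHL g
  have hS' : Measurable fun x => starHL g (-x) := hS.comp measurable_neg
  have hneg : ∀ τ, volume {x | τ < starHL g (-x)} = volume {x | τ < starHL g x} := fun τ =>
    Measure.measure_preimage_neg volume {x | τ < starHL g x}
  have hN : X.N (fun x => starHL g (-x)) ≤ X.N g := by
    rw [← X.N_starHL hg]
    exact X.N_le_of_dist hS.aemeasurable hS'.aemeasurable fun τ => (hneg τ).le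
  calc X.Nr (dil (1 / 2) f) ≤ X.N (fun x => starHL g x + starHL g (-x)) := by
        refine X.N_le_of_dist (hS.add hS').aemeasurable
          (aemeasurable_ofReal_abs (aemeasurable_dil hf (by norm_num))) fun τ => ?_
        simp only [dil]
        rw [volume_lt_comp_mul g (by norm_num : (0 : ℝ) < 1 / 2)]
        have hdisj : Disjoint {x | τ < starHL g x} {x | τ < starHL g (-x)} := by
          rw [Set.disjoint_left]
          intro x (hx : τ < starHL g x) (hx' : τ < starHL g (-x))
          have h1 : 0 < x := by
            by_contra h; simp [starHL, h] at hx
          have h2 : 0 < -x := by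
            by_contra h; simp only [starHL, h, if_false] at hx'; exact absurd hx' (by simp)
          linarith
        have hsub : {x | τ < starHL g x} ∪ {x | τ < starHL g (-x)} ⊆
            {x | τ < starHL g x + starHL g (-x)} := by
          rintro x (hx | hx)
          · exact lt_of_lt_of_le (show τ < starHL g x from hx) le_self_add
          · exact lt_of_lt_of_le (show τ < starHL g (-x) from hx) le_add_self
        refine le_trans ?_ (measure_mono hsub)
        rw [measure_union hdisj (measurableSet_lt measurable_const hS'), hneg,
          volume_lt_starHL]
        norm_num [two_mul]
    _ ≤ ENNReal.ofReal X.C * (X.N (starHL g) + X.N (fun x => starHL g (-x))) :=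
        X.N_add_le hS.aemeasurable hS'.aemeasurable
    _ ≤ ENNReal.ofReal X.C * (X.N g + X.N g) := by rw [X.N_starHL hg]; gcongr
    _ = ENNReal.ofReal (2 * X.C) * X.Nr f := by
        rw [mul_comm (2 : ℝ), ENNReal.ofReal_mul X.C_pos.le, ← two_mul, mul_assoc]
        norm_num [Nr, g]

variable (X) in
lemma exists_dilBound {a : ℝ} (ha : 0 < a) : ∃ K, 0 < K ∧ X.DilBound a K := by
  obtain ⟨n, hn⟩ := exists_pow_lt_of_lt_one ha (by norm_num : (1 / 2 : ℝ) < 1)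
  have hC := X.C_pos
  exact ⟨(2 * X.C) ^ n, by positivity, ((X.dilBound_half.pow (by norm_num) (by positivity)
    n).mono (by positivity) hn.le)⟩

/-! ### Boyd indices and a single dilation -/

lemma one_lt_lowerBoyd {a K : ℝ} (h : X.DilBound a K) (ha : 0 < a) (ha1 : a < 1)
    (hK : K * a < 1) : 1 < lowerBoyd X := by
  set L := max K (a ^ (-(1 / 2) : ℝ)) with hL
  have hLpos : 0 < L := lt_max_of_lt_right (by positivity)
  have hla : Real.log a < 0 := Real.log_neg ha ha1
  set θ := - Real.log L / Real.log a with hθ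
  have hLθ : L = a ^ (-θ) := by
    rw [Real.rpow_def_of_pos ha, hθ, neg_div, neg_neg, mul_div_cancel₀ _ hla.ne,
      Real.exp_log hLpos]
  have hLa : L * a < 1 := by
    rw [hL, max_mul_of_nonneg _ _ ha.le]
    refine max_lt hK ?_
    nth_rewrite 2 [← Real.rpow_one a]
    rw [← Real.rpow_add ha]
    exact Real.rpow_lt_one ha.le ha1 (by norm_num)
  have hθ1 : θ < 1 := by
    by_contra! h1
    have : a ^ (-(1 : ℝ)) ≤ L := by
      rw [hLθ]; exact Real.rpow_le_rpow_of_exponent_ge ha ha1.le (by linarith)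
    rw [Real.rpow_neg_one] at this
    have := mul_le_mul_of_nonneg_right this ha.le
    rw [inv_mul_cancel₀ ha.ne'] at this
    linarith
  have hθ0 : 0 < θ := by
    by_contra! h1
    have h2 : a ^ (-(1 / 2) : ℝ) ≤ a ^ (-θ) := hLθ ▸ le_max_right _ _
    have h3 := (Real.rpow_le_rpow_left_iff_of_base_lt_one ha ha1).1 h2
    linarith
  have hmem : (1 / θ) ∈ {p : ℝ | 0 < p ∧ ∃ c : ℝ, 0 < c ∧ ∀ a : ℝ, 0 < a → a < 1 →
      ∀ f : ℝ → ℝ, AEMeasurable f volume → X.Nr f < ∞ →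
        X.Nr (dil a f) ≤ ENNReal.ofReal (c * a ^ (-(1/p))) * X.Nr f} := by
    refine ⟨by positivity, L, hLpos, fun b hb hb1 f hf hN => ?_⟩
    obtain ⟨n, hn1, hn2⟩ := exists_nat_pow_near_of_lt_one hb hb1.le ha ha1
    have h1 := (((h.mono_const (le_max_left _ _ : K ≤ L)).pow ha.ne' hLpos.le (n + 1)).mono
      (by positivity) hn1.le) f hf hN
    refine h1.trans ?_
    gcongr
    rw [pow_succ', one_div_one_div]
    gcongr
    calc L ^ n = (a ^ n) ^ (-θ) := by
          rw [hLθ, ← Real.rpow_natCast, ← Real.rpow_mul ha.le, mul_comm, Real.rpow_mul ha.le,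
            Real.rpow_natCast]
      _ ≤ b ^ (-θ) := Real.rpow_le_rpow_of_nonpos hb hn2 (by linarith)
  refine lt_of_lt_of_le ?_ (le_iSup₂ (f := fun p _ => ENNReal.ofReal p) (1 / θ) hmem)
  rw [ENNReal.one_lt_ofReal]
  exact (one_lt_div hθ0).2 hθ1

lemma upperBoyd_lt_top {b K : ℝ} (h : X.DilBound b K) (hb : 1 < b) (hK0 : 0 < K)
    (hK : K < 1) : upperBoyd X < ∞ := by
  have hb0 : 0 < b := one_pos.trans hb
  have hlb : 0 < Real.log b := Real.log_pos hb
  set θ := - Real.log K / Real.log b with hθ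
  have hθ0 : 0 < θ := div_pos (neg_pos.2 (Real.log_neg hK0 hK)) hlb
  have hKθ : K = b ^ (-θ) := by
    rw [Real.rpow_def_of_pos hb0, hθ, neg_div, neg_neg, mul_div_cancel₀ _ hlb.ne',
      Real.exp_log hK0]
  have hpow : ∀ n : ℕ, K ^ n = (b ^ n) ^ (-θ) := fun n => by
    rw [hKθ, ← Real.rpow_natCast, ← Real.rpow_mul hb0.le, mul_comm, Real.rpow_mul hb0.le,
            Real.rpow_natCast]
  have hmem : (1 / θ) ∈ {q : ℝ | 0 < q ∧ ∃ c : ℝ, 0 < c ∧ ∀ a : ℝ, 1 < a →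
      ∀ f : ℝ → ℝ, AEMeasurable f volume → X.Nr f < ∞ →
        X.Nr (dil a f) ≤ ENNReal.ofReal (c * a ^ (-(1/q))) * X.Nr f} := by
    refine ⟨by positivity, K⁻¹, by positivity, fun x hx f hf hN => ?_⟩
    obtain ⟨n, hn1, hn2⟩ := exists_nat_pow_near hx.le hb
    have h1 := ((h.pow hb0.ne' hK0.le n).mono (by positivity) hn1) f hf hN
    refine h1.trans ?_
    gcongr
    rw [one_div_one_div]
    calc K ^ n = K⁻¹ * K ^ (n + 1) := by rw [pow_succ]; field_simp
      _ = K⁻¹ * (b ^ (n + 1)) ^ (-θ) := by rw [hpow]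
      _ ≤ K⁻¹ * x ^ (-θ) := mul_le_mul_of_nonneg_left (Real.rpow_le_rpow_of_nonpos (one_pos.trans hx) hn2.le
          (by linarith)) (by positivity)
  exact (iInf₂_le (f := fun p _ => ENNReal.ofReal p) (1 / θ) hmem).trans_lt ENNReal.ofReal_lt_top

lemma exists_dilBound_of_one_lt_lowerBoyd (h : 1 < lowerBoyd X) :
    ∃ p c : ℝ, 1 < p ∧ 0 < c ∧ ∀ a : ℝ, 0 < a → a < 1 → X.DilBound a (c * a ^ (-(1 / p))) := by
  simp only [lowerBoyd, lowerBoydOf, lt_iSup_iff] at h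
  obtain ⟨p, ⟨-, c, hc, H⟩, hp⟩ := h
  exact ⟨p, c, ENNReal.one_lt_ofReal.1 hp, hc, fun a ha ha1 f hf hN => H a ha ha1 f hf hN⟩

lemma exists_dilBound_of_upperBoyd_lt_top (h : upperBoyd X < ∞) :
    ∃ q c : ℝ, 0 < q ∧ 0 < c ∧ ∀ a : ℝ, 1 < a → X.DilBound a (c * a ^ (-(1 / q))) := by
  simp only [upperBoyd, upperBoydOf, iInf_lt_iff] at h
  obtain ⟨q, ⟨hq, c, hc, H⟩, -⟩ := h
  exact ⟨q, c, hq, hc, fun a ha f hf hN => H a ha f hf hN⟩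

end RIQB
/-! ### Truncation -/

/-- Truncation of `|f|` at height `n`, restricted to `[-n, n]`. -/
def truncAbs (n : ℕ) (f : ℝ → ℝ) : ℝ → ℝ := fun x => if |x| ≤ n then min |f x| n else 0

lemma truncAbs_nonneg (n : ℕ) (f : ℝ → ℝ) (x : ℝ) : 0 ≤ truncAbs n f x := by
  unfold truncAbs; split_ifs <;> positivity

lemma truncAbs_le (n : ℕ) (f : ℝ → ℝ) (x : ℝ) : truncAbs n f x ≤ n := by
  unfold truncAbs; split_ifs <;> simp

lemma truncAbs_le_abs (n : ℕ) (f : ℝ → ℝ) (x : ℝ) : truncAbs n f x ≤ |f x| := by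
  unfold truncAbs; split_ifs <;> simp

lemma truncAbs_mono (f : ℝ → ℝ) (x : ℝ) : Monotone fun n => truncAbs n f x := by
  intro m n hmn
  have : (m : ℝ) ≤ n := by exact_mod_cast hmn
  by_cases h : |x| ≤ m
  · simp only [truncAbs, h, h.trans this, if_true]
    exact min_le_min_left _ this
  · simp only [truncAbs, h, if_false]
    exact truncAbs_nonneg n f x

lemma truncAbs_eventually_eq (f : ℝ → ℝ) (x : ℝ) : ∀ᶠ n in atTop, truncAbs n f x = |f x| := by
  obtain ⟨N, hN⟩ := exists_nat_ge (max |x| |f x|)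
  filter_upwards [eventually_ge_atTop N] with n hn
  have : (N : ℝ) ≤ n := by exact_mod_cast hn
  simp only [truncAbs, ((le_max_left _ _).trans hN).trans this, if_true]
  exact min_eq_left (((le_max_right _ _).trans hN).trans this)

lemma truncAbs_eq_zero {n : ℕ} {x : ℝ} (h : (n : ℝ) < |x|) (f : ℝ → ℝ) : truncAbs n f x = 0 := by
  simp [truncAbs, not_le.2 h]

lemma measurableSet_abs_le (r : ℝ) : MeasurableSet {x : ℝ | |x| ≤ r} :=
  measurableSet_le measurable_norm measurable_const

lemma measurable_truncAbs {f : ℝ → ℝ} (hf : Measurable f) (n : ℕ) : Measurable (truncAbs n f) :=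
  Measurable.ite (measurableSet_abs_le _) ((measurable_norm.comp hf).min measurable_const)
    measurable_const

lemma aemeasurable_truncAbs {f : ℝ → ℝ} (hf : AEMeasurable f volume) (n : ℕ) :
    AEMeasurable (truncAbs n f) volume := by
  refine ⟨truncAbs n (hf.mk f), measurable_truncAbs hf.measurable_mk n, ?_⟩
  filter_upwards [hf.ae_eq_mk] with x hx
  simp [truncAbs, hx]

namespace RIQB

variable {X : RIQB}

lemma dilBound_of_truncAbs {a K : ℝ} (ha : 0 < a)
    (H : ∀ (n : ℕ) (f : ℝ → ℝ), AEMeasurable f volume → X.Nr f < ∞ →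
      X.Nr (dil a (truncAbs n f)) ≤ ENNReal.ofReal K * X.Nr (truncAbs n f)) :
    X.DilBound a (X.C * K) := by
  intro f hf hN
  have hC := X.C_pos
  have htm := fun n => aemeasurable_truncAbs hf n
  have htN : ∀ n, X.Nr (truncAbs n f) ≤ X.Nr f := fun n =>
    X.Nr_le_of_abs_le hf (htm n) fun x => by
      rw [abs_of_nonneg (truncAbs_nonneg n f x)]; exact truncAbs_le_abs n f x
  have hbd : ∀ n, X.Nr (dil a (truncAbs n f)) ≤ ENNReal.ofReal K * X.Nr f := fun n =>
    (H n f hf hN).trans (by gcongr; exact htN n)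
  have hfin : ENNReal.ofReal K * X.Nr f < ∞ := ENNReal.mul_lt_top ENNReal.ofReal_lt_top hN
  rw [ENNReal.ofReal_mul hC.le, mul_assoc]
  rcases X.fatou with h3 | h3
  · obtain ⟨L, hL, hLb⟩ := X.exists_dilBound ha
    set r : ℕ → ℝ → ℝ := fun n x => |f x| - truncAbs n f x with hr
    have hr0 : ∀ n x, 0 ≤ r n x := fun n x => sub_nonneg.2 (truncAbs_le_abs n f x)
    have hrm : ∀ n, AEMeasurable (r n) volume := fun n =>
      (measurable_norm.comp_aemeasurable hf).sub (htm n)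
    have hrN : ∀ n, X.Nr (r n) < ∞ := fun n =>
      (X.Nr_le_of_abs_le hf (hrm n) fun x => by
        rw [abs_of_nonneg (hr0 n x)]
        exact sub_le_self _ (truncAbs_nonneg n f x)).trans_lt hN
    have hlim : Tendsto (fun n => X.Nr (r n)) atTop (𝓝 0) := by
      refine h3 (fun n x => ENNReal.ofReal |r n x|)
        (fun n => ⟨aemeasurable_ofReal_abs (hrm n), hrN n⟩) (fun x m n hmn => ?_) fun x => ?_
      · simp only [abs_of_nonneg (hr0 _ x)]
        exact ENNReal.ofReal_le_ofReal (sub_le_sub_left (truncAbs_mono f x hmn) _)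
      · refine tendsto_const_nhds.congr' ?_
        filter_upwards [truncAbs_eventually_eq f x] with n hn
        simp [hr, hn]
    have hstep : ∀ n, X.Nr (dil a f) ≤ ENNReal.ofReal X.C *
        (ENNReal.ofReal K * X.Nr f + ENNReal.ofReal L * X.Nr (r n)) := fun n => by
      calc X.Nr (dil a f) = X.N (fun x => ENNReal.ofReal |dil a (truncAbs n f) x| +
            ENNReal.ofReal |dil a (r n) x|) := by
            unfold Nr
            congr 1
            ext x
            rw [← ENNReal.ofReal_add (abs_nonneg _) (abs_nonneg _)]
            simp only [dil]
            rw [abs_of_nonneg (truncAbs_nonneg _ _ _), abs_of_nonneg (hr0 _ _)]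
            simp [hr]
        _ ≤ _ := X.N_add_le (aemeasurable_ofReal_abs (aemeasurable_dil (htm n) ha.ne'))
            (aemeasurable_ofReal_abs (aemeasurable_dil (hrm n) ha.ne'))
        _ ≤ _ := by
          gcongr
          · exact hbd n
          · exact hLb _ (hrm n) (hrN n)
    have hlim2 : Tendsto (fun n => ENNReal.ofReal X.C *
        (ENNReal.ofReal K * X.Nr f + ENNReal.ofReal L * X.Nr (r n))) atTop
        (𝓝 (ENNReal.ofReal X.C * (ENNReal.ofReal K * X.Nr f + ENNReal.ofReal L * 0))) := by
      refine ENNReal.Tendsto.const_mul ?_ (Or.inr ENNReal.ofReal_ne_top)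
      exact tendsto_const_nhds.add
        (ENNReal.Tendsto.const_mul hlim (Or.inr ENNReal.ofReal_ne_top))
    simpa using ge_of_tendsto' hlim2 hstep
  · have hsup : (⨆ n, X.Nr (dil a (truncAbs n f))) ≤ ENNReal.ofReal K * X.Nr f := iSup_le hbd
    have h4 := h3 (fun n x => ENNReal.ofReal |dil a (truncAbs n f) x|)
      (fun x => ENNReal.ofReal |dil a f x|)
      (fun n => ⟨aemeasurable_ofReal_abs (aemeasurable_dil (htm n) ha.ne'), (hbd n).trans_lt hfin⟩)
      (fun x m n hmn => ?_) (fun x => ?_) (hsup.trans_lt hfin)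
    · have h5 : X.Nr (dil a f) ≤ ENNReal.ofReal K * X.Nr f := h4.trans_le hsup
      refine h5.trans (le_mul_of_one_le_left' ?_)
      exact ENNReal.one_le_ofReal.2 X.one_le_C
    · simp only [dil, abs_of_nonneg (truncAbs_nonneg _ _ _)]
      exact ENNReal.ofReal_le_ofReal (truncAbs_mono f _ hmn)
    · refine tendsto_const_nhds.congr' ?_
      filter_upwards [truncAbs_eventually_eq f (a * x)] with n hn
      simp [dil, hn]

end RIQB

/-! ### The real-valued rearrangement -/

/-- Real-valued decreasing rearrangement, extended by zero to `(-∞, 0]`. -/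
def starReal (f : ℝ → ℝ) : ℝ → ℝ := fun x => (starHL (fun y => ENNReal.ofReal |f y|) x).toReal

lemma measurable_starReal (f : ℝ → ℝ) : Measurable (starReal f) :=
  (measurable_starHL _).ennreal_toReal

lemma starReal_nonneg (f : ℝ → ℝ) (x : ℝ) : 0 ≤ starReal f x := ENNReal.toReal_nonneg

lemma starReal_of_nonpos (f : ℝ → ℝ) {x : ℝ} (hx : x ≤ 0) : starReal f x = 0 := by
  simp [starReal, starHL, not_lt.2 hx]

namespace RIQB

variable {X : RIQB}

lemma ofReal_starReal {f : ℝ → ℝ} (hf : AEMeasurable f volume) (hN : X.Nr f < ∞) (x : ℝ) :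
    ENNReal.ofReal (starReal f x) = starHL (fun y => ENNReal.ofReal |f y|) x :=
  ENNReal.ofReal_toReal (X.starHL_lt_top (aemeasurable_ofReal_abs hf) hN x).ne

lemma starReal_antitoneOn {f : ℝ → ℝ} (hf : AEMeasurable f volume) (hN : X.Nr f < ∞) {s t : ℝ}
    (hs : 0 < s) (hst : s ≤ t) : starReal f t ≤ starReal f s :=
  ENNReal.toReal_mono (X.starHL_lt_top (aemeasurable_ofReal_abs hf) hN s).ne
    (starHL_antitoneOn _ hs hst)

lemma Nr_dil_starReal {f : ℝ → ℝ} (hf : AEMeasurable f volume) (hN : X.Nr f < ∞) {a : ℝ}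
    (ha : 0 < a) : X.Nr (dil a (starReal f)) = X.Nr (dil a f) := by
  have h1 : ∀ τ, volume {x | τ < ENNReal.ofReal |dil a (starReal f) x|} =
      volume {x | τ < ENNReal.ofReal |dil a f x|} := fun τ => by
    simp only [dil, abs_of_nonneg (starReal_nonneg _ _), ofReal_starReal hf hN]
    rw [volume_lt_comp_mul _ ha, volume_lt_comp_mul (fun x => ENNReal.ofReal |f x|) ha,
      volume_lt_starHL]
  have hm1 := aemeasurable_ofReal_abs (aemeasurable_dil hf ha.ne')
  have hm2 := aemeasurable_ofReal_abs
    (aemeasurable_dil (measurable_starReal f).aemeasurable ha.ne')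
  exact le_antisymm (X.N_le_of_dist hm1 hm2 fun τ => (h1 τ).le)
    (X.N_le_of_dist hm2 hm1 fun τ => (h1 τ).ge)

lemma Nr_starReal {f : ℝ → ℝ} (hf : AEMeasurable f volume) (hN : X.Nr f < ∞) :
    X.Nr (starReal f) = X.Nr f := by
  have h1 : ∀ g, dil 1 g = g := fun g => funext fun x => by simp [dil]
  simpa only [h1] using Nr_dil_starReal hf hN one_pos

end RIQB
/-! ### Necessity of the conditions on the Boyd indices -/

/-- A bounded nonnegative measurable function supported in `(0, M)` and bounded by `M`. -/
structure IsNice (M : ℝ) (F : ℝ → ℝ) : Prop where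
  meas : Measurable F
  nonneg : ∀ x, 0 ≤ F x
  le : ∀ x, F x ≤ M
  left : ∀ x, x ≤ 0 → F x = 0
  right : ∀ x, M ≤ x → F x = 0

/-- The Stieltjes-type operator arising as the Hilbert transform on the opposite half-line. -/
def stieltjesOp (F : ℝ → ℝ) (x : ℝ) : ℝ := ∫ y, F y / (x + y)

lemma IsNice.integrable {M : ℝ} {F : ℝ → ℝ} (h : IsNice M F) : Integrable F volume := by
  have h1 : IntegrableOn F (Ioo 0 M) volume := by
    refine Measure.integrableOn_of_bounded (M := M) (by simp) h.meas.aestronglyMeasurable ?_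
    exact Eventually.of_forall fun x => by
      rw [Real.norm_of_nonneg (h.nonneg x)]; exact h.le x
  refine (integrableOn_iff_integrable_of_support_subset fun x hx => ?_).1 h1
  refine ⟨?_, ?_⟩ <;> by_contra! hc
  · exact hx (h.left x hc)
  · exact hx (h.right x hc)

lemma IsNice.integrable_div {M : ℝ} {F : ℝ → ℝ} (h : IsNice M F) {x : ℝ} (hx : 0 < x) :
    Integrable (fun y => F y / (x + y)) volume := by
  refine (h.integrable.const_mul x⁻¹).mono'
    (h.meas.div (measurable_const.add measurable_id)).aestronglyMeasurable
    (Eventually.of_forall fun y => ?_)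
  rcases le_or_gt y 0 with hy | hy
  · simp [h.left y hy]
  · rw [Real.norm_of_nonneg (div_nonneg (h.nonneg y) (by positivity)), div_eq_inv_mul]
    gcongr
    · exact h.nonneg y
    · linarith

lemma IsNice.div_nonneg {M : ℝ} {F : ℝ → ℝ} (h : IsNice M F) {x : ℝ} (hx : 0 < x) (y : ℝ) :
    0 ≤ F y / (x + y) := by
  rcases le_or_gt y 0 with hy | hy
  · simp [h.left y hy]
  · exact _root_.div_nonneg (h.nonneg y) (by positivity)

lemma IsNice.le_stieltjesOp {M : ℝ} {F : ℝ → ℝ} (h : IsNice M F) {x u v : ℝ} (hx : 0 < x)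
    (huv : u ≤ v) {φ : ℝ → ℝ} (hφ : ContinuousOn φ (Icc u v))
    (hle : ∀ y ∈ Ioo u v, φ y ≤ F y / (x + y)) :
    ∫ y in u..v, φ y ≤ stieltjesOp F x := by
  rw [intervalIntegral.integral_of_le huv, integral_Ioc_eq_integral_Ioo]
  calc ∫ y in Ioo u v, φ y ≤ ∫ y in Ioo u v, F y / (x + y) :=
        setIntegral_mono_on (hφ.integrableOn_Icc.mono_set Ioo_subset_Icc_self)
          (h.integrable_div hx).integrableOn measurableSet_Ioo hle
    _ ≤ _ := setIntegral_le_integral (h.integrable_div hx)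
        (Eventually.of_forall fun y => h.div_nonneg hx y)

lemma measurable_stieltjesOp {F : ℝ → ℝ} (hF : Measurable F) : Measurable (stieltjesOp F) := by
  have : Measurable (Function.uncurry fun x y => F y / (x + y)) :=
    (hF.comp measurable_snd).div (measurable_fst.add measurable_snd)
  exact this.stronglyMeasurable.integral_prod_right.measurable

namespace RIQB

variable {X : RIQB}

/-- Boundedness of the principal-value Hilbert transform on the space, with constant `c`. -/
def HilbertBound (X : RIQB) (c : ℝ) : Prop :=
  ∀ f : ℝ → ℝ, X.mem f →
      ∃ g : ℝ → ℝ, AEMeasurable g volume ∧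
        (∀ᵐ x ∂volume,
          Tendsto (fun ε : ℝ => ∫ y in {y : ℝ | ε < |x - y|}, f y / (x - y))
            (𝓝[>] (0:ℝ)) (𝓝 (g x))) ∧
        X.Nr g ≤ ENNReal.ofReal c * X.Nr f

lemma HilbertBound.stieltjes {c : ℝ} (hc : X.HilbertBound c) {M : ℝ} {F : ℝ → ℝ}
    (h : IsNice M F) (hN : X.Nr F < ∞) {G : ℝ → ℝ} (hG : Measurable G) (hG0 : ∀ x, 0 ≤ G x)
    (hGn : ∀ x ≤ 0, G x = 0) (hGle : ∀ x, 0 < x → G x ≤ stieltjesOp F x) :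
    X.Nr G ≤ ENNReal.ofReal c * X.Nr F := by
  obtain ⟨g, hg, hlim, hgN⟩ := hc F ⟨h.meas.aemeasurable, hN⟩
  refine le_trans ?_ hgN
  have hGneg : Measurable fun x => G (-x) := hG.comp measurable_neg
  calc X.Nr G ≤ X.Nr (fun x => G (-x)) := by
        refine X.N_le_of_dist (aemeasurable_ofReal_abs hGneg.aemeasurable)
          (aemeasurable_ofReal_abs hG.aemeasurable) fun τ => ?_
        exact (Measure.measure_preimage_neg volume {x | τ < ENNReal.ofReal |G x|}).ge
    _ ≤ X.Nr g := by
        refine X.N_mono_ae (aemeasurable_ofReal_abs hg)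
          (aemeasurable_ofReal_abs hGneg.aemeasurable) ?_
        filter_upwards [hlim] with x hx
        refine ENNReal.ofReal_le_ofReal ?_
        rcases lt_or_ge x 0 with hx0 | hx0
        · have hev : ∀ᶠ ε in 𝓝[>] (0 : ℝ),
              -stieltjesOp F (-x) = ∫ y in {y : ℝ | ε < |x - y|}, F y / (x - y) := by
            filter_upwards [Ioo_mem_nhdsGT (neg_pos.2 hx0)] with ε hε
            rw [setIntegral_eq_integral_of_forall_compl_eq_zero, stieltjesOp, ← integral_neg]
            · congr 1
              ext y
              rw [← div_neg]; ring_nf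
            · intro y hy
              have : y ≤ 0 := by
                by_contra! hy0
                refine hy ?_
                change ε < |x - y|
                rw [abs_of_neg (by linarith)]
                linarith [hε.2]
              simp [h.left y this]
          have := tendsto_nhds_unique hx (tendsto_const_nhds.congr' hev)
          rw [this, abs_neg, abs_of_nonneg (hG0 _)]
          exact (hGle (-x) (by linarith)).trans (le_abs_self _)
        · simp [hGn (-x) (by linarith)]

lemma HilbertBound.dil_large {c : ℝ} (hc : X.HilbertBound c) {M : ℝ} {F : ℝ → ℝ}
    (h : IsNice M F) (hN : X.Nr F < ∞) (hanti : ∀ s t, 0 < s → s ≤ t → F t ≤ F s) {b : ℝ}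
    (hb : 1 < b) :
    ENNReal.ofReal (Real.log b / 2) * X.Nr (dil b F) ≤ ENNReal.ofReal c * X.Nr F := by
  have hb0 : 0 < b := one_pos.trans hb
  have hlog : 0 < Real.log b := Real.log_pos hb
  have := hc.stieltjes h hN (G := fun x => Real.log b / 2 * F (b * x))
    ((h.meas.comp (measurable_const_mul b)).const_mul _)
    (fun x => mul_nonneg (by positivity) (h.nonneg _))
    (fun x hx => by rw [h.left _ (mul_nonpos_of_nonneg_of_nonpos hb0.le hx), mul_zero])
    fun x hx => ?_
  · refine le_trans (le_of_eq ?_) this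
    rw [Nr, Nr, ← X.norm_smul]
    congr 1
    ext x
    rw [abs_mul, abs_of_pos (by positivity : 0 < Real.log b / 2),
      ENNReal.ofReal_mul (by positivity)]
    rfl
  · have hxb : x ≤ b * x := by nlinarith
    have h1 : ∫ y in x..b * x, (F (b * x) / 2) * y⁻¹ = Real.log b / 2 * F (b * x) := by
      rw [intervalIntegral.integral_const_mul, integral_inv_of_pos hx (by positivity),
        mul_div_cancel_right₀ _ hx.ne']
      ring
    rw [← h1]
    refine h.le_stieltjesOp hx hxb (ContinuousOn.mul continuousOn_const
      (continuousOn_inv₀.mono fun y hy => (hx.trans_le hy.1).ne')) fun y hy => ?_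
    have hy0 : 0 < y := hx.trans hy.1
    calc F (b * x) / 2 * y⁻¹ = F (b * x) / (2 * y) := by field_simp
      _ ≤ F y / (x + y) := by
        gcongr
        · exact h.nonneg y
        · exact hanti y _ hy0 hy.2.le
        · linarith [hy.1]

lemma HilbertBound.dil_small {c : ℝ} (hc : X.HilbertBound c) {M : ℝ} {F : ℝ → ℝ}
    (h : IsNice M F) (hN : X.Nr F < ∞) (hanti : ∀ s t, 0 < s → s ≤ t → F t ≤ F s) {a : ℝ}
    (ha : 0 < a) (ha1 : a < 1) :
    ENNReal.ofReal (a * Real.log a⁻¹ / 4) * X.Nr (dil a F) ≤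
      ENNReal.ofReal c * (ENNReal.ofReal c * X.Nr F) := by
  have hM : 0 ≤ M := (h.nonneg 0).trans (h.le 0)
  have hlog : 0 < Real.log a⁻¹ := Real.log_pos ((one_lt_inv₀ ha).2 ha1)
  set G : ℝ → ℝ := fun s => if 0 < s ∧ s < M / a then min (stieltjesOp F s) (M / a) else 0 with hGdef
  have hT0 : ∀ s, 0 < s → 0 ≤ stieltjesOp F s := fun s hs =>
    integral_nonneg fun y => h.div_nonneg hs y
  have hGm : Measurable G :=
    Measurable.ite (measurableSet_Ioi.inter measurableSet_Iio)
      ((measurable_stieltjesOp h.meas).min measurable_const) measurable_const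
  have hMa : 0 ≤ M / a := by positivity
  have hGnice : IsNice (M / a) G := by
    refine ⟨hGm, fun x => ?_, fun x => ?_, fun x hx => ?_, fun x hx => ?_⟩
    · simp only [hGdef]
      split_ifs with hx
      · exact le_min (hT0 x hx.1) hMa
      · exact le_rfl
    · simp only [hGdef]
      split_ifs with hx
      · exact min_le_right _ _
      · exact hMa
    · simp [hGdef, not_lt.2 hx]
    · simp [hGdef, not_lt.2 hx]
  have hGN : X.Nr G ≤ ENNReal.ofReal c * X.Nr F := by
    refine hc.stieltjes h hN hGm hGnice.nonneg hGnice.left fun x hx => ?_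
    simp only [hGdef]
    split_ifs
    · exact min_le_left _ _
    · exact hT0 x hx
  have := hc.stieltjes hGnice (hGN.trans_lt (ENNReal.mul_lt_top ENNReal.ofReal_lt_top hN))
    (G := fun x => a * Real.log a⁻¹ / 4 * F (a * x))
    ((h.meas.comp (measurable_const_mul a)).const_mul _)
    (fun x => mul_nonneg (by positivity) (h.nonneg _))
    (fun x hx => by rw [h.left _ (mul_nonpos_of_nonneg_of_nonpos ha.le hx), mul_zero])
    fun x hx => ?_
  · refine le_trans (le_of_eq ?_) (this.trans (by gcongr))
    rw [Nr, Nr, ← X.norm_smul]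
    congr 1
    ext x
    rw [abs_mul, abs_of_pos (by positivity : 0 < a * Real.log a⁻¹ / 4),
      ENNReal.ofReal_mul (by positivity)]
    rfl
  · have hax : 0 < a * x := by positivity
    rcases le_or_gt M (a * x) with hxM | hxM
    · rw [h.right _ hxM, mul_zero]
      exact integral_nonneg fun y => hGnice.div_nonneg hx y
    have hxMa : x < M / a := by rw [lt_div_iff₀ ha]; linarith
    have hxa : a * x ≤ x := by nlinarith
    have h1 : ∫ y in a * x..x, (a * F (a * x) / 4) * y⁻¹ =
        a * Real.log a⁻¹ / 4 * F (a * x) := by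
      rw [intervalIntegral.integral_const_mul, integral_inv_of_pos hax hx]
      have : x / (a * x) = a⁻¹ := by field_simp
      rw [this]; ring
    rw [← h1]
    refine hGnice.le_stieltjesOp hx hxa (ContinuousOn.mul continuousOn_const
      (continuousOn_inv₀.mono fun y hy => (hax.trans_le hy.1).ne')) fun s hs => ?_
    have hs0 : 0 < s := hax.trans hs.1
    have hFax := h.nonneg (a * x)
    have hGs : a * x * F (a * x) / (2 * s) ≤ G s := by
      simp only [hGdef, hs0, hs.2.trans hxMa, and_self, if_true]
      refine le_min ?_ ?_
      · have h2 : ∫ y in (0 : ℝ)..a * x, F (a * x) / (2 * s) = a * x * F (a * x) / (2 * s) := by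
          rw [intervalIntegral.integral_const, smul_eq_mul]; ring
        rw [← h2]
        refine h.le_stieltjesOp hs0 hax.le continuousOn_const fun y hy => ?_
        have hy0 := hy.1
        gcongr
        · exact h.nonneg y
        · exact hanti y _ hy.1 hy.2.le
        · linarith [hs.1, hy.2]
      · calc a * x * F (a * x) / (2 * s) ≤ F (a * x) := by
              rw [div_le_iff₀ (by positivity)]
              nlinarith [hs.1]
          _ ≤ M := h.le _
          _ ≤ M / a := le_div_self hM ha ha1.le
    calc a * F (a * x) / 4 * s⁻¹ = (a * x * F (a * x) / (2 * s)) / (x + x) := by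
          field_simp; ring
      _ ≤ G s / (x + s) := by
        gcongr
        · exact hGnice.nonneg s
        · exact hs.2.le

lemma isNice_starReal_truncAbs {f : ℝ → ℝ} (n : ℕ) :
    IsNice (2 * n) (starReal (truncAbs n f)) := by
  refine ⟨measurable_starReal _, starReal_nonneg _, fun x => ?_,
    fun x hx => starReal_of_nonpos _ hx, fun x hx => ?_⟩
  · have hn : starReal (truncAbs n f) x ≤ n := by
      refine ENNReal.toReal_le_of_le_ofReal (by positivity) (not_lt.1 fun hlt => ?_)
      have : x ∈ {x | ENNReal.ofReal n < starHL (fun y => ENNReal.ofReal |truncAbs n f y|) x} := hlt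
      rw [lt_starHL_iff] at this
      have h0 : {y | ENNReal.ofReal n < ENNReal.ofReal |truncAbs n f y|} = ∅ := by
        ext y
        simp only [mem_ofPred_eq, mem_empty_iff_false, iff_false, not_lt,
          abs_of_nonneg (truncAbs_nonneg _ _ _)]
        exact ENNReal.ofReal_le_ofReal (truncAbs_le n f y)
      rw [h0] at this
      simpa using this.2
    have : (0 : ℝ) ≤ n := by positivity
    linarith
  · by_contra hne
    have h1 : 0 < starHL (fun y => ENNReal.ofReal |truncAbs n f y|) x := by
      rw [pos_iff_ne_zero]
      intro h
      exact hne (by simp [starReal, h])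
    have : x ∈ {x | 0 < starHL (fun y => ENNReal.ofReal |truncAbs n f y|) x} := h1
    rw [lt_starHL_iff] at this
    have h2 : volume {y | 0 < ENNReal.ofReal |truncAbs n f y|} ≤ ENNReal.ofReal (2 * n) := by
      have : {y | 0 < ENNReal.ofReal |truncAbs n f y|} ⊆ Icc (-(n : ℝ)) n := by
        intro y hy
        refine abs_le.1 (not_lt.1 fun h => ?_)
        have hy' : 0 < ENNReal.ofReal |truncAbs n f y| := hy
        simp [truncAbs_eq_zero h] at hy'
      refine (measure_mono this).trans (le_of_eq ?_)
      rw [Real.volume_Icc]; ring_nf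
    exact absurd (this.2.trans_le h2) (not_lt.2 (ENNReal.ofReal_le_ofReal hx))

lemma le_of_ofReal_mul_le {k : ℝ} (hk : 0 < k) {x y : ℝ≥0∞} (h : ENNReal.ofReal k * x ≤ y) :
    x ≤ ENNReal.ofReal k⁻¹ * y := by
  calc x = ENNReal.ofReal k⁻¹ * (ENNReal.ofReal k * x) := by
        rw [← mul_assoc, ← ENNReal.ofReal_mul (by positivity), inv_mul_cancel₀ hk.ne']; simp
    _ ≤ _ := by gcongr

lemma dilBound_of_isNice {a K : ℝ} (ha : 0 < a)
    (H : ∀ (M : ℝ) (F : ℝ → ℝ), IsNice M F → X.Nr F < ∞ →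
      (∀ s t, 0 < s → s ≤ t → F t ≤ F s) →
      X.Nr (dil a F) ≤ ENNReal.ofReal K * X.Nr F) : X.DilBound a (X.C * K) := by
  refine dilBound_of_truncAbs ha fun n f hf hN => ?_
  have htm := aemeasurable_truncAbs hf n
  have htN : X.Nr (truncAbs n f) < ∞ := (X.Nr_le_of_abs_le hf htm fun x => by
      rw [abs_of_nonneg (truncAbs_nonneg n f x)]; exact truncAbs_le_abs n f x).trans_lt hN
  rw [← Nr_dil_starReal htm htN ha, ← Nr_starReal htm htN]
  exact H _ _ (isNice_starReal_truncAbs n) (by rwa [Nr_starReal htm htN])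
    fun s t hs hst => starReal_antitoneOn htm htN hs hst

lemma HilbertBound.boyd {c : ℝ} (hc : X.HilbertBound c) (hc0 : 0 < c) :
    1 < lowerBoyd X ∧ upperBoyd X < ∞ := by
  have hC := X.C_pos
  constructor
  · set L := 8 * X.C * c ^ 2 with hL
    have hL0 : 0 < L := by positivity
    set a := Real.exp (-L) with ha
    have ha0 : 0 < a := Real.exp_pos _
    have ha1 : a < 1 := Real.exp_lt_one_iff.2 (by linarith)
    have hlog : Real.log a⁻¹ = L := by rw [Real.log_inv, ha, Real.log_exp, neg_neg]
    refine one_lt_lowerBoyd (a := a) (K := X.C * ((a * L / 4)⁻¹ * (c * c)))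
      (dilBound_of_isNice ha0 fun M F hF hN hanti => ?_) ha0 ha1 ?_
    · have := hc.dil_small hF hN hanti ha0 ha1
      rw [hlog] at this
      refine (le_of_ofReal_mul_le (by positivity) this).trans (le_of_eq ?_)
      rw [ENNReal.ofReal_mul (by positivity), ENNReal.ofReal_mul hc0.le]
      ring
    · have : X.C * ((a * L / 4)⁻¹ * (c * c)) * a = 1 / 2 := by
        rw [hL]; field_simp; norm_num
      rw [this]; norm_num
  · set L := 4 * X.C * c with hL
    have hL0 : 0 < L := by positivity
    set b := Real.exp L with hb
    have hb1 : 1 < b := Real.one_lt_exp_iff.2 hL0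
    have hlog : Real.log b = L := by rw [hb, Real.log_exp]
    refine upperBoyd_lt_top (b := b) (K := X.C * ((L / 2)⁻¹ * c))
      (dilBound_of_isNice (by positivity) fun M F hF hN hanti => ?_) hb1 (by positivity) ?_
    · have := hc.dil_large hF hN hanti hb1
      rw [hlog] at this
      refine (le_of_ofReal_mul_le (by positivity) this).trans (le_of_eq ?_)
      rw [ENNReal.ofReal_mul (by positivity)]
      ring
    · have : X.C * ((L / 2)⁻¹ * c) = 1 / 2 := by
        rw [hL]; field_simp; norm_num
      rw [this]; norm_num

end RIQB

/-! ### The Cauchy integral -/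

/-- The analytic extension `i ∫ f(y) / (z - y) dy` of (`π` times) a function on the line to the
upper half plane. -/
def cauchyInt (f : ℝ → ℝ) (z : ℂ) : ℂ := ∫ y, (f y : ℂ) * (Complex.I / (z - y))

/-- Integrability against the kernel `1 / (1 + |y|)`. -/
def CauchyIntegrable (f : ℝ → ℝ) : Prop := Integrable (fun y => f y * (1 + |y|)⁻¹) volume

lemma im_le_norm_sub (z : ℂ) (y : ℝ) : z.im ≤ ‖z - y‖ := by
  simpa using (le_abs_self _).trans (Complex.abs_im_le_norm (z - y))

lemma sub_ofReal_ne_zero {z : ℂ} (hz : 0 < z.im) (y : ℝ) : z - y ≠ 0 :=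
  norm_pos_iff.1 (hz.trans_le (im_le_norm_sub z y))

lemma inv_norm_sub_le {z : ℂ} {h R : ℝ} (hh : 0 < h) (hz : h ≤ z.im) (hR : ‖z‖ ≤ R) (y : ℝ) :
    ‖z - y‖⁻¹ ≤ ((1 + R) / h + 1) * (1 + |y|)⁻¹ := by
  have h1 : h ≤ ‖z - y‖ := hz.trans (im_le_norm_sub z y)
  have h2 : |y| ≤ ‖z - y‖ + ‖z‖ := by
    have : ‖(y : ℂ)‖ ≤ ‖z - y‖ + ‖z‖ := by
      calc ‖(y : ℂ)‖ = ‖z - (z - y)‖ := by congr 1; ring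
        _ ≤ ‖z‖ + ‖z - y‖ := norm_sub_le _ _
        _ = _ := add_comm _ _
    simpa using this
  have h3 : 0 < ‖z - y‖ := hh.trans_le h1
  have hR0 : 0 ≤ R := (norm_nonneg _).trans hR
  rw [← div_eq_mul_inv, le_div_iff₀ (by positivity), inv_mul_le_iff₀ h3]
  have : 1 + R ≤ ‖z - y‖ * ((1 + R) / h) := by
    rw [mul_div_assoc', le_div_iff₀ hh]; nlinarith
  nlinarith

variable {f g : ℝ → ℝ}

lemma CauchyIntegrable.aesm (hf : CauchyIntegrable f) : AEStronglyMeasurable f volume := by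
  have h : AEStronglyMeasurable (fun y : ℝ => (f y * (1 + |y|)⁻¹) * (1 + |y|)) volume :=
    hf.1.mul (by fun_prop)
  refine h.congr (ae_of_all _ fun y => ?_)
  have : (0 : ℝ) < 1 + |y| := by positivity
  field_simp

lemma Integrable.cauchyIntegrable (hf : Integrable f volume) : CauchyIntegrable f := by
  refine hf.mono (hf.1.mul (Measurable.aestronglyMeasurable (by fun_prop))) (ae_of_all _ fun y => ?_)
  rw [norm_mul]
  refine mul_le_of_le_one_right (norm_nonneg _) ?_
  rw [Real.norm_of_nonneg (by positivity)]
  exact inv_le_one_of_one_le₀ (by linarith [abs_nonneg y])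

lemma measurable_kernel (z : ℂ) : Measurable fun y : ℝ => Complex.I / (z - y) := by fun_prop

lemma CauchyIntegrable.integrable (hf : CauchyIntegrable f) {z : ℂ} (hz : 0 < z.im) :
    Integrable (fun y : ℝ => (f y : ℂ) * (Complex.I / (z - y))) volume := by
  refine (hf.norm.const_mul ((1 + ‖z‖) / z.im + 1)).mono'
    ((Complex.continuous_ofReal.comp_aestronglyMeasurable hf.aesm).mul
      (measurable_kernel z).aestronglyMeasurable) (ae_of_all _ fun y => ?_)
  rw [norm_mul, norm_div, Complex.norm_I, Complex.norm_real, norm_mul,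
    Real.norm_of_nonneg (show (0 : ℝ) ≤ (1 + |y|)⁻¹ by positivity), one_div]
  calc ‖f y‖ * ‖z - y‖⁻¹ ≤ ‖f y‖ * (((1 + ‖z‖) / z.im + 1) * (1 + |y|)⁻¹) := by
        gcongr; exact inv_norm_sub_le hz le_rfl le_rfl y
    _ = _ := by ring

lemma CauchyIntegrable.hasDerivAt (hf : CauchyIntegrable f) {z : ℂ} (hz : 0 < z.im) :
    HasDerivAt (cauchyInt f) (∫ y, (f y : ℂ) * (-Complex.I / (z - y) ^ 2)) z := by
  set h := z.im / 2 with hh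
  have h0 : 0 < h := by positivity
  have hball : ∀ x ∈ Metric.ball z h, h ≤ x.im ∧ ‖x‖ ≤ ‖z‖ + h := by
    intro x hx
    rw [mem_ball_iff_norm] at hx
    have h1 : |x.im - z.im| ≤ ‖x - z‖ := by simpa using Complex.abs_im_le_norm (x - z)
    have h2 := norm_sub_norm_le x z
    constructor
    · have := (abs_le.1 h1).1
      linarith
    · linarith
  refine (hasDerivAt_integral_of_dominated_loc_of_deriv_le
    (F := fun z (y : ℝ) => (f y : ℂ) * (Complex.I / (z - y)))
    (F' := fun z (y : ℝ) => (f y : ℂ) * (-Complex.I / (z - y) ^ 2))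
    (bound := fun y => (h⁻¹ * ((1 + (‖z‖ + h)) / h + 1)) * ‖f y * (1 + |y|)⁻¹‖)
    (Metric.ball_mem_nhds z h0) ?_ (hf.integrable hz) ?_ ?_ (hf.norm.const_mul _) ?_).2
  · filter_upwards with x
    exact (Complex.continuous_ofReal.comp_aestronglyMeasurable hf.aesm).mul
      (measurable_kernel x).aestronglyMeasurable
  · exact (Complex.continuous_ofReal.comp_aestronglyMeasurable hf.aesm).mul
      (Measurable.aestronglyMeasurable (by fun_prop))
  · refine ae_of_all _ fun y x hx => ?_
    obtain ⟨h1, h2⟩ := hball x hx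
    rw [norm_mul, norm_div, norm_neg, Complex.norm_I, Complex.norm_real, norm_mul, norm_pow,
      Real.norm_of_nonneg (show (0 : ℝ) ≤ (1 + |y|)⁻¹ by positivity), one_div]
    have h3 := inv_norm_sub_le h0 h1 h2 y
    have h4 : ‖x - y‖⁻¹ ≤ h⁻¹ := inv_anti₀ h0 (h1.trans (im_le_norm_sub x y))
    calc ‖f y‖ * (‖x - y‖ ^ 2)⁻¹ = ‖f y‖ * (‖x - y‖⁻¹ * ‖x - y‖⁻¹) := by
          rw [← mul_inv, ← sq]
      _ ≤ ‖f y‖ * (h⁻¹ * (((1 + (‖z‖ + h)) / h + 1) * (1 + |y|)⁻¹)) := by gcongr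
      _ = _ := by ring
  · refine ae_of_all _ fun y x hx => ?_
    have hx0 := sub_ofReal_ne_zero (h0.trans_le (hball x hx).1) y
    have := (((hasDerivAt_id x).sub_const (y : ℂ)).inv hx0).const_mul ((f y : ℂ) * Complex.I)
    refine (this.congr_deriv (by simp; ring)).congr_of_eventuallyEq
      (Eventually.of_forall fun z => ?_)
    simp only [Pi.inv_apply, id]; ring

lemma CauchyIntegrable.differentiableOn (hf : CauchyIntegrable f) :
    DifferentiableOn ℂ (cauchyInt f) {z | 0 < z.im} := fun _ hz =>
  (hf.hasDerivAt hz).differentiableAt.differentiableWithinAt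

lemma kernel_re_im (x y ε : ℝ) : Complex.I / ((x + ε * Complex.I : ℂ) - y) =
    ((ε / ((x - y) ^ 2 + ε ^ 2) : ℝ) : ℂ) + ((x - y) / ((x - y) ^ 2 + ε ^ 2) : ℝ) * Complex.I := by
  by_cases h : (x + ε * Complex.I : ℂ) - y = 0
  · have h1 := congrArg Complex.re h
    have h2 := congrArg Complex.im h
    simp at h1 h2
    rw [h, h1, h2]; simp
  · have h0 : (x - y) ^ 2 + ε ^ 2 ≠ 0 := by
      intro h0
      apply h
      have h1 : x - y = 0 := by nlinarith [sq_nonneg (x - y), sq_nonneg ε]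
      have h2 : ε = 0 := by nlinarith [sq_nonneg (x - y), sq_nonneg ε]
      apply Complex.ext <;> simp [h1, h2]
    have h0' : ((x : ℂ) - y) ^ 2 + ε ^ 2 ≠ 0 := by exact_mod_cast h0
    rw [div_eq_iff h]
    push_cast
    field_simp
    ring_nf
    simp only [Complex.I_sq]
    ring

lemma CauchyIntegrable.integrable_real (hf : CauchyIntegrable f) (x : ℝ) {ε : ℝ} (hε : 0 < ε) :
    Integrable (fun y => f y * (ε / ((x - y) ^ 2 + ε ^ 2))) volume ∧
    Integrable (fun y => f y * ((x - y) / ((x - y) ^ 2 + ε ^ 2))) volume := by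
  have h := hf.integrable (z := x + ε * Complex.I) (by simpa using hε)
  simp only [kernel_re_im] at h
  constructor
  · refine h.re.congr (ae_of_all _ fun y => ?_)
    simp [-Complex.ofReal_div]
  · refine h.im.congr (ae_of_all _ fun y => ?_)
    simp [-Complex.ofReal_div]

lemma CauchyIntegrable.cauchyInt_re (hf : CauchyIntegrable f) (x : ℝ) {ε : ℝ} (hε : 0 < ε) :
    (cauchyInt f (x + ε * Complex.I)).re = ∫ y, f y * (ε / ((x - y) ^ 2 + ε ^ 2)) := by
  have h := hf.integrable (z := x + ε * Complex.I) (by simpa using hε)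
  have := integral_re h
  simp only [kernel_re_im] at this
  rw [cauchyInt]
  simp only [kernel_re_im]
  refine this.symm.trans (integral_congr_ae (ae_of_all _ fun y => ?_))
  simp [-Complex.ofReal_div]

lemma CauchyIntegrable.cauchyInt_im (hf : CauchyIntegrable f) (x : ℝ) {ε : ℝ} (hε : 0 < ε) :
    (cauchyInt f (x + ε * Complex.I)).im = ∫ y, f y * ((x - y) / ((x - y) ^ 2 + ε ^ 2)) := by
  have h := hf.integrable (z := x + ε * Complex.I) (by simpa using hε)
  have := integral_im h
  simp only [kernel_re_im] at this
  rw [cauchyInt]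
  simp only [kernel_re_im]
  refine this.symm.trans (integral_congr_ae (ae_of_all _ fun y => ?_))
  simp [-Complex.ofReal_div]

lemma CauchyIntegrable.cauchyInt_add (hf : CauchyIntegrable f) (hg : CauchyIntegrable g) {z : ℂ}
    (hz : 0 < z.im) : cauchyInt (fun x => f x + g x) z = cauchyInt f z + cauchyInt g z := by
  rw [cauchyInt, cauchyInt, cauchyInt, ← integral_add (hf.integrable hz) (hg.integrable hz)]
  congr 1; ext y; push_cast; ring

lemma cauchyInt_const_mul (c : ℝ) (z : ℂ) :
    cauchyInt (fun x => c * f x) z = c * cauchyInt f z := by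
  rw [cauchyInt, cauchyInt, ← integral_const_mul]
  congr 1; ext y; push_cast; ring

lemma CauchyIntegrable.continuous_line (hf : CauchyIntegrable f) {ε : ℝ} (hε : 0 < ε) :
    Continuous fun x : ℝ => cauchyInt f (x + ε * Complex.I) := by
  rw [continuous_iff_continuousAt]
  intro x
  have : ContinuousAt (cauchyInt f) (x + ε * Complex.I) :=
    (hf.hasDerivAt (by simpa using hε)).continuousAt
  exact ContinuousAt.comp (f := fun x : ℝ => (x + ε * Complex.I : ℂ)) this (by fun_prop)

lemma CauchyIntegrable.cauchyInt_re_nonneg (hf : CauchyIntegrable f) (h0 : ∀ x, 0 ≤ f x) {z : ℂ}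
    (hz : 0 < z.im) : 0 ≤ (cauchyInt f z).re := by
  rw [← Complex.re_add_im z, hf.cauchyInt_re _ hz]
  exact integral_nonneg fun y => mul_nonneg (h0 y) (by positivity)

lemma norm_integral_line_le {G : ℂ → ℂ} {ε K R : ℝ} (hε : 0 < ε)
    (hG : DifferentiableOn ℂ G {z | 0 < z.im}) (hR : 0 < R) (hK0 : 0 ≤ K)
    (hK : ∀ z : ℂ, ε ≤ z.im → R ≤ ‖z‖ → ‖G z‖ ≤ K / ‖z‖) :
    ‖∫ x in (-R)..R, G (x + ε * Complex.I)‖ ≤ 4 * K := by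
  have hK' : ∀ z : ℂ, ε ≤ z.im → R ≤ ‖z‖ → ‖G z‖ ≤ K / R := fun z h1 h2 =>
    (hK z h1 h2).trans (by gcongr)
  have key := Complex.integral_boundary_rect_eq_zero_of_differentiableOn G
    (-R + ε * Complex.I) (R + (ε + R : ℝ) * Complex.I) (hG.mono fun z hz => by
      have h := hz.2
      rw [mem_preimage, uIcc_of_le (by simp; linarith)] at h
      have := h.1
      simp at this
      exact hε.trans_le this)
  simp only [Complex.add_re, Complex.neg_re, Complex.ofReal_re, Complex.mul_re, Complex.I_re,
    mul_zero, Complex.ofReal_im, Complex.I_im, mul_one, sub_self, add_zero, Complex.add_im,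
    Complex.neg_im, neg_zero, Complex.mul_im, zero_add] at key
  set A := ∫ x in (-R)..R, G (x + ε * Complex.I)
  have hB : ‖∫ x in (-R)..R, G (x + (ε + R : ℝ) * Complex.I)‖ ≤ K / R * |R - -R| := by
    refine intervalIntegral.norm_integral_le_of_norm_le_const fun x _ => hK' _ (by simp; linarith) ?_
    have := Complex.abs_im_le_norm (x + (ε + R : ℝ) * Complex.I)
    simp at this
    rw [abs_of_pos (by positivity)] at this
    push_cast
    linarith
  have hside : ∀ r : ℝ, |r| = R →
      ‖∫ y in ε..(ε + R), G (r + y * Complex.I)‖ ≤ K / R * |ε + R - ε| := by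
    intro r hr
    refine intervalIntegral.norm_integral_le_of_norm_le_const fun y hy => hK' _ ?_ ?_
    · rw [uIoc_of_le (by linarith)] at hy
      simpa using hy.1.le
    · have := Complex.abs_re_le_norm (r + y * Complex.I)
      simp at this
      linarith
  have hC := hside R (abs_of_pos hR)
  have hD := hside (-R) (by rw [abs_neg, abs_of_pos hR])
  rw [show |R - -R| = 2 * R by rw [abs_of_pos] <;> linarith] at hB
  rw [show |ε + R - ε| = R by rw [abs_of_pos] <;> linarith] at hC hD
  set B := ∫ x in (-R)..R, G (x + (ε + R : ℝ) * Complex.I)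
  push_cast at hD key
  set C := ∫ y in ε..(ε + R), G (R + y * Complex.I)
  set D := ∫ y in ε..(ε + R), G (-R + y * Complex.I)
  have hA : A = B - Complex.I • C + Complex.I • D := by linear_combination key
  have e1 : K / R * (2 * R) = 2 * K := by field_simp
  have e2 : K / R * R = K := by field_simp
  rw [e1] at hB
  rw [e2] at hC hD
  calc ‖A‖ ≤ ‖B‖ + ‖C‖ + ‖D‖ := by
        rw [hA]
        refine (norm_add_le _ _).trans ?_
        gcongr
        · refine (norm_sub_le _ _).trans ?_
          simp
        · simp
    _ ≤ 4 * K := by linarith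

/-- Bounded integrable functions with bounded support: the Cauchy integral decays. -/
lemma norm_cauchyInt_le {f : ℝ → ℝ} (hf : Integrable f volume) {M : ℝ}
    (hM : ∀ y, M < |y| → f y = 0) {z : ℂ} (hz : 2 * M ≤ ‖z‖) (hz0 : z ≠ 0) :
    ‖cauchyInt f z‖ ≤ 2 * (∫ y, |f y|) / ‖z‖ := by
  have hz1 : 0 < ‖z‖ := norm_pos_iff.2 hz0
  calc ‖cauchyInt f z‖ ≤ ∫ y, 2 / ‖z‖ * |f y| := by
        refine norm_integral_le_of_norm_le (hf.abs.const_mul _) (ae_of_all _ fun y => ?_)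
        by_cases hy : M < |y|
        · simp [hM y hy]
        rw [norm_mul, Complex.norm_real, norm_div, Complex.norm_I, Real.norm_eq_abs, mul_comm]
        refine mul_le_mul_of_nonneg_right ?_ (abs_nonneg _)
        have : ‖z‖ / 2 ≤ ‖z - y‖ := by
          have h1 := norm_sub_norm_le z (y : ℂ)
          rw [Complex.norm_real, Real.norm_eq_abs] at h1
          linarith [not_lt.1 hy]
        rw [div_le_div_iff₀ (lt_of_lt_of_le (by positivity) this) hz1]
        linarith
    _ = _ := by rw [integral_const_mul]; ring

/-- If `Re Φ(w)` dominates `ρ` along a horizontal line, where `Φ` is analytic and vanishes at the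
origin, then the integral of `ρ` is controlled by the `L¹` norm of the boundary function. -/
lemma lintegral_le_of_re_cauchyInt {f : ℝ → ℝ} (hf : Integrable f volume) {M : ℝ}
    (hM : ∀ y, M < |y| → f y = 0) (h0 : ∀ y, 0 ≤ f y) {Φ : ℂ → ℂ} {A r : ℝ} (hA : 0 ≤ A)
    (hr : 0 < r) (hΦ : ∀ w : ℂ, 0 ≤ w.re → DifferentiableAt ℂ Φ w)
    (hΦ0 : ∀ w : ℂ, 0 ≤ w.re → ‖w‖ ≤ r → ‖Φ w‖ ≤ A * ‖w‖) {ε : ℝ} (hε : 0 < ε)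
    {ρ : ℝ → ℝ} (hρ : ∀ x, 0 ≤ ρ x)
    (h : ∀ x : ℝ, ρ x ≤ (Φ (cauchyInt f (x + ε * Complex.I))).re) :
    ∫⁻ x, ENNReal.ofReal (ρ x) ≤ ENNReal.ofReal (8 * A * ∫ y, f y) := by
  have hci := Integrable.cauchyIntegrable hf
  have hI : ∫ y, |f y| = ∫ y, f y := by simp [abs_of_nonneg (h0 _)]
  have hI0 : 0 ≤ ∫ y, f y := integral_nonneg h0
  set J := ∫ y, f y with hJ
  set G : ℂ → ℂ := fun z => Φ (cauchyInt f z) with hG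
  have hGd : DifferentiableOn ℂ G {z | 0 < z.im} := fun z hz =>
    (DifferentiableAt.comp z (hΦ _ (hci.cauchyInt_re_nonneg h0 hz))
      (hci.hasDerivAt hz).differentiableAt).differentiableWithinAt
  have hGc : Continuous fun x : ℝ => G (x + ε * Complex.I) := by
    rw [continuous_iff_continuousAt]
    intro x
    have hx : 0 < ((x : ℂ) + ε * Complex.I).im := by simpa using hε
    have : ContinuousAt G (x + ε * Complex.I) :=
      ((hGd _ hx).differentiableAt ((isOpen_lt continuous_const Complex.continuous_im).mem_nhds
        hx)).continuousAt
    exact ContinuousAt.comp (f := fun x : ℝ => (x + ε * Complex.I : ℂ)) this (by fun_prop)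
  set R₀ := max 1 (max (2 * M) (2 * J / r)) with hR₀
  have key : ∀ R : ℝ, R₀ ≤ R →
      ∫⁻ x in Ioc (-R) R, ENNReal.ofReal (ρ x) ≤ ENNReal.ofReal (8 * A * J) := by
    intro R hR
    have hR1 : 0 < R := lt_of_lt_of_le one_pos ((le_max_left _ _).trans hR)
    have hR2 : 2 * M ≤ R := ((le_max_left _ _).trans (le_max_right _ _)).trans hR
    have hR3 : 2 * J / r ≤ R := ((le_max_right _ _).trans (le_max_right _ _)).trans hR
    have hb := norm_integral_line_le (K := 2 * A * J) hε hGd hR1 (by positivity) fun z hz1 hz2 => by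
      have hz0 : 0 < ‖z‖ := hR1.trans_le hz2
      have h1 := norm_cauchyInt_le hf hM (hR2.trans hz2) (norm_pos_iff.1 hz0)
      rw [hI] at h1
      have h2 : 2 * J / ‖z‖ ≤ r := by
        rw [div_le_iff₀ hz0]
        rw [div_le_iff₀ hr] at hR3
        nlinarith
      calc ‖G z‖ ≤ A * ‖cauchyInt f z‖ :=
            hΦ0 _ (hci.cauchyInt_re_nonneg h0 (hε.trans_le hz1)) (h1.trans h2)
        _ ≤ A * (2 * J / ‖z‖) := by gcongr
        _ = _ := by ring
    have hGi : IntegrableOn (fun x : ℝ => G (x + ε * Complex.I)) (Ioc (-R) R) volume :=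
      (hGc.integrableOn_Icc).mono_set Ioc_subset_Icc_self
    calc ∫⁻ x in Ioc (-R) R, ENNReal.ofReal (ρ x)
        ≤ ∫⁻ x in Ioc (-R) R, ENNReal.ofReal (G (x + ε * Complex.I)).re :=
          lintegral_mono fun x => ENNReal.ofReal_le_ofReal (h x)
      _ = ENNReal.ofReal (∫ x in Ioc (-R) R, (G (x + ε * Complex.I)).re) :=
          (ofReal_integral_eq_lintegral_ofReal hGi.re
            (ae_of_all _ fun x => (hρ x).trans (h x))).symm
      _ ≤ _ := by
          apply ENNReal.ofReal_le_ofReal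
          have h3 := integral_re hGi
          simp only [RCLike.re_to_complex] at h3
          rw [h3, ← intervalIntegral.integral_of_le (by linarith)]
          exact ((Complex.re_le_norm _).trans hb).trans (le_of_eq (by ring))
  have hU : (⋃ n : ℕ, Ioc (-(n : ℝ)) n) = univ := by
    refine eq_univ_of_forall fun x => mem_iUnion.2 ?_
    obtain ⟨n, hn⟩ := exists_nat_gt |x|
    exact ⟨n, (abs_lt.1 hn).1, (abs_lt.1 hn).2.le⟩
  have hmono : Monotone fun n : ℕ => Ioc (-(n : ℝ)) n := fun m n hmn => by
    have : (m : ℝ) ≤ n := by exact_mod_cast hmn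
    exact Ioc_subset_Ioc (neg_le_neg this) this
  rw [← setLIntegral_univ, ← hU, setLIntegral_iUnion_of_directed _ hmono.directed_le]
  refine iSup_le fun n => ?_
  obtain ⟨m, hm⟩ := exists_nat_ge R₀
  exact (lintegral_mono_set (hmono (le_max_left n m))).trans
    (key _ (hm.trans (by exact_mod_cast le_max_right n m)))

lemma integral_poisson (x : ℝ) {ε : ℝ} (hε : 0 < ε) :
    Integrable (fun y : ℝ => ε / ((x - y) ^ 2 + ε ^ 2)) volume ∧
    ∫ y : ℝ, ε / ((x - y) ^ 2 + ε ^ 2) = Real.pi := by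
  have e : ∀ y : ℝ, ε / ((x - y) ^ 2 + ε ^ 2) = ε⁻¹ * (1 + (ε⁻¹ * (x - y)) ^ 2)⁻¹ := by
    intro y
    have : (x - y) ^ 2 + ε ^ 2 ≠ 0 := by positivity
    field_simp
    ring
  simp only [e]
  have h1 : Integrable (fun y : ℝ => (1 + (ε⁻¹ * y) ^ 2)⁻¹) volume :=
    integrable_inv_one_add_sq.comp_mul_left' (inv_ne_zero hε.ne')
  constructor
  · exact (h1.comp_sub_left x).const_mul _
  · rw [integral_const_mul, integral_sub_left_eq_self (fun y : ℝ => (1 + (ε⁻¹ * y) ^ 2)⁻¹) volume x,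
      Measure.integral_comp_mul_left (fun y : ℝ => (1 + y ^ 2)⁻¹), integral_univ_inv_one_add_sq]
    rw [inv_inv, abs_of_pos hε, smul_eq_mul]
    field_simp

lemma measurableSet_lt_abs_im {f : ℝ → ℝ} (hf : CauchyIntegrable f) {ε : ℝ} (hε : 0 < ε) (l : ℝ) :
    MeasurableSet {x : ℝ | l < |(cauchyInt f (x + ε * Complex.I)).im|} :=
  (isOpen_lt continuous_const
    (Complex.continuous_im.comp (hf.continuous_line hε)).abs).measurableSet

lemma mul_volume_le_of_re_cauchyInt {f : ℝ → ℝ} (hf : Integrable f volume) {M : ℝ}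
    (hM : ∀ y, M < |y| → f y = 0) (h0 : ∀ y, 0 ≤ f y) {Φ : ℂ → ℂ} {A r : ℝ} (hA : 0 ≤ A)
    (hr : 0 < r) (hΦ : ∀ w : ℂ, 0 ≤ w.re → DifferentiableAt ℂ Φ w)
    (hΦ0 : ∀ w : ℂ, 0 ≤ w.re → ‖w‖ ≤ r → ‖Φ w‖ ≤ A * ‖w‖) {ε : ℝ} (hε : 0 < ε)
    (hpos : ∀ x : ℝ, 0 ≤ (Φ (cauchyInt f (x + ε * Complex.I))).re) {k l : ℝ} (hk : 0 ≤ k)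
    (h : ∀ x : ℝ, l < |(cauchyInt f (x + ε * Complex.I)).im| →
      k ≤ (Φ (cauchyInt f (x + ε * Complex.I))).re) :
    ENNReal.ofReal k * volume {x : ℝ | l < |(cauchyInt f (x + ε * Complex.I)).im|} ≤
      ENNReal.ofReal (8 * A * ∫ y, f y) := by
  set S := {x : ℝ | l < |(cauchyInt f (x + ε * Complex.I)).im|} with hS
  have hSm : MeasurableSet S :=
    measurableSet_lt_abs_im (Integrable.cauchyIntegrable hf) hε l
  refine le_trans (le_of_eq ?_) (lintegral_le_of_re_cauchyInt hf hM h0 hA hr hΦ hΦ0 hε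
    (ρ := S.indicator fun _ => k) (fun x => indicator_nonneg (fun _ _ => hk) x) fun x => ?_)
  · rw [← lintegral_indicator_const hSm]
    refine lintegral_congr fun x => ?_
    by_cases hx : x ∈ S <;> simp [hx]
  · by_cases hx : x ∈ S
    · rw [indicator_of_mem hx]; exact h x hx
    · rw [indicator_of_notMem hx]; exact hpos x

lemma volume_lt_abs_im_le_div {f : ℝ → ℝ} (hf : Integrable f volume) {M : ℝ}
    (hM : ∀ y, M < |y| → f y = 0) (h0 : ∀ y, 0 ≤ f y) {ε l : ℝ} (hε : 0 < ε) (hl : 0 < l) :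
    volume {x : ℝ | l < |(cauchyInt f (x + ε * Complex.I)).im|} ≤
      ENNReal.ofReal (32 / l * ∫ y, f y) := by
  have hci := Integrable.cauchyIntegrable hf
  have hne : ∀ w : ℂ, 0 ≤ w.re → w + l ≠ 0 := fun w hw h => by
    have := congrArg Complex.re h
    simp at this
    linarith
  have hre : ∀ w : ℂ, (w / (w + l)).re =
      (w.re ^ 2 + w.im ^ 2 + l * w.re) / ((w.re + l) ^ 2 + w.im ^ 2) := fun w => by
    rw [Complex.div_re, Complex.normSq_apply, ← add_div]
    simp only [Complex.add_re, Complex.ofReal_re, Complex.add_im, Complex.ofReal_im, add_zero]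
    congr 1 <;> ring
  have key := mul_volume_le_of_re_cauchyInt (l := l) (k := 1 / 4) hf hM h0
    (Φ := fun w => w / (w + l)) (A := l⁻¹)
    (by positivity) one_pos (fun w hw => by
      exact differentiableAt_id.div (by fun_prop) (hne w hw)) (fun w hw _ => by
      have h1 : l ≤ ‖w + l‖ := by
        have := Complex.re_le_norm (w + l)
        simp at this
        linarith
      rw [norm_div, div_eq_inv_mul]
      gcongr) hε (fun x => by
      have hw := hci.cauchyInt_re_nonneg h0 (z := x + ε * Complex.I) (by simpa using hε)
      rw [hre]
      positivity) (by norm_num) (fun x hx => by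
      have hw := hci.cauchyInt_re_nonneg h0 (z := x + ε * Complex.I) (by simpa using hε)
      rw [hre, div_le_div_iff₀ (by norm_num) (by positivity)]
      have : l ^ 2 ≤ (cauchyInt f (x + ε * Complex.I)).im ^ 2 := by
        rw [← sq_abs (cauchyInt f _).im]
        gcongr
      nlinarith [sq_nonneg (cauchyInt f (x + ε * Complex.I)).re, mul_nonneg hl.le hw])
  refine (RIQB.le_of_ofReal_mul_le (by norm_num) key).trans (le_of_eq ?_)
  rw [← ENNReal.ofReal_mul (by norm_num)]
  congr 1
  field_simp
  ring

lemma norm_cos_sub_one_le {w : ℂ} (hw : ‖w‖ ≤ 1) : ‖Complex.cos w - 1‖ ≤ ‖w‖ := by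
  have h1 := Complex.norm_exp_sub_one_sub_id_le (x := w * Complex.I) (by simpa using hw)
  have h2 := Complex.norm_exp_sub_one_sub_id_le (x := -w * Complex.I) (by simpa using hw)
  have e : Complex.cos w - 1 = ((Complex.exp (w * Complex.I) - 1 - w * Complex.I) +
      (Complex.exp (-w * Complex.I) - 1 - -w * Complex.I)) / 2 := by
    rw [Complex.cos]; ring
  rw [e, norm_div]
  have h3 := norm_add_le (Complex.exp (w * Complex.I) - 1 - w * Complex.I)
    (Complex.exp (-w * Complex.I) - 1 - -w * Complex.I)
  simp only [norm_mul, norm_neg, Complex.norm_I, mul_one, Complex.norm_ofNat] at h1 h2 ⊢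
  nlinarith [norm_nonneg w]

lemma volume_lt_abs_im_le_exp {f : ℝ → ℝ} (hf : Integrable f volume) {M : ℝ}
    (hM : ∀ y, M < |y| → f y = 0) (h0 : ∀ y, 0 ≤ f y) (h1 : ∀ y, f y ≤ 1 / 4) {ε l : ℝ}
    (hε : 0 < ε) (hl : 2 ≤ l) :
    volume {x : ℝ | l < |(cauchyInt f (x + ε * Complex.I)).im|} ≤
      ENNReal.ofReal (192 * Real.exp (-l) * ∫ y, f y) := by
  have hci := Integrable.cauchyIntegrable hf
  have hre : ∀ w : ℂ, (Complex.cos w - 1 + 2 * w).re =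
      Real.cos w.re * Real.cosh w.im - 1 + 2 * w.re := fun w => by
    conv_lhs => rw [Complex.cos_eq]
    simp [← Complex.ofReal_cos, ← Complex.ofReal_cosh, ← Complex.ofReal_sin, ← Complex.ofReal_sinh]
  have hu : ∀ x : ℝ, (cauchyInt f (x + ε * Complex.I)).re ≤ 1 := by
    intro x
    rw [hci.cauchyInt_re _ hε]
    calc ∫ y, f y * (ε / ((x - y) ^ 2 + ε ^ 2)) ≤ ∫ y, 1 / 4 * (ε / ((x - y) ^ 2 + ε ^ 2)) := by
          refine integral_mono (hci.integrable_real x hε).1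
            ((integral_poisson x hε).1.const_mul _) fun y => ?_
          exact mul_le_mul_of_nonneg_right (h1 y) (by positivity)
      _ ≤ 1 := by
          rw [integral_const_mul, (integral_poisson x hε).2]
          linarith [Real.pi_le_four]
  have hge : ∀ x : ℝ, (Real.cosh (cauchyInt f (x + ε * Complex.I)).im - 1) / 2 ≤
      (Complex.cos (cauchyInt f (x + ε * Complex.I)) - 1 +
        2 * cauchyInt f (x + ε * Complex.I)).re := by
    intro x
    rw [hre]
    have hw := hci.cauchyInt_re_nonneg h0 (z := x + ε * Complex.I) (by simpa using hε)
    have hw1 := hu x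
    set u := (cauchyInt f (x + ε * Complex.I)).re
    have hc := Real.one_sub_sq_div_two_le_cos (x := u)
    have hch := Real.one_le_cosh (cauchyInt f (x + ε * Complex.I)).im
    have hcu : 1 / 2 ≤ Real.cos u := by nlinarith
    nlinarith [mul_nonneg (sub_nonneg.2 hcu) (sub_nonneg.2 hch),
      mul_nonneg hw (sub_nonneg.2 hw1)]
  have hexp : 0 < Real.exp l := Real.exp_pos l
  have key := mul_volume_le_of_re_cauchyInt (l := l) (k := Real.exp l / 8) hf hM h0
    (Φ := fun w => Complex.cos w - 1 + 2 * w) (A := 3)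
    (by positivity) one_pos (fun w hw => by fun_prop) (fun w hw hw1 => by
      refine (norm_add_le _ _).trans ?_
      have := norm_cos_sub_one_le hw1
      simp only [norm_mul, Complex.norm_ofNat]
      linarith) hε (fun x => le_trans
        (by linarith [Real.one_le_cosh (cauchyInt f (x + ε * Complex.I)).im]) (hge x))
      (by positivity) (fun x hx => by
      refine le_trans ?_ (hge x)
      rw [← Real.cosh_abs]
      have h2 : Real.exp l ≤ Real.exp |(cauchyInt f (x + ε * Complex.I)).im| :=
        Real.exp_le_exp.2 hx.le
      have h3 := Real.cosh_eq |(cauchyInt f (x + ε * Complex.I)).im|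
      have h4 := Real.exp_pos (-|(cauchyInt f (x + ε * Complex.I)).im|)
      have h5 : 4 ≤ Real.exp l := by
        have h6 := Real.add_one_le_exp (1 : ℝ)
        have h7 : Real.exp 2 ≤ Real.exp l := Real.exp_le_exp.2 hl
        have h8 : Real.exp 2 = Real.exp 1 * Real.exp 1 := by rw [← Real.exp_add]; norm_num
        nlinarith
      linarith)
  refine (RIQB.le_of_ofReal_mul_le (by positivity) key).trans (le_of_eq ?_)
  rw [← ENNReal.ofReal_mul (by positivity), Real.exp_neg]
  congr 1
  field_simp
  ring

lemma volume_add_lt_abs_im_le {f g : ℝ → ℝ} (hf : CauchyIntegrable f) (hg : CauchyIntegrable g)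
    {ε : ℝ} (hε : 0 < ε) (l m : ℝ) :
    volume {x : ℝ | l + m < |(cauchyInt (fun y => f y + g y) (x + ε * Complex.I)).im|} ≤
      volume {x : ℝ | l < |(cauchyInt f (x + ε * Complex.I)).im|} +
      volume {x : ℝ | m < |(cauchyInt g (x + ε * Complex.I)).im|} := by
  refine (measure_mono fun x hx => ?_).trans (measure_union_le _ _)
  have hx' : l + m < |(cauchyInt (fun y => f y + g y) (x + ε * Complex.I)).im| := hx
  rw [hf.cauchyInt_add hg (by simpa using hε), Complex.add_im] at hx'
  by_contra h
  simp only [mem_union, mem_ofPred_eq, not_or, not_lt] at h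
  linarith [abs_add_le (cauchyInt f (x + ε * Complex.I)).im (cauchyInt g (x + ε * Complex.I)).im]

lemma volume_lt_abs_im_le_of_le {f : ℝ → ℝ} (hf : Integrable f volume) {M : ℝ}
    (hM : ∀ y, M < |y| → f y = 0) (h0 : ∀ y, 0 ≤ f y) {a m : ℝ} (h1 : ∀ y, f y ≤ a)
    (hm : ∫ y, f y ≤ a * m) {ε l : ℝ} (hε : 0 < ε) (hl : 2 ≤ l) :
    volume {x : ℝ | 4 * a * l < |(cauchyInt f (x + ε * Complex.I)).im|} ≤
      ENNReal.ofReal (192 * Real.exp (-l) * m) := by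
  rcases ((h0 0).trans (h1 0)).eq_or_lt with ha | ha
  · have : f = fun _ => 0 := funext fun y => le_antisymm (ha ▸ h1 y) (h0 y)
    simp [← ha, this, cauchyInt]
  · have key := volume_lt_abs_im_le_exp (f := fun y => (4 * a)⁻¹ * f y) (hf.const_mul _) (M := M)
      (fun y hy => by simp [hM y hy]) (fun y => mul_nonneg (by positivity) (h0 y))
      (fun y => by rw [inv_mul_le_iff₀ (by positivity)]; linarith [h1 y]) hε hl
    simp only [cauchyInt_const_mul, Complex.im_ofReal_mul] at key
    have e : {x : ℝ | 4 * a * l < |(cauchyInt f (x + ε * Complex.I)).im|} =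
        {x : ℝ | l < |(4 * a)⁻¹ * (cauchyInt f (x + ε * Complex.I)).im|} := by
      ext x
      simp only [mem_ofPred_eq]
      rw [abs_mul, abs_of_pos (a := (4 * a)⁻¹) (by positivity), lt_inv_mul_iff₀ (by positivity)]
    rw [e]
    refine key.trans (ENNReal.ofReal_le_ofReal ?_)
    rw [integral_const_mul]
    gcongr
    rw [inv_mul_le_iff₀ (by positivity)]
    have : 0 ≤ a * m := (integral_nonneg h0).trans hm
    linarith

lemma integral_indicator_le_mul {f : ℝ → ℝ} {s T : Set ℝ} (hT : MeasurableSet T) {a m : ℝ}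
    (ha : 0 ≤ a) (hm : 0 ≤ m) (hst : s ⊆ T) (hs : ∀ y ∈ s, f y ≤ a)
    (hTm : volume T ≤ ENNReal.ofReal m) : ∫ y, s.indicator f y ≤ a * m := by
  have hT' : volume T < ∞ := hTm.trans_lt ENNReal.ofReal_lt_top
  by_cases hi : Integrable (s.indicator f) volume
  · calc ∫ y, s.indicator f y ≤ ∫ y, T.indicator (fun _ => a) y := by
          refine integral_mono hi ((integrable_indicator_iff hT).2
            (integrableOn_const hT'.ne)) fun y => ?_
          by_cases hy : y ∈ s
          · simp [hy, hst hy, hs y hy]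
          · rw [indicator_of_notMem hy]; exact indicator_nonneg (fun _ _ => ha) _
      _ = a * volume.real T := by
          rw [integral_indicator_const _ hT, smul_eq_mul, mul_comm]
      _ ≤ a * m := by
          gcongr
          exact ENNReal.toReal_le_of_le_ofReal hm hTm
  · rw [integral_undef hi]; positivity

/-- A distributional estimate for the conjugate Poisson integral of a bounded function with bounded
support, in terms of upper bounds `a k` for the decreasing rearrangement at `B ^ k * t`. -/
lemma volume_lt_abs_im_le_three {f : ℝ → ℝ} (hfm : Measurable f) (hf : Integrable f volume) {M : ℝ}
    (hM : ∀ y, M < |y| → f y = 0) (h0 : ∀ y, 0 ≤ f y) {a : ℕ → ℝ} (ha0 : ∀ k, 0 ≤ a k)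
    {B t S ε : ℝ} (hB : 2 ≤ B) (ht : 0 < t) (hS : 0 < S) (hε : 0 < ε)
    (ha : ∀ k, volume {y | a k < f y} ≤ ENNReal.ofReal (B ^ k * t))
    (hS0 : ∫ y, {y | a 0 < f y}.indicator f y ≤ S * t)
    (hS1 : ∀ K, ∑ k ∈ Finset.range K, (k + 1) * a k ≤ S) (hanti : Antitone a) :
    volume {x : ℝ | (32 + 4 * Real.log (384 * B)) * S <
      |(cauchyInt f (x + ε * Complex.I)).im|} ≤ ENNReal.ofReal (3 * t) := by
  set L := Real.log (384 * B) with hL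
  have hexpL : Real.exp L = 384 * B := Real.exp_log (by positivity)
  have hL2 : 2 ≤ L := by
    rw [hL, Real.le_log_iff_exp_le (by positivity)]
    have h8 : Real.exp 2 = Real.exp 1 * Real.exp 1 := by rw [← Real.exp_add]; norm_num
    have := Real.exp_one_lt_d9
    have := Real.exp_pos 1
    nlinarith
  have hms : ∀ c, MeasurableSet {y | c < f y} := fun c => hfm measurableSet_Ioi
  have hms' : ∀ c, MeasurableSet {y | f y ≤ c} := fun c => hfm measurableSet_Iic
  have hpiece : ∀ s : Set ℝ, MeasurableSet s → Integrable (s.indicator f) volume ∧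
      (∀ y, M < |y| → s.indicator f y = 0) ∧ (∀ y, 0 ≤ s.indicator f y) := fun s hs =>
    ⟨hf.indicator hs, fun y hy => by simp [hM y hy],
      fun y => indicator_nonneg (fun y _ => h0 y) y⟩
  have hlevel : ∀ k : ℕ, 2 ≤ L * (k + 1) := fun k => by
    have : (0 : ℝ) ≤ k := by positivity
    nlinarith
  have hbd : ∀ k : ℕ, 192 * Real.exp (-(L * (k + 1))) * (B ^ (k + 1) * t) ≤
      (1 / 2) ^ (k + 1) * t := by
    intro k
    have e : Real.exp (-(L * (k + 1))) = ((384 * B) ^ (k + 1))⁻¹ := by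
      rw [Real.exp_neg, mul_comm L]
      have := Real.exp_nat_mul L (k + 1)
      push_cast at this
      rw [this, hexpL]
    rw [e, mul_pow]
    have h1 : (384 : ℝ) ^ (k + 1) = 192 ^ (k + 1) * 2 ^ (k + 1) := by rw [← mul_pow]; norm_num
    have h2 : (192 : ℝ) ≤ 192 ^ (k + 1) := by
      calc (192 : ℝ) = 192 ^ 1 := by norm_num
        _ ≤ _ := pow_le_pow_right₀ (by norm_num) (by omega)
    have hB0 : 0 < B := by linarith
    rw [h1, one_div, inv_pow]
    have : 192 * (192 ^ (k + 1) * 2 ^ (k + 1) * B ^ (k + 1))⁻¹ * (B ^ (k + 1) * t) =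
        (192 / 192 ^ (k + 1)) * ((2 ^ (k + 1))⁻¹ * t) := by field_simp
    rw [this]
    refine mul_le_of_le_one_left (by positivity) ?_
    rw [div_le_one (by positivity)]; exact h2
  have hmain : ∀ K, volume {x : ℝ | 32 * S + ∑ k ∈ Finset.range K, 4 * a k * (L * (k + 1)) <
      |(cauchyInt ({y | a K < f y}.indicator f) (x + ε * Complex.I)).im|} ≤
      ENNReal.ofReal ((2 - (1 / 2) ^ K) * t) := by
    intro K
    induction K with
    | zero =>
      obtain ⟨i1, i2, i3⟩ := hpiece _ (hms (a 0))
      simp only [Finset.range_zero, Finset.sum_empty, add_zero, pow_zero]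
      refine (volume_lt_abs_im_le_div i1 i2 i3 hε (by positivity)).trans
        (ENNReal.ofReal_le_ofReal ?_)
      calc 32 / (32 * S) * ∫ y, {y | a 0 < f y}.indicator f y
          ≤ 32 / (32 * S) * (S * t) := by gcongr
        _ = (2 - 1) * t := by field_simp; norm_num
    | succ K ih =>
      obtain ⟨i1, i2, i3⟩ := hpiece _ (hms (a K))
      obtain ⟨j1, j2, j3⟩ := hpiece _ ((hms (a (K + 1))).inter (hms' (a K)))
      have e : {y | a (K + 1) < f y}.indicator f = fun y => {y | a K < f y}.indicator f y +
          ({y | a (K + 1) < f y} ∩ {y | f y ≤ a K}).indicator f y := by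
        ext y
        have := hanti (Nat.le_succ K)
        simp only [indicator_apply, mem_inter_iff, mem_ofPred_eq]
        by_cases h1 : a K < f y
        · simp [h1, this.trans_lt h1, not_le.2 h1]
        · simp [h1, not_lt.1 h1]
      rw [e, Finset.sum_range_succ, ← add_assoc]
      refine (volume_add_lt_abs_im_le (Integrable.cauchyIntegrable i1)
        (Integrable.cauchyIntegrable j1) hε _ _).trans ?_
      have hp := volume_lt_abs_im_le_of_le (a := a K) (m := B ^ (K + 1) * t) (l := L * (K + 1))
        j1 j2 j3 (fun y => by
          rw [indicator_apply]
          split_ifs with h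
          · exact h.2
          · exact ha0 K)
        (integral_indicator_le_mul (hms (a (K + 1))) (ha0 K) (by positivity) inter_subset_left
          (fun y hy => hy.2) (ha (K + 1))) hε (hlevel K)
      refine (add_le_add ih (hp.trans (ENNReal.ofReal_le_ofReal (hbd K)))).trans ?_
      have : (1 / 2 : ℝ) ^ K ≤ 1 := pow_le_one₀ (by norm_num) (by norm_num)
      rw [← ENNReal.ofReal_add (mul_nonneg (by linarith) ht.le) (by positivity)]
      refine ENNReal.ofReal_le_ofReal (le_of_eq ?_)
      rw [pow_succ]; ring
  obtain ⟨K, hK⟩ := pow_unbounded_of_one_lt (2 * |M| / t) (show 1 < B by linarith)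
  obtain ⟨i1, i2, i3⟩ := hpiece _ (hms (a K))
  obtain ⟨j1, j2, j3⟩ := hpiece _ (hms' (a K))
  have e : f = fun y => {y | a K < f y}.indicator f y + {y | f y ≤ a K}.indicator f y := by
    ext y
    simp only [indicator_apply, mem_ofPred_eq]
    by_cases h1 : a K < f y
    · simp [h1, not_le.2 h1]
    · simp [h1, not_lt.1 h1]
  have hp := volume_lt_abs_im_le_of_le (a := a K) (m := B ^ (K + 1) * t) (l := L * (K + 1))
    j1 j2 j3 (fun y => by
      rw [indicator_apply]
      split_ifs with h
      · exact h
      · exact ha0 K)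
    (by
      have : {y | f y ≤ a K}.indicator f = ({y | f y ≤ a K} ∩ Icc (-|M|) |M|).indicator f := by
        ext y
        simp only [indicator_apply, mem_inter_iff]
        by_cases hy : y ∈ Icc (-|M|) |M|
        · simp [hy]
        · have hfy : f y = 0 := hM y (lt_of_not_ge fun h => hy (abs_le.1 (h.trans (le_abs_self M))))
          simp [hfy]
      rw [this]
      refine integral_indicator_le_mul measurableSet_Icc (ha0 K) (by positivity)
        inter_subset_right (fun y hy => hy.1) ?_
      rw [Real.volume_Icc]
      apply ENNReal.ofReal_le_ofReal
      rw [div_lt_iff₀ ht] at hK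
      have h3 : B ^ K * t ≤ B ^ (K + 1) * t := by
        gcongr
        · linarith
        · omega
      linarith) hε (hlevel K)
  have hsub : {x : ℝ | (32 + 4 * L) * S < |(cauchyInt f (x + ε * Complex.I)).im|} ⊆
      {x : ℝ | (32 * S + ∑ k ∈ Finset.range K, 4 * a k * (L * (k + 1))) +
        4 * a K * (L * (K + 1)) < |(cauchyInt (fun y => {y | a K < f y}.indicator f y +
          {y | f y ≤ a K}.indicator f y) (x + ε * Complex.I)).im|} := by
    intro x hx
    rw [← e]
    refine lt_of_le_of_lt ?_ (show (32 + 4 * L) * S < _ from hx)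
    rw [add_assoc, ← Finset.sum_range_succ fun k : ℕ => 4 * a k * (L * (k + 1))]
    have : ∑ k ∈ Finset.range (K + 1), 4 * a k * (L * (k + 1)) =
        4 * L * ∑ k ∈ Finset.range (K + 1), (k + 1) * a k := by
      rw [Finset.mul_sum]
      exact Finset.sum_congr rfl fun k _ => by ring
    rw [this]
    nlinarith [hS1 (K + 1)]
  refine (measure_mono hsub).trans ((volume_add_lt_abs_im_le (Integrable.cauchyIntegrable i1)
    (Integrable.cauchyIntegrable j1) hε _ _).trans ((add_le_add (hmain K)
      (hp.trans (ENNReal.ofReal_le_ofReal (hbd K)))).trans ?_))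
  have h1 : (1 / 2 : ℝ) ^ K ≤ 1 := pow_le_one₀ (by norm_num) (by norm_num)
  have h2 : (1 / 2 : ℝ) ^ (K + 1) ≤ 1 := pow_le_one₀ (by norm_num) (by norm_num)
  have h3 : 0 ≤ (1 / 2 : ℝ) ^ K := by positivity
  rw [← ENNReal.ofReal_add (mul_nonneg (by linarith) ht.le) (by positivity)]
  refine ENNReal.ofReal_le_ofReal ?_
  nlinarith

/-! ### Discrete Hardy operators -/

lemma volume_le_of_eventually {s : ℕ → Set ℝ} {T : Set ℝ} {m : ℝ≥0∞} (hs : ∀ n, volume (s n) ≤ m)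
    (hT : ∀ᵐ x, x ∈ T → ∀ᶠ n in atTop, x ∈ s n) : volume T ≤ m := by
  have hmono : Monotone fun N : ℕ => ⋂ n ≥ N, s n := fun M N h =>
    biInter_subset_biInter_left fun n hn => h.trans hn
  calc volume T ≤ volume (⋃ N : ℕ, ⋂ n ≥ N, s n) := by
        refine measure_mono_ae ?_
        filter_upwards [hT] with x hx hxT
        obtain ⟨N, hN⟩ := eventually_atTop.1 (hx hxT)
        exact mem_iUnion.2 ⟨N, mem_iInter₂.2 hN⟩
    _ ≤ m := by
        rw [hmono.measure_iUnion]
        exact iSup_le fun N => (measure_mono (biInter_subset_of_mem le_rfl)).trans (hs N)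

/-- The terms of the discrete version of the sum of the Hardy operator and its dual. -/
def hardyTerm (B : ℝ) (F : ℝ → ℝ) (k : ℕ) (t : ℝ) : ℝ :=
  (k + 1) * F (B ^ k * t) + (B ^ k)⁻¹ * F ((B ^ (k + 1))⁻¹ * t)

/-- A discrete version of the sum of the Hardy operator and its dual. -/
def hardySum (B : ℝ) (F : ℝ → ℝ) (t : ℝ) : ℝ≥0∞ := ∑' k, ENNReal.ofReal (hardyTerm B F k t)

/-- `F` bounds the decreasing rearrangement of `f` from above. -/
structure RearrBound (f F : ℝ → ℝ) : Prop where
  nonneg : ∀ s, 0 ≤ F s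
  anti : ∀ s t, 0 < s → s ≤ t → F t ≤ F s
  dist : ∀ s, 0 < s → volume {y | F s < f y} ≤ ENNReal.ofReal s

namespace RearrBound

variable {f F : ℝ → ℝ} {B t : ℝ}

lemma sum_le (h : RearrBound f F) (hB : 0 < B) :
    ∑' k : ℕ, ENNReal.ofReal ((k + 1) * F (B ^ k * t)) ≤ hardySum B F t := by
  refine ENNReal.tsum_le_tsum fun k => ENNReal.ofReal_le_ofReal ?_
  have := h.nonneg ((B ^ (k + 1))⁻¹ * t)
  rw [hardyTerm]
  exact le_add_of_nonneg_right (by positivity)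

lemma lintegral_le (h : RearrBound f F) (hfm : Measurable f) (hB : 2 ≤ B) (ht : 0 < t) :
    ∫⁻ y, ENNReal.ofReal ({y | F t < f y}.indicator f y) ≤
      hardySum B F t * ENNReal.ofReal t := by
  have hB0 : 0 < B := by linarith
  set b : ℕ → ℝ := fun k => F ((B ^ k)⁻¹ * t) with hb
  have hbt : b 0 = F t := by simp [hb]
  have hms : ∀ c, MeasurableSet {y | c < f y} := fun c => hfm measurableSet_Ioi
  have hnull : ∀ᵐ y, ∃ k, f y ≤ b k := by
    have : volume {y | ∀ k, b k < f y} ≤ 0 := by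
      have hlim : Tendsto (fun k : ℕ => ENNReal.ofReal ((B ^ k)⁻¹ * t)) atTop (𝓝 0) := by
        have h1 : Tendsto (fun k : ℕ => (B⁻¹) ^ k * t) atTop (𝓝 (0 * t)) :=
          (_root_.tendsto_pow_atTop_nhds_zero_of_lt_one (by positivity)
            (inv_lt_one_of_one_lt₀ (by linarith))).mul_const t
        rw [zero_mul] at h1
        simpa using (ENNReal.tendsto_ofReal h1)
      refine ge_of_tendsto' hlim fun k => ?_
      refine (measure_mono fun y hy => ?_).trans (h.dist ((B ^ k)⁻¹ * t) (by positivity))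
      exact (show ∀ k, b k < f y from hy) k
    rw [ae_iff]
    simpa using this
  calc ∫⁻ y, ENNReal.ofReal ({y | F t < f y}.indicator f y)
      ≤ ∫⁻ y, ∑' k, {y | b k < f y}.indicator (fun _ => ENNReal.ofReal (b (k + 1))) y := by
        refine lintegral_mono_ae ?_
        filter_upwards [hnull] with y hy
        by_cases hty : F t < f y
        · classical
          have hk := Nat.find_spec hy
          have hk0 : Nat.find hy ≠ 0 := by
            intro h0
            rw [h0, hbt] at hk
            exact absurd hty (not_lt.2 hk)
          obtain ⟨m, hm⟩ := Nat.exists_eq_succ_of_ne_zero hk0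
          have hlt : b m < f y := not_le.1 (Nat.find_min hy (by omega))
          refine le_trans ?_ (ENNReal.le_tsum m)
          rw [indicator_of_mem (show y ∈ {y | F t < f y} from hty),
            indicator_of_mem (show y ∈ {y | b m < f y} from hlt)]
          rw [hm] at hk
          exact ENNReal.ofReal_le_ofReal hk
        · simp [hty]
    _ = ∑' k, ENNReal.ofReal (b (k + 1)) * volume {y | b k < f y} := by
        rw [lintegral_tsum fun k => (measurable_const.indicator (hms _)).aemeasurable]
        exact tsum_congr fun k => lintegral_indicator_const (hms _) _
    _ ≤ ∑' k, ENNReal.ofReal (hardyTerm B F k t) * ENNReal.ofReal t := by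
        refine ENNReal.tsum_le_tsum fun k => ?_
        have h1 : 0 ≤ b (k + 1) := h.nonneg _
        have h2 : 0 ≤ F (B ^ k * t) := h.nonneg _
        calc ENNReal.ofReal (b (k + 1)) * volume {y | b k < f y}
            ≤ ENNReal.ofReal (b (k + 1)) * ENNReal.ofReal ((B ^ k)⁻¹ * t) := by
              gcongr; exact h.dist _ (by positivity)
          _ = ENNReal.ofReal ((B ^ k)⁻¹ * b (k + 1)) * ENNReal.ofReal t := by
              rw [← ENNReal.ofReal_mul h1, ← ENNReal.ofReal_mul (by positivity)]
              congr 1; ring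
          _ ≤ _ := by
              gcongr
              rw [hardyTerm]
              exact le_add_of_nonneg_left (by positivity)
    _ = _ := ENNReal.tsum_mul_right

end RearrBound

lemma integral_Icc_inv_one_add_abs {m : ℝ} (hm : 0 ≤ m) :
    ∫ y in (-m)..m, (1 + |y|)⁻¹ = 2 * Real.log (1 + m) := by
  have hc : Continuous fun y : ℝ => (1 + |y|)⁻¹ :=
    Continuous.inv₀ (by fun_prop) fun y => by positivity
  have h1 : ∫ y in (0 : ℝ)..m, (1 + |y|)⁻¹ = Real.log (1 + m) := by
    rw [intervalIntegral.integral_eq_sub_of_hasDerivAt (f := fun y => Real.log (1 + y))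
      (fun y hy => ?_) (hc.intervalIntegrable _ _)]
    · simp
    · rw [uIcc_of_le hm] at hy
      have := ((hasDerivAt_id y).const_add 1).log (by have := hy.1; simp; linarith)
      simpa [abs_of_nonneg hy.1] using this
  have h2 : ∫ y in (-m)..0, (1 + |y|)⁻¹ = Real.log (1 + m) := by
    rw [← h1, ← neg_zero, ← intervalIntegral.integral_comp_neg]
    simp
  rw [← intervalIntegral.integral_add_adjacent_intervals (b := 0) (hc.intervalIntegrable _ _)
    (hc.intervalIntegrable _ _), h1, h2]
  ring

lemma lintegral_inv_one_add_abs_le {E : Set ℝ} (hEm : MeasurableSet E) {m : ℝ} (hm : 0 ≤ m)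
    (hE : volume E ≤ ENNReal.ofReal m) :
    ∫⁻ y in E, ENNReal.ofReal (1 + |y|)⁻¹ ≤ ENNReal.ofReal (2 * Real.log (1 + m) + 1) := by
  have hc : Continuous fun y : ℝ => (1 + |y|)⁻¹ :=
    Continuous.inv₀ (by fun_prop) fun y => by positivity
  have hlog : 0 ≤ Real.log (1 + m) := Real.log_nonneg (by linarith)
  have h1 : ∫⁻ y in Ioc (-m) m, ENNReal.ofReal (1 + |y|)⁻¹ = ENNReal.ofReal (2 * Real.log (1 + m)) := by
    rw [← integral_Icc_inv_one_add_abs hm, intervalIntegral.integral_of_le (by linarith),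
      ofReal_integral_eq_lintegral_ofReal ((hc.integrableOn_Icc).mono_set Ioc_subset_Icc_self)
        (ae_of_all _ fun y => by positivity)]
  calc ∫⁻ y in E, ENNReal.ofReal (1 + |y|)⁻¹
      ≤ ∫⁻ y in Ioc (-m) m ∪ (E \ Ioc (-m) m), ENNReal.ofReal (1 + |y|)⁻¹ :=
        lintegral_mono_set (by simp)
    _ ≤ (∫⁻ y in Ioc (-m) m, ENNReal.ofReal (1 + |y|)⁻¹) +
        ∫⁻ y in E \ Ioc (-m) m, ENNReal.ofReal (1 + |y|)⁻¹ := lintegral_union_le _ _ _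
    _ ≤ ENNReal.ofReal (2 * Real.log (1 + m)) + 1 := by
        gcongr
        · exact h1.le
        · calc ∫⁻ y in E \ Ioc (-m) m, ENNReal.ofReal (1 + |y|)⁻¹
              ≤ ∫⁻ y in E \ Ioc (-m) m, ENNReal.ofReal (1 + m)⁻¹ := by
                refine setLIntegral_mono' (hEm.diff measurableSet_Ioc) fun y hy => ?_
                refine ENNReal.ofReal_le_ofReal (inv_anti₀ (by positivity) ?_)
                by_contra! h
                have h' := abs_lt.1 (show |y| < m by linarith)
                exact hy.2 ⟨h'.1, h'.2.le⟩
            _ ≤ ENNReal.ofReal (1 + m)⁻¹ * ENNReal.ofReal m := by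
                rw [setLIntegral_const]
                gcongr
                exact (measure_mono sdiff_subset).trans hE
            _ ≤ 1 := by
                rw [← ENNReal.ofReal_mul (by positivity), ENNReal.ofReal_le_one,
                  inv_mul_le_iff₀ (by positivity)]
                linarith
    _ = _ := by rw [ENNReal.ofReal_add (by positivity) (by norm_num)]; simp

lemma tendsto_cauchyInt_truncAbs {f : ℝ → ℝ} (hfm : Measurable f) (hf : CauchyIntegrable f)
    (h0 : ∀ y, 0 ≤ f y) {z : ℂ} (hz : 0 < z.im) :
    Tendsto (fun n => cauchyInt (truncAbs n f) z) atTop (𝓝 (cauchyInt f z)) := by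
  refine tendsto_integral_of_dominated_convergence _ (fun n => ?_) (hf.integrable hz).norm
    (fun n => ae_of_all _ fun y => ?_) (ae_of_all _ fun y => ?_)
  · exact ((Complex.measurable_ofReal.comp (measurable_truncAbs hfm n)).mul
      (measurable_kernel z)).aestronglyMeasurable
  · rw [norm_mul, norm_mul, Complex.norm_real, Complex.norm_real, Real.norm_eq_abs,
      Real.norm_eq_abs, abs_of_nonneg (truncAbs_nonneg n f y)]
    gcongr
    exact truncAbs_le_abs n f y
  · refine tendsto_const_nhds.congr' ?_
    filter_upwards [truncAbs_eventually_eq f y] with n hn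
    rw [hn, abs_of_nonneg (h0 y)]

namespace RearrBound

variable {f F : ℝ → ℝ} {B t : ℝ}

lemma cauchyIntegrable (h : RearrBound f F) (hfm : Measurable f) (h0 : ∀ y, 0 ≤ f y) (hB : 2 ≤ B)
    (ht : 0 < t) (hfin : hardySum B F t < ∞) : CauchyIntegrable f := by
  have hB0 : 0 < B := by linarith
  set a : ℕ → ℝ := fun k => F (B ^ k * t) with ha
  have hat : a 0 = F t := by simp [ha]
  have ha0 : ∀ k, 0 ≤ a k := fun k => h.nonneg _
  have hms : ∀ c, MeasurableSet {y | c < f y} := fun c => hfm measurableSet_Ioi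
  have hsum : ∑' k : ℕ, ENNReal.ofReal ((k + 1) * a k) < ∞ := (h.sum_le hB0).trans_lt hfin
  have hpt : ∀ y, ENNReal.ofReal (f y) ≤ ENNReal.ofReal ({y | F t < f y}.indicator f y) +
      ∑' k, {y | a (k + 1) < f y}.indicator (fun _ => ENNReal.ofReal (a k)) y := by
    intro y
    by_cases hty : F t < f y
    · rw [indicator_of_mem (show y ∈ {y | F t < f y} from hty)]
      exact le_self_add
    · rcases (h0 y).eq_or_lt with hy0 | hy0
      · simp [← hy0]
      have hy : ∃ k, a k < f y := by
        by_contra! hcon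
        have : ∑' _ : ℕ, ENNReal.ofReal (f y) ≤ ∑' k : ℕ, ENNReal.ofReal ((k + 1) * a k) :=
          ENNReal.tsum_le_tsum fun k => ENNReal.ofReal_le_ofReal
            ((hcon k).trans (le_mul_of_one_le_left (ha0 k) (by linarith [k.cast_nonneg (α := ℝ)])))
        rw [ENNReal.tsum_const_eq_top_of_ne_zero (by simpa using hy0)] at this
        exact absurd hsum (not_lt.2 this)
      classical
      have hk := Nat.find_spec hy
      have hk0 : Nat.find hy ≠ 0 := by
        intro h0
        rw [h0, hat] at hk
        exact hty hk
      obtain ⟨m, hm⟩ := Nat.exists_eq_succ_of_ne_zero hk0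
      have hle : f y ≤ a m := not_lt.1 (Nat.find_min hy (by omega))
      refine le_trans ?_ le_add_self
      refine le_trans ?_ (ENNReal.le_tsum m)
      rw [hm] at hk
      rw [indicator_of_mem (show y ∈ {y | a (m + 1) < f y} from hk)]
      exact ENNReal.ofReal_le_ofReal hle
  set w : ℝ → ℝ≥0∞ := fun y => ENNReal.ofReal (1 + |y|)⁻¹ with hw
  have hwm : Measurable w := by fun_prop
  have hw1 : ∀ y, w y ≤ 1 := fun y => by
    rw [hw]
    simp only [ENNReal.ofReal_le_one]
    exact inv_le_one_of_one_le₀ (by linarith [abs_nonneg y])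
  set D := 2 * Real.log B + 2 * Real.log (1 + t) + 1 with hD
  have hlB : 0 ≤ Real.log B := Real.log_nonneg (by linarith)
  have hlt : 0 ≤ Real.log (1 + t) := Real.log_nonneg (by linarith)
  have hlog : ∀ k : ℕ, 2 * Real.log (1 + B ^ (k + 1) * t) + 1 ≤ D * (k + 1) := by
    intro k
    have h1 : 1 ≤ B ^ (k + 1) := one_le_pow₀ (by linarith)
    have h2 : Real.log (1 + B ^ (k + 1) * t) ≤ Real.log (B ^ (k + 1) * (1 + t)) :=
      Real.log_le_log (by positivity) (by linarith)
    rw [Real.log_mul (by positivity) (by positivity), Real.log_pow] at h2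
    push_cast at h2
    have : (0 : ℝ) ≤ k := k.cast_nonneg
    nlinarith [mul_nonneg this hlt]
  refine ⟨hfm.aestronglyMeasurable.mul (Measurable.aestronglyMeasurable (by fun_prop)), ?_⟩
  rw [hasFiniteIntegral_iff_ofReal (ae_of_all _ fun y => mul_nonneg (h0 y) (by positivity))]
  calc ∫⁻ y, ENNReal.ofReal (f y * (1 + |y|)⁻¹)
      ≤ ∫⁻ y, (ENNReal.ofReal ({y | F t < f y}.indicator f y) +
        ∑' k, {y | a (k + 1) < f y}.indicator (fun z => ENNReal.ofReal (a k) * w z) y) := by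
        refine lintegral_mono fun y => ?_
        rw [ENNReal.ofReal_mul (h0 y)]
        refine (mul_le_mul_left (hpt y) (w y)).trans ?_
        rw [add_mul, ← ENNReal.tsum_mul_right]
        refine add_le_add (mul_le_of_le_one_right' (hw1 y)) (ENNReal.tsum_le_tsum fun k => ?_)
        rw [← indicator_mul_left]
    _ = (∫⁻ y, ENNReal.ofReal ({y | F t < f y}.indicator f y)) +
        ∑' k, ENNReal.ofReal (a k) * ∫⁻ y in {y | a (k + 1) < f y}, w y := by
        rw [lintegral_add_left (hfm.indicator (hms _)).ennreal_ofReal, lintegral_tsum fun k =>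
          ((hwm.const_mul _).indicator (hms _)).aemeasurable]
        congr 1
        refine tsum_congr fun k => ?_
        rw [lintegral_indicator (hms _), lintegral_const_mul _ hwm]
    _ ≤ hardySum B F t * ENNReal.ofReal t +
        ∑' k : ℕ, ENNReal.ofReal D * ENNReal.ofReal ((k + 1) * a k) := by
        refine add_le_add (h.lintegral_le hfm hB ht) (ENNReal.tsum_le_tsum fun k => ?_)
        refine (mul_le_mul_right (lintegral_inv_one_add_abs_le (hms _) (by positivity)
          (h.dist (B ^ (k + 1) * t) (by positivity))) _).trans ?_
        rw [← ENNReal.ofReal_mul (ha0 k), ← ENNReal.ofReal_mul (by positivity)]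
        refine ENNReal.ofReal_le_ofReal ?_
        calc a k * (2 * Real.log (1 + B ^ (k + 1) * t) + 1) ≤ a k * (D * (k + 1)) :=
              mul_le_mul_of_nonneg_left (hlog k) (ha0 k)
          _ = _ := by ring
    _ < ∞ := by
        rw [ENNReal.tsum_mul_left]
        exact ENNReal.add_lt_top.2 ⟨ENNReal.mul_lt_top hfin ENNReal.ofReal_lt_top,
          ENNReal.mul_lt_top ENNReal.ofReal_lt_top hsum⟩

lemma volume_lt_abs_im_le_of_lt (h : RearrBound f F) (hfm : Measurable f) (h0 : ∀ y, 0 ≤ f y)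
    (hB : 2 ≤ B) (ht : 0 < t) {S : ℝ} (hS : 0 < S) (hfin : hardySum B F t ≤ ENNReal.ofReal S)
    {ε : ℝ} (hε : 0 < ε) :
    volume {x : ℝ | (32 + 4 * Real.log (384 * B)) * S <
      |(cauchyInt f (x + ε * Complex.I)).im|} ≤ ENNReal.ofReal (3 * t) := by
  have hB0 : 0 < B := by linarith
  have hci := h.cauchyIntegrable hfm h0 hB ht (hfin.trans_lt ENNReal.ofReal_lt_top)
  have hle : ∀ n y, truncAbs n f y ≤ f y := fun n y =>
    (truncAbs_le_abs n f y).trans (abs_of_nonneg (h0 y)).le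
  have h_int : ∀ n, Integrable (truncAbs n f) volume := fun n => by
    refine Integrable.mono' (g := (Icc (-(n : ℝ)) n).indicator fun _ => (n : ℝ))
      ((integrable_indicator_iff measurableSet_Icc).2 (integrableOn_const (by simp)))
      (measurable_truncAbs hfm n).aestronglyMeasurable (ae_of_all _ fun y => ?_)
    rw [Real.norm_of_nonneg (truncAbs_nonneg n f y)]
    by_cases hy : y ∈ Icc (-(n : ℝ)) n
    · rw [indicator_of_mem hy]; exact truncAbs_le n f y
    · rw [truncAbs_eq_zero (lt_of_not_ge fun h => hy (abs_le.1 h))]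
      exact indicator_nonneg (fun _ _ => n.cast_nonneg) y
  refine volume_le_of_eventually (s := fun n => {x : ℝ | (32 + 4 * Real.log (384 * B)) * S <
      |(cauchyInt (truncAbs n f) (x + ε * Complex.I)).im|}) (fun n => ?_)
      (ae_of_all _ fun x hx => ?_)
  · refine volume_lt_abs_im_le_three (measurable_truncAbs hfm n) (h_int n) (M := n)
      (fun y hy => truncAbs_eq_zero hy f) (truncAbs_nonneg n f) (a := fun k => F (B ^ k * t))
      (fun k => h.nonneg _) hB ht hS hε (fun k => (measure_mono fun y hy =>
        (show F (B ^ k * t) < truncAbs n f y from hy).trans_le (hle n y)).trans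
          (h.dist _ (by positivity))) ?_ (fun K => ?_) ?_
    · simp only [pow_zero, one_mul]
      have hm : MeasurableSet {y | F t < truncAbs n f y} :=
        measurable_truncAbs hfm n measurableSet_Ioi
      have hnn : ∀ y, 0 ≤ {y | F t < truncAbs n f y}.indicator (truncAbs n f) y := fun y =>
        indicator_nonneg (fun y _ => truncAbs_nonneg n f y) y
      rw [← ENNReal.ofReal_le_ofReal_iff (by positivity),
        ofReal_integral_eq_lintegral_ofReal ((h_int n).indicator hm) (ae_of_all _ hnn),
        ENNReal.ofReal_mul hS.le]
      calc ∫⁻ y, ENNReal.ofReal ({y | F t < truncAbs n f y}.indicator (truncAbs n f) y)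
          ≤ ∫⁻ y, ENNReal.ofReal ({y | F t < f y}.indicator f y) := by
            refine lintegral_mono fun y => ENNReal.ofReal_le_ofReal ?_
            by_cases hy : F t < truncAbs n f y
            · have hy' := hy.trans_le (hle n y)
              rw [indicator_of_mem (show y ∈ {y | F t < truncAbs n f y} from hy),
                indicator_of_mem (show y ∈ {y | F t < f y} from hy')]
              exact hle n y
            · rw [indicator_of_notMem (show y ∉ {y | F t < truncAbs n f y} from hy)]
              exact indicator_nonneg (fun y _ => h0 y) y
        _ ≤ hardySum B F t * ENNReal.ofReal t := h.lintegral_le hfm hB ht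
        _ ≤ _ := by gcongr
    · rw [← ENNReal.ofReal_le_ofReal_iff hS.le, ENNReal.ofReal_sum_of_nonneg fun k _ =>
        mul_nonneg (by positivity) (h.nonneg _)]
      exact (ENNReal.sum_le_tsum _).trans ((h.sum_le hB0).trans hfin)
    · intro m n hmn
      refine h.anti _ _ (by positivity) ?_
      gcongr
      linarith
  · have := (((Complex.continuous_im.tendsto _).comp (tendsto_cauchyInt_truncAbs hfm hci h0
      (z := x + ε * Complex.I) (by simpa using hε))).abs)
    exact this.eventually (lt_mem_nhds hx)

lemma volume_lt_abs_im_le (h : RearrBound f F) (hfm : Measurable f) (h0 : ∀ y, 0 ≤ f y)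
    (hB : 2 ≤ B) (ht : 0 < t) {ε : ℝ} (hε : 0 < ε) :
    volume {x : ℝ | ENNReal.ofReal (32 + 4 * Real.log (384 * B)) * hardySum B F t <
      ENNReal.ofReal |(cauchyInt f (x + ε * Complex.I)).im|} ≤ ENNReal.ofReal (3 * t) := by
  have hL : 0 ≤ Real.log (384 * B) := Real.log_nonneg (by linarith)
  rcases eq_or_ne (hardySum B F t) ∞ with hfin | hfin
  · rw [hfin, ENNReal.mul_top (by positivity)]
    simp
  set S := (hardySum B F t).toReal with hS
  have hS0 : 0 ≤ S := ENNReal.toReal_nonneg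
  have hSe : hardySum B F t = ENNReal.ofReal S := (ENNReal.ofReal_toReal hfin).symm
  refine volume_le_of_eventually (s := fun n : ℕ => {x : ℝ | (32 + 4 * Real.log (384 * B)) *
    (S + 1 / (n + 1)) < |(cauchyInt f (x + ε * Complex.I)).im|}) (fun n => ?_)
      (ae_of_all _ fun x hx => ?_)
  · refine h.volume_lt_abs_im_le_of_lt hfm h0 hB ht (by positivity) ?_ hε
    rw [hSe]
    exact ENNReal.ofReal_le_ofReal (le_add_of_nonneg_right (by positivity))
  · have hx' : ENNReal.ofReal (32 + 4 * Real.log (384 * B)) * hardySum B F t <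
      ENNReal.ofReal |(cauchyInt f (x + ε * Complex.I)).im| := hx
    rw [hSe, ← ENNReal.ofReal_mul (by positivity),
      ENNReal.ofReal_lt_ofReal_iff_of_nonneg (by positivity)] at hx'
    have hlim : Tendsto (fun n : ℕ => (32 + 4 * Real.log (384 * B)) * (S + 1 / ((n : ℝ) + 1)))
        atTop (𝓝 ((32 + 4 * Real.log (384 * B)) * (S + 0))) :=
      (tendsto_const_nhds.add tendsto_one_div_add_atTop_nhds_zero_nat).const_mul _
    rw [add_zero] at hlim
    exact hlim.eventually (gt_mem_nhds hx')

end RearrBound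

lemma poisson_le_tsum {s ε : ℝ} (hε : 0 < ε) :
    ENNReal.ofReal (ε / (s ^ 2 + ε ^ 2)) ≤
      ∑' k : ℕ, (Icc (-(2 ^ k * ε)) (2 ^ k * ε)).indicator
        (fun _ => ENNReal.ofReal (4 * (1 / 4) ^ k / ε)) s := by
  have hex : ∃ k : ℕ, |s| ≤ 2 ^ k * ε := by
    obtain ⟨k, hk⟩ := pow_unbounded_of_one_lt (|s| / ε) (one_lt_two (α := ℝ))
    exact ⟨k, by rw [div_lt_iff₀ hε] at hk; exact hk.le⟩
  classical
  have hk := Nat.find_spec hex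
  refine le_trans ?_ (ENNReal.le_tsum (Nat.find hex))
  rw [indicator_of_mem (show s ∈ Icc _ _ from abs_le.1 hk)]
  apply ENNReal.ofReal_le_ofReal
  rcases Nat.eq_zero_or_pos (Nat.find hex) with h0 | h0
  · rw [h0, pow_zero, div_le_div_iff₀ (by positivity) hε]
    nlinarith [sq_nonneg s]
  · obtain ⟨m, hm⟩ := Nat.exists_eq_succ_of_ne_zero h0.ne'
    have hlt : 2 ^ m * ε < |s| := not_le.1 (Nat.find_min hex (by omega))
    rw [hm, div_le_div_iff₀ (by positivity) hε]
    have h1 : (2 ^ m * ε) ^ 2 ≤ s ^ 2 := by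
      rw [← sq_abs s]; gcongr
    have h2 : (1 / 4 : ℝ) ^ m * (2 ^ m) ^ 2 = 1 := by
      rw [← pow_mul, mul_comm m, pow_mul, ← mul_pow]; norm_num
    have h3 : 0 < (1 / 4 : ℝ) ^ m := by positivity
    rw [Nat.succ_eq_add_one, pow_succ]
    nlinarith [mul_le_mul_of_nonneg_left h1 h3.le, mul_pos h3 (pow_pos hε 2)]

lemma lintegral_mul_poisson_le {g : ℝ → ℝ≥0∞} (hg : AEMeasurable g volume) {x δ ε : ℝ} {η : ℝ≥0∞}
    (hδ : 0 < δ) (hε : 0 < ε)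
    (hη : ∀ r, 0 < r → r ≤ δ → ∫⁻ y in Metric.closedBall x r, g y ≤ η * ENNReal.ofReal r) :
    ∫⁻ y, g y * ENNReal.ofReal (ε / ((x - y) ^ 2 + ε ^ 2)) ≤
      8 * η + ENNReal.ofReal ε * (ENNReal.ofReal ((1 + 2 * x ^ 2) / δ ^ 2 + 2) *
        ∫⁻ y, g y * ENNReal.ofReal (1 + y ^ 2)⁻¹) := by
  have hball : ∀ r y, y ∈ Metric.closedBall x r ↔ |x - y| ≤ r := fun r y => by
    rw [Metric.mem_closedBall, Real.dist_eq, abs_sub_comm]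
  have hnear : ∫⁻ y in Metric.closedBall x δ, g y * ENNReal.ofReal (ε / ((x - y) ^ 2 + ε ^ 2)) ≤
      8 * η := by
    calc ∫⁻ y in Metric.closedBall x δ, g y * ENNReal.ofReal (ε / ((x - y) ^ 2 + ε ^ 2))
        ≤ ∫⁻ y in Metric.closedBall x δ, ∑' k : ℕ, (Metric.closedBall x (2 ^ k * ε)).indicator
            (fun y => ENNReal.ofReal (4 * (1 / 4) ^ k / ε) * g y) y := by
          refine lintegral_mono fun y => ?_
          refine (mul_le_mul_right (poisson_le_tsum hε) (g y)).trans (le_of_eq ?_)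
          rw [← ENNReal.tsum_mul_left]
          refine tsum_congr fun k => ?_
          by_cases hy : |x - y| ≤ 2 ^ k * ε
          · rw [indicator_of_mem ((hball _ y).2 hy), indicator_of_mem (show _ ∈ Icc _ _ from
              abs_le.1 hy), mul_comm]
          · rw [indicator_of_notMem (fun h => hy ((hball _ y).1 h)), indicator_of_notMem
              (show x - y ∉ Icc (-(2 ^ k * ε)) (2 ^ k * ε) from fun h => hy (abs_le.2 h)), mul_zero]
      _ = ∑' k : ℕ, ENNReal.ofReal (4 * (1 / 4) ^ k / ε) *
            ∫⁻ y in Metric.closedBall x (min (2 ^ k * ε) δ), g y := by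
          rw [lintegral_tsum fun k => ((hg.restrict.const_mul _).indicator
            Metric.isClosed_closedBall.measurableSet)]
          refine tsum_congr fun k => ?_
          rw [lintegral_indicator Metric.isClosed_closedBall.measurableSet,
            Measure.restrict_restrict Metric.isClosed_closedBall.measurableSet,
            lintegral_const_mul'' _ hg.restrict]
          congr 3
          ext y
          simp only [mem_inter_iff, hball, le_min_iff]
      _ ≤ ∑' k : ℕ, ENNReal.ofReal (4 * (1 / 2) ^ k) * η := by
          refine ENNReal.tsum_le_tsum fun k => ?_
          calc ENNReal.ofReal (4 * (1 / 4) ^ k / ε) *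
                ∫⁻ y in Metric.closedBall x (min (2 ^ k * ε) δ), g y
              ≤ ENNReal.ofReal (4 * (1 / 4) ^ k / ε) * (η * ENNReal.ofReal (2 ^ k * ε)) := by
                gcongr
                refine (hη _ (lt_min (by positivity) hδ) (min_le_right _ _)).trans ?_
                gcongr
                exact min_le_left _ _
            _ = ENNReal.ofReal (4 * (1 / 4) ^ k / ε) * ENNReal.ofReal (2 ^ k * ε) * η := by ring
            _ = _ := by
                rw [← ENNReal.ofReal_mul (by positivity)]
                congr 2
                have : (1 / 4 : ℝ) ^ k * 2 ^ k = (1 / 2) ^ k := by rw [← mul_pow]; norm_num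
                field_simp
                linear_combination this
      _ = 8 * η := by
          rw [ENNReal.tsum_mul_right, ← ENNReal.ofReal_tsum_of_nonneg (fun k => by positivity)
            (summable_geometric_two.mul_left _), tsum_mul_left, tsum_geometric_two]
          norm_num
  have hfar : ∫⁻ y in (Metric.closedBall x δ)ᶜ,
      g y * ENNReal.ofReal (ε / ((x - y) ^ 2 + ε ^ 2)) ≤
      ENNReal.ofReal ε * (ENNReal.ofReal ((1 + 2 * x ^ 2) / δ ^ 2 + 2) *
        ∫⁻ y, g y * ENNReal.ofReal (1 + y ^ 2)⁻¹) := by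
    have hm : AEMeasurable (fun y => g y * ENNReal.ofReal (1 + y ^ 2)⁻¹) volume :=
      hg.mul (by fun_prop)
    rw [← lintegral_const_mul'' _ hm, ← lintegral_const_mul'' _ (hm.const_mul _)]
    refine le_trans ?_ (setLIntegral_le_lintegral (Metric.closedBall x δ)ᶜ _)
    refine setLIntegral_mono' Metric.isClosed_closedBall.measurableSet.compl fun y hy => ?_
    have hy' : δ < |x - y| := not_le.1 fun h => hy ((hball _ _).2 h)
    have hy2 : δ ^ 2 ≤ (x - y) ^ 2 := by rw [← sq_abs (x - y)]; gcongr
    rw [mul_comm (g y), mul_comm (g y), ← mul_assoc, ← mul_assoc]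
    gcongr
    rw [← ENNReal.ofReal_mul hε.le, ← ENNReal.ofReal_mul (by positivity)]
    apply ENNReal.ofReal_le_ofReal
    rw [div_eq_mul_inv, mul_assoc]
    gcongr
    rw [← div_eq_mul_inv, le_div_iff₀ (by positivity), inv_mul_le_iff₀ (by positivity)]
    have h1 : 1 + 2 * x ^ 2 ≤ (x - y) ^ 2 * ((1 + 2 * x ^ 2) / δ ^ 2) := by
      rw [mul_div_assoc', le_div_iff₀ (by positivity)]
      nlinarith [sq_nonneg x]
    have h2 : 0 ≤ ε ^ 2 * ((1 + 2 * x ^ 2) / δ ^ 2 + 2) := by positivity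
    nlinarith [sq_nonneg (2 * x - y), sq_nonneg (x - y)]
  rw [← lintegral_add_compl _ (measurableSet_closedBall (x := x) (ε := δ))]
  exact add_le_add hnear hfar

lemma ae_tendsto_lintegral_mul_poisson {E : Type*} [NormedAddCommGroup E] {h : ℝ → E}
    (hm : AEStronglyMeasurable h volume)
    (h_int : Integrable (fun y => ‖h y‖ * (1 + y ^ 2)⁻¹) volume) :
    ∀ᵐ x, Tendsto (fun ε : ℝ => ∫⁻ y, ‖h y - h x‖ₑ * ENNReal.ofReal (ε / ((x - y) ^ 2 + ε ^ 2)))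
      (𝓝[>] 0) (𝓝 0) := by
  have hloc : LocallyIntegrable h volume := by
    rw [locallyIntegrable_iff]
    intro K hK
    have hb : ContinuousOn (fun y : ℝ => 1 + y ^ 2) K := by fun_prop
    have h1 : IntegrableOn (fun y => (‖h y‖ * (1 + y ^ 2)⁻¹) * (1 + y ^ 2)) K volume :=
      h_int.integrableOn.mul_continuousOn hb hK
    refine Integrable.mono h1 hm.restrict (ae_of_all _ fun y => ?_)
    rw [mul_assoc, inv_mul_cancel₀ (by positivity), mul_one, norm_norm]
  filter_upwards [(Besicovitch.vitaliFamily (volume : Measure ℝ)).ae_tendsto_lintegral_enorm_sub_div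
    hloc] with x hx
  have hx' := hx.comp (Besicovitch.tendsto_filterAt (volume : Measure ℝ) x)
  set g : ℝ → ℝ≥0∞ := fun y => ‖h y - h x‖ₑ with hg
  have hgm : AEMeasurable g volume := (hm.sub aestronglyMeasurable_const).enorm
  have hfin : ∫⁻ y, g y * ENNReal.ofReal (1 + y ^ 2)⁻¹ < ∞ := by
    have h2 : Integrable (fun y => ‖h y‖ * (1 + y ^ 2)⁻¹ + ‖h x‖ * (1 + y ^ 2)⁻¹) volume :=
      h_int.add (integrable_inv_one_add_sq.const_mul _)
    refine lt_of_le_of_lt (lintegral_mono fun y => ?_) h2.2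
    rw [Real.enorm_of_nonneg (by positivity)]
    simp only [hg]
    rw [← add_mul]
    rw [← ofReal_norm, ← ENNReal.ofReal_mul (norm_nonneg _)]
    apply ENNReal.ofReal_le_ofReal
    gcongr
    exact norm_sub_le _ _
  rw [ENNReal.tendsto_nhds_zero]
  intro η hη
  have hη' : 0 < η / 32 := ENNReal.div_pos hη.ne' (by norm_num)
  have h1 := (ENNReal.tendsto_nhds_zero.1 hx') (η / 32) hη'
  obtain ⟨δ, hδ, hδ1⟩ := (mem_nhdsGT_iff_exists_Ioc_subset).1 h1
  have hδ0 : 0 < δ := hδ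
  have hη1 : ∀ r, 0 < r → r ≤ δ → ∫⁻ y in Metric.closedBall x r, g y ≤
      (η / 16) * ENNReal.ofReal r := by
    intro r hr hrδ
    have h2 : (∫⁻ y in Metric.closedBall x r, g y) / volume (Metric.closedBall x r) ≤ η / 32 :=
      hδ1 ⟨hr, hrδ⟩
    rw [Real.volume_closedBall] at h2
    rw [ENNReal.div_le_iff (by simpa using hr) ENNReal.ofReal_ne_top] at h2
    refine h2.trans (le_of_eq ?_)
    rw [ENNReal.ofReal_mul (by norm_num), ← mul_assoc]
    congr 1
    rw [div_eq_mul_inv, div_eq_mul_inv, mul_assoc]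
    congr 1
    rw [show (32 : ℝ≥0∞) = 16 * 2 by norm_num, ENNReal.mul_inv (by simp) (by simp), mul_assoc,
      ENNReal.ofReal_ofNat, ENNReal.inv_mul_cancel (by simp) (by simp), mul_one]
  have hlim : Tendsto (fun ε : ℝ => ENNReal.ofReal ε *
      (ENNReal.ofReal ((1 + 2 * x ^ 2) / δ ^ 2 + 2) * ∫⁻ y, g y * ENNReal.ofReal (1 + y ^ 2)⁻¹))
      (𝓝[>] 0) (𝓝 0) := by
    have h3 : Tendsto (fun ε : ℝ => ENNReal.ofReal ε) (𝓝[>] 0) (𝓝 0) := by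
      have := (ENNReal.continuous_ofReal.tendsto 0).mono_left (nhdsWithin_le_nhds (s := Ioi 0))
      simpa using this
    have := ENNReal.Tendsto.mul_const h3 (Or.inr
      (ENNReal.mul_lt_top (ENNReal.ofReal_lt_top (r := (1 + 2 * x ^ 2) / δ ^ 2 + 2)) hfin).ne)
    simpa using this
  have hη2 : 0 < η / 2 := ENNReal.div_pos hη.ne' (by norm_num)
  filter_upwards [(ENNReal.tendsto_nhds_zero.1 hlim) (η / 2) hη2, self_mem_nhdsWithin]
    with ε h4 hε
  refine (lintegral_mul_poisson_le hgm hδ0 hε hη1).trans ?_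
  calc 8 * (η / 16) + _ ≤ η / 2 + η / 2 := by
        refine add_le_add (le_of_eq ?_) h4
        rw [div_eq_mul_inv, div_eq_mul_inv, mul_left_comm]
        congr 1
        rw [show (16 : ℝ≥0∞) = 8 * 2 by norm_num, ENNReal.mul_inv (by simp) (by simp), ← mul_assoc,
          ENNReal.mul_inv_cancel (by simp) (by simp), one_mul]
    _ = η := ENNReal.add_halves η

lemma poisson_le_mul_inv_one_add_sq {ε : ℝ} (hε : 0 < ε) (x y : ℝ) :
    ε / ((x - y) ^ 2 + ε ^ 2) ≤ ((1 + 2 * x ^ 2) / ε + 2 * ε) * (1 + y ^ 2)⁻¹ := by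
  rw [← div_eq_mul_inv, div_le_div_iff₀ (by positivity) (by positivity)]
  have h1 : ((1 + 2 * x ^ 2) / ε + 2 * ε) * ((x - y) ^ 2 + ε ^ 2) =
      (1 + 2 * x ^ 2) / ε * (x - y) ^ 2 + (1 + 2 * x ^ 2) * ε + 2 * ε * (x - y) ^ 2 + 2 * ε ^ 3 := by
    field_simp
    ring
  have h2 : 0 ≤ (1 + 2 * x ^ 2) / ε * (x - y) ^ 2 := by positivity
  have h3 : 0 < ε ^ 3 := by positivity
  have h4 : 0 ≤ ε * (2 * x - y) ^ 2 := by positivity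
  nlinarith

lemma integrable_poisson_smul {E : Type*} [NormedAddCommGroup E] [NormedSpace ℝ E] {h : ℝ → E}
    (hm : AEStronglyMeasurable h volume)
    (h_int : Integrable (fun y => ‖h y‖ * (1 + y ^ 2)⁻¹) volume) {ε : ℝ} (hε : 0 < ε) (x : ℝ) :
    Integrable (fun y => (ε / ((x - y) ^ 2 + ε ^ 2)) • h y) volume := by
  refine (h_int.const_mul ((1 + 2 * x ^ 2) / ε + 2 * ε)).mono'
    ((by fun_prop : Measurable fun y => ε / ((x - y) ^ 2 + ε ^ 2)).aestronglyMeasurable.smul hm)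
    (ae_of_all _ fun y => ?_)
  rw [norm_smul, Real.norm_of_nonneg (by positivity), mul_comm ‖h y‖, ← mul_assoc]
  gcongr
  exact poisson_le_mul_inv_one_add_sq hε x y

lemma ae_tendsto_integral_poisson_smul {E : Type*} [NormedAddCommGroup E] [NormedSpace ℝ E]
    [CompleteSpace E] {h : ℝ → E} (hm : AEStronglyMeasurable h volume)
    (h_int : Integrable (fun y => ‖h y‖ * (1 + y ^ 2)⁻¹) volume) :
    ∀ᵐ x, Tendsto (fun ε : ℝ => ∫ y, (ε / ((x - y) ^ 2 + ε ^ 2)) • h y)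
      (𝓝[>] 0) (𝓝 (Real.pi • h x)) := by
  filter_upwards [ae_tendsto_lintegral_mul_poisson hm h_int] with x hx
  rw [tendsto_iff_edist_tendsto_0]
  refine tendsto_of_tendsto_of_tendsto_of_le_of_le' tendsto_const_nhds hx
    (Eventually.of_forall fun _ => zero_le) ?_
  filter_upwards [self_mem_nhdsWithin] with ε hε
  have hε : 0 < ε := hε
  obtain ⟨hp, hpi⟩ := integral_poisson x hε
  rw [edist_eq_enorm_sub, ← hpi, ← integral_smul_const, ← integral_sub
    (integrable_poisson_smul hm h_int hε x) (hp.smul_const _)]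
  refine (enorm_integral_le_lintegral_enorm _).trans (le_of_eq (lintegral_congr fun y => ?_))
  rw [← smul_sub, enorm_smul, mul_comm, Real.enorm_of_nonneg (by positivity)]

lemma CauchyIntegrable.integrable_mul_inv_one_add_sq {f : ℝ → ℝ} (hf : CauchyIntegrable f) :
    Integrable (fun y => ‖f y‖ * (1 + y ^ 2)⁻¹) volume := by
  refine (Integrable.norm hf).const_mul 2 |>.mono' (hf.aesm.norm.mul
    (by fun_prop : Measurable fun y : ℝ => (1 + y ^ 2)⁻¹).aestronglyMeasurable)
    (ae_of_all _ fun y => ?_)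
  rw [norm_mul, norm_mul, norm_norm, Real.norm_of_nonneg (by positivity : 0 ≤ (1 + y ^ 2)⁻¹),
    Real.norm_of_nonneg (by positivity : 0 ≤ (1 + |y|)⁻¹), mul_left_comm]
  gcongr
  rw [← div_eq_mul_inv, inv_eq_one_div, div_le_div_iff₀ (by positivity) (by positivity)]
  nlinarith [sq_abs y, sq_nonneg (|y| - 1)]

/-- The truncated Hilbert kernel is close to the conjugate Poisson kernel. -/
lemma abs_conjPoisson_sub_trunc_le {ε : ℝ} (hε : 0 < ε) (s : ℝ) :
    |s / (s ^ 2 + ε ^ 2) - {s : ℝ | ε < |s|}.indicator (fun s => s⁻¹) s| ≤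
      ε / (s ^ 2 + ε ^ 2) := by
  by_cases hs : ε < |s|
  · rw [indicator_of_mem (show s ∈ {s : ℝ | ε < |s|} from hs)]
    have hs0 : s ≠ 0 := abs_pos.1 (hε.trans hs)
    have h1 : s / (s ^ 2 + ε ^ 2) - s⁻¹ = -(ε ^ 2 / (s * (s ^ 2 + ε ^ 2))) := by
      field_simp
      ring
    rw [h1, abs_neg, abs_div, abs_mul, abs_of_nonneg (by positivity : 0 ≤ ε ^ 2),
      abs_of_nonneg (by positivity : 0 ≤ s ^ 2 + ε ^ 2), div_le_div_iff₀ (by positivity)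
      (by positivity)]
    have : 0 < s ^ 2 + ε ^ 2 := by positivity
    nlinarith [mul_pos hε this]
  · rw [indicator_of_notMem (show s ∉ {s : ℝ | ε < |s|} from hs), sub_zero, abs_div,
      abs_of_nonneg (by positivity : 0 ≤ s ^ 2 + ε ^ 2)]
    gcongr
    exact not_lt.1 hs

lemma integral_conjPoisson_sub_trunc (ε x : ℝ) :
    ∫ y, ((x - y) / ((x - y) ^ 2 + ε ^ 2) -
      {s : ℝ | ε < |s|}.indicator (fun s => s⁻¹) (x - y)) = 0 := by
  set d : ℝ → ℝ := fun s => s / (s ^ 2 + ε ^ 2) - {s : ℝ | ε < |s|}.indicator (fun s => s⁻¹) s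
  have hodd : ∀ s, d (-s) = - d s := by
    intro s
    simp only [d, neg_sq]
    by_cases hs : ε < |s|
    · rw [indicator_of_mem (show s ∈ {s : ℝ | ε < |s|} from hs),
        indicator_of_mem (show -s ∈ {s : ℝ | ε < |s|} from by
          show ε < |-s|
          rwa [abs_neg]), inv_neg]
      ring
    · rw [indicator_of_notMem (show s ∉ {s : ℝ | ε < |s|} from hs),
        indicator_of_notMem (show -s ∉ {s : ℝ | ε < |s|} from by
          show ¬ ε < |-s|
          rwa [abs_neg])]
      ring
  have h1 : ∫ y, d (x - y) = ∫ s, d s := integral_sub_left_eq_self d volume x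
  have h2 : ∫ s, d (-s) = ∫ s, d s := integral_neg_eq_self d volume
  simp only [hodd, integral_neg] at h2
  change ∫ y, d (x - y) = 0
  rw [h1]
  linarith

lemma ae_tendsto_trunc_sub_im {f : ℝ → ℝ} (hf : CauchyIntegrable f) :
    ∀ᵐ x : ℝ, Tendsto (fun ε : ℝ => (∫ y in {y : ℝ | ε < |x - y|}, f y / (x - y)) -
      (cauchyInt f (x + ε * Complex.I)).im) (𝓝[>] 0) (𝓝 0) := by
  have h_int := hf.integrable_mul_inv_one_add_sq
  filter_upwards [ae_tendsto_lintegral_mul_poisson hf.aesm h_int] with x hx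
  rw [tendsto_zero_iff_enorm_tendsto_zero]
  refine tendsto_of_tendsto_of_tendsto_of_le_of_le' tendsto_const_nhds hx
    (Eventually.of_forall fun _ => zero_le) ?_
  filter_upwards [self_mem_nhdsWithin] with ε hε
  have hε : 0 < ε := hε
  set k : ℝ → ℝ := fun y => (x - y) / ((x - y) ^ 2 + ε ^ 2)
  set i : ℝ → ℝ := fun y => {s : ℝ | ε < |s|}.indicator (fun s => s⁻¹) (x - y)
  have hset : MeasurableSet {s : ℝ | ε < |s|} := measurableSet_lt measurable_const (by fun_prop)
  have hdm : Measurable (fun y => k y - i y) :=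
    (by fun_prop : Measurable k).sub
      ((measurable_inv.indicator hset).comp (by fun_prop : Measurable fun y => x - y))
  have hd : ∀ y, |k y - i y| ≤ ε / ((x - y) ^ 2 + ε ^ 2) := fun y =>
    abs_conjPoisson_sub_trunc_le hε (x - y)
  have hdi : Integrable (fun y => k y - i y) volume :=
    (integral_poisson x hε).1.mono' hdm.aestronglyMeasurable (ae_of_all _ hd)
  have hfk := (hf.integrable_real x hε).2
  have hfd : Integrable (fun y => f y * (k y - i y)) volume := by
    refine (hf.integrable_real x hε).1.norm.mono' (hf.aesm.mul hdm.aestronglyMeasurable)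
      (ae_of_all _ fun y => ?_)
    rw [norm_mul, norm_mul]
    gcongr
    exact (hd y).trans (le_abs_self _)
  have htr : ∫ y in {y : ℝ | ε < |x - y|}, f y / (x - y) =
      (∫ y, f y * k y) - ∫ y, f y * (k y - i y) := by
    rw [← integral_sub hfk hfd, ← integral_indicator
      (measurableSet_lt measurable_const (by fun_prop))]
    refine integral_congr_ae (ae_of_all _ fun y => ?_)
    simp only [i]
    by_cases hy : ε < |x - y|
    · rw [indicator_of_mem (show y ∈ {y : ℝ | ε < |x - y|} from hy),
        indicator_of_mem (show x - y ∈ {s : ℝ | ε < |s|} from hy)]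
      ring
    · rw [indicator_of_notMem (show y ∉ {y : ℝ | ε < |x - y|} from hy),
        indicator_of_notMem (show x - y ∉ {s : ℝ | ε < |s|} from hy)]
      ring
  have h0 : ∫ y, f x * (k y - i y) = 0 := by
    rw [integral_const_mul, integral_conjPoisson_sub_trunc, mul_zero]
  have h1 : (∫ y in {y : ℝ | ε < |x - y|}, f y / (x - y)) -
      (cauchyInt f (x + ε * Complex.I)).im = -∫ y, (f y - f x) * (k y - i y) := by
    simp only [sub_mul (f _) (f x)]
    rw [htr, hf.cauchyInt_im x hε, integral_sub hfd (hdi.const_mul _), h0]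
    ring
  rw [h1, enorm_neg]
  refine (enorm_integral_le_lintegral_enorm _).trans (lintegral_mono fun y => ?_)
  rw [enorm_mul]
  gcongr
  rw [← ofReal_norm]
  exact ENNReal.ofReal_le_ofReal (hd y)

lemma integral_poisson_smul_of_differentiableOn {P : ℂ → ℂ} {M x ε δ : ℝ}
    (hP : DifferentiableOn ℂ P {z | 0 < z.im}) (hM : ∀ z : ℂ, 0 < z.im → ‖P z‖ ≤ M)
    (hε : 0 < ε) (hεδ : ε ≤ δ) :
    ∫ s : ℝ, (δ / ((x - s) ^ 2 + δ ^ 2)) • P (s + ε * Complex.I) =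
      Real.pi • P (x + (ε + δ : ℝ) * Complex.I) := by
  have hδ : 0 < δ := hε.trans_le hεδ
  set z₀ : ℂ := x + (ε + δ : ℝ) * Complex.I with hz₀
  set z₁ : ℂ := x + (ε - δ : ℝ) * Complex.I with hz₁
  have him0 : z₀.im = ε + δ := by simp [hz₀]
  have him1 : z₁.im = ε - δ := by simp [hz₁]
  have hz₀U : {z : ℂ | 0 < z.im} ∈ 𝓝 z₀ := by
    refine (isOpen_lt continuous_const Complex.continuous_im).mem_nhds ?_
    show 0 < z₀.im
    rw [him0]; positivity
  have hM0 : 0 ≤ M := (norm_nonneg _).trans (hM z₀ (by rw [him0]; positivity))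
  have hne1 : ∀ z : ℂ, 0 < z.im → z - z₁ ≠ 0 := by
    intro z hz h
    rw [sub_eq_zero] at h
    rw [h, him1] at hz
    linarith
  set G : ℂ → ℂ := fun z => dslope P z₀ z / (z - z₁) with hG
  have hGd : DifferentiableOn ℂ G {z | 0 < z.im} := by
    refine DifferentiableOn.div ((Complex.differentiableOn_dslope hz₀U).2 hP) (by fun_prop) ?_
    intro z hz
    exact hne1 z hz
  set R₀ : ℝ := 2 * (‖z₀‖ + ‖z₁‖) + 1 with hR₀
  have hGK : ∀ R, R₀ ≤ R → ∀ z : ℂ, ε ≤ z.im → R ≤ ‖z‖ → ‖G z‖ ≤ (8 * M / R) / ‖z‖ := by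
    intro R hR z hz hRz
    have hz0 : ‖z‖ / 2 ≤ ‖z - z₀‖ := by
      have := norm_sub_norm_le z z₀
      linarith [norm_nonneg z₁]
    have hz1 : ‖z‖ / 2 ≤ ‖z - z₁‖ := by
      have := norm_sub_norm_le z z₁
      linarith [norm_nonneg z₀]
    have hR0 : 0 < R := lt_of_lt_of_le (by positivity) hR
    have hzp : 0 < ‖z‖ := hR0.trans_le hRz
    have hne : z ≠ z₀ := by
      intro h
      rw [h, sub_self, norm_zero] at hz0
      rw [← h] at hz0
      linarith
    rw [hG]
    simp only
    rw [dslope_of_ne _ hne, slope_def_field, norm_div, norm_div, div_div]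
    calc ‖P z - P z₀‖ / (‖z - z₀‖ * ‖z - z₁‖) ≤ (M + M) / (‖z‖ / 2 * (R / 2)) := by
          gcongr
          · exact (norm_sub_le _ _).trans (add_le_add (hM z (hε.trans_le hz))
              (hM z₀ (by rw [him0]; positivity)))
          · linarith
      _ = _ := by
          field_simp
          ring
  have hcont : Continuous fun s : ℝ => P (s + ε * Complex.I) := by
    refine hP.continuousOn.comp_continuous (by fun_prop) fun s => ?_
    show 0 < (s + ε * Complex.I : ℂ).im
    simpa using hε
  have hint1 : Integrable (fun s : ℝ => (δ / ((x - s) ^ 2 + δ ^ 2)) • P (s + ε * Complex.I)) := by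
    refine (integral_poisson x hδ).1.smul_bdd M hcont.aestronglyMeasurable
      (ae_of_all _ fun s => hM _ (by simpa using hε))
  have hint2 := (integral_poisson x hδ).1.smul_const (P z₀)
  have hGline : ∀ s : ℝ, δ • G (s + ε * Complex.I) = (δ / ((x - s) ^ 2 + δ ^ 2)) • P (s + ε * Complex.I) -
      (δ / ((x - s) ^ 2 + δ ^ 2)) • P z₀ := by
    intro s
    have h0 : (s + ε * Complex.I : ℂ) - z₀ = (s - x) - δ * Complex.I := by
      rw [hz₀]; push_cast; ring
    have h1 : (s + ε * Complex.I : ℂ) - z₁ = (s - x) + δ * Complex.I := by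
      rw [hz₁]; push_cast; ring
    have hne : (s + ε * Complex.I : ℂ) ≠ z₀ := by
      intro h
      have := congrArg Complex.im h
      rw [him0] at this
      simp at this
      linarith
    have hprod : ((s + ε * Complex.I : ℂ) - z₀) * ((s + ε * Complex.I : ℂ) - z₁) =
        (((x - s) ^ 2 + δ ^ 2 : ℝ) : ℂ) := by
      rw [h0, h1]
      push_cast
      linear_combination -(δ : ℂ) ^ 2 * Complex.I_sq
    rw [← smul_sub, hG]
    simp only
    rw [dslope_of_ne _ hne, slope_def_field, div_div, hprod, Complex.real_smul, Complex.real_smul]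
    push_cast
    ring
  have hzero : ∫ s : ℝ, δ • G (s + ε * Complex.I) = 0 := by
    have h_int : Integrable (fun s : ℝ => δ • G (s + ε * Complex.I)) := by
      simp only [hGline]
      exact hint1.sub hint2
    have hl := intervalIntegral_tendsto_integral h_int tendsto_neg_atTop_atBot tendsto_id
    refine tendsto_nhds_unique hl ?_
    have hb : Tendsto (fun R : ℝ => δ * (4 * (8 * M / R))) atTop (𝓝 0) := by
      have : Tendsto (fun R : ℝ => 8 * M / R) atTop (𝓝 0) := tendsto_const_nhds.div_atTop tendsto_id
      simpa using (this.const_mul 4).const_mul δ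
    refine squeeze_zero_norm' ?_ hb
    filter_upwards [eventually_ge_atTop R₀] with R hR
    have hR0 : 0 < R := lt_of_lt_of_le (by positivity) hR
    rw [intervalIntegral.integral_smul, norm_smul, Real.norm_of_nonneg hδ.le]
    gcongr
    exact norm_integral_line_le hε hGd hR0 (by positivity) (hGK R hR)
  simp only [hGline] at hzero
  rw [integral_sub hint1 hint2, sub_eq_zero, integral_smul_const, (integral_poisson x hδ).2] at hzero
  exact hzero

lemma exists_tendsto_inner {H ι : Type*} [NormedAddCommGroup H] [InnerProductSpace ℂ H]
    [CompleteSpace H] {l : Filter ι} [l.NeBot] {u : ι → H} {r : ℝ} (hu : ∀ᶠ i in l, ‖u i‖ ≤ r) :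
    ∃ (φ : H) (l' : Filter ι), l'.NeBot ∧ l' ≤ l ∧
      ∀ v, Tendsto (fun i => inner ℂ v (u i)) l' (𝓝 (inner ℂ v φ)) := by
  set T : ι → WeakDual ℂ H := fun i => StrongDual.toWeakDual (InnerProductSpace.toDual ℂ H (u i))
  have hc := WeakDual.isCompact_closedBall (𝕜 := ℂ) (E := H) 0 r
  have hmem : ∀ᶠ i in (Ultrafilter.of l : Filter ι),
      T i ∈ WeakDual.toStrongDual ⁻¹' Metric.closedBall (0 : StrongDual ℂ H) r := by
    filter_upwards [Ultrafilter.of_le l hu] with i hi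
    simpa [T] using hi
  obtain ⟨τ, -, hτ⟩ := hc.ultrafilter_le_nhds ((Ultrafilter.of l).map T) (le_principal_iff.2 hmem)
  have hτ' : Tendsto T (Ultrafilter.of l : Filter ι) (𝓝 τ) := hτ
  refine ⟨(InnerProductSpace.toDual ℂ H).symm (WeakDual.toStrongDual τ), Ultrafilter.of l,
    inferInstance, Ultrafilter.of_le l, fun v => ?_⟩
  have h1 := ((WeakDual.eval_continuous v).tendsto τ).comp hτ'
  have h2 := (Complex.continuous_conj.tendsto _).comp h1
  refine Tendsto.congr (fun i => ?_) (h2.trans (le_of_eq ?_))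
  · simp [T]
  · congr 1
    rw [← inner_conj_symm, InnerProductSpace.toDual_symm_apply]
    rfl

lemma ae_exists_tendsto_of_bounded {P : ℂ → ℂ} {M : ℝ}
    (hP : DifferentiableOn ℂ P {z | 0 < z.im}) (hM : ∀ z : ℂ, 0 < z.im → ‖P z‖ ≤ M) :
    ∀ᵐ x : ℝ, ∃ l : ℂ, Tendsto (fun ε : ℝ => P (x + ε * Complex.I)) (𝓝[>] 0) (𝓝 l) := by
  have hM0 : 0 ≤ M := (norm_nonneg _).trans (hM Complex.I (by simp))
  set Φ : ℂ → ℂ := fun z => P z / (z + Complex.I) with hΦ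
  have hne : ∀ z : ℂ, 0 < z.im → z + Complex.I ≠ 0 := by
    intro z hz h
    have := congrArg Complex.im h
    simp at this
    linarith
  have hΦd : DifferentiableOn ℂ Φ {z | 0 < z.im} := hP.div (by fun_prop) fun z hz => hne z hz
  have hΦM : ∀ z : ℂ, 0 < z.im → ‖Φ z‖ ≤ M := by
    intro z hz
    rw [hΦ]
    simp only
    rw [norm_div]
    refine div_le_of_le_mul₀ (norm_nonneg _) hM0 ((hM z hz).trans ?_)
    refine le_mul_of_one_le_right hM0 ?_
    calc (1 : ℝ) ≤ (z + Complex.I).im := by simp; linarith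
      _ ≤ _ := Complex.im_le_norm _
  have hcont : ∀ ε : ℝ, 0 < ε → Continuous fun s : ℝ => Φ (s + ε * Complex.I) := by
    intro ε hε
    refine hΦd.continuousOn.comp_continuous (by fun_prop) fun s => ?_
    show 0 < (s + ε * Complex.I : ℂ).im
    simpa using hε
  have hsq : ∀ ε : ℝ, 0 < ε → ∀ s : ℝ, ‖Φ (s + ε * Complex.I)‖ ^ 2 ≤ M ^ 2 * (1 + s ^ 2)⁻¹ := by
    intro ε hε s
    rw [hΦ]
    simp only
    rw [norm_div, div_pow, div_eq_mul_inv]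
    have h1 : 1 + s ^ 2 ≤ ‖(s + ε * Complex.I + Complex.I : ℂ)‖ ^ 2 := by
      rw [← Complex.normSq_eq_norm_sq, Complex.normSq_apply]
      simp
      nlinarith
    gcongr
    exact hM _ (by simpa using hε)
  set g : ℝ → ℝ := fun s => M * √(1 + s ^ 2)⁻¹ with hg
  have hle : ∀ ε : ℝ, 0 < ε → ∀ s : ℝ, ‖Φ (s + ε * Complex.I)‖ ≤ ‖g s‖ := by
    intro ε hε s
    rw [Real.norm_of_nonneg (by positivity)]
    refine le_of_sq_le_sq ((hsq ε hε s).trans (le_of_eq ?_)) (by positivity)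
    rw [hg, mul_pow, Real.sq_sqrt (by positivity)]
  have hgL2 : MemLp g 2 volume := by
    rw [memLp_two_iff_integrable_sq (by fun_prop)]
    refine (integrable_inv_one_add_sq.const_mul (M ^ 2)).congr (ae_of_all _ fun s => ?_)
    simp only [hg]
    rw [mul_pow, Real.sq_sqrt (by positivity)]
  have hL2 : ∀ ε : ℝ, 0 < ε → MemLp (fun s : ℝ => Φ (s + ε * Complex.I)) 2 volume :=
    fun ε hε => hgL2.mono (hcont ε hε).aestronglyMeasurable (ae_of_all _ (hle ε hε))
  classical
  set u : ℝ → Lp ℂ 2 (volume : Measure ℝ) := fun ε => if h : 0 < ε then (hL2 ε h).toLp _ else 0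
  have hu : ∀ᶠ ε in 𝓝[>] (0 : ℝ), ‖u ε‖ ≤ ‖hgL2.toLp g‖ := by
    filter_upwards [self_mem_nhdsWithin] with ε hε
    have hε : 0 < ε := hε
    simp only [u, dif_pos hε]
    refine Lp.norm_le_norm_of_ae_le ?_
    filter_upwards [(hL2 ε hε).coeFn_toLp, hgL2.coeFn_toLp] with s h1 h2
    rw [h1, h2]
    exact hle ε hε s
  obtain ⟨φ, l, hl, hll, hlim⟩ := exists_tendsto_inner hu
  have hφm : AEStronglyMeasurable φ volume := Lp.aestronglyMeasurable φ
  have hφi : Integrable (fun y => ‖φ y‖ * (1 + y ^ 2)⁻¹) volume := by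
    refine MemLp.integrable_mul (p := 2) (q := 2) (Lp.memLp φ).norm ?_
    rw [memLp_two_iff_integrable_sq (by fun_prop)]
    refine integrable_inv_one_add_sq.mono' (by fun_prop) (ae_of_all _ fun s => ?_)
    rw [Real.norm_of_nonneg (by positivity)]
    refine pow_le_of_le_one (by positivity) (inv_le_one_of_one_le₀ ?_) two_ne_zero
    nlinarith
  have hpois : ∀ x δ : ℝ, 0 < δ → ∫ s : ℝ, (δ / ((x - s) ^ 2 + δ ^ 2)) • φ s =
      Real.pi • Φ (x + δ * Complex.I) := by
    intro x δ hδ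
    have hp1 : MemLp (fun s : ℝ => δ / ((x - s) ^ 2 + δ ^ 2)) 2 volume := by
      have hpm : Measurable fun s : ℝ => δ / ((x - s) ^ 2 + δ ^ 2) := by fun_prop
      rw [memLp_two_iff_integrable_sq hpm.aestronglyMeasurable]
      refine ((integral_poisson x hδ).1.const_mul δ⁻¹).mono' (hpm.pow_const 2).aestronglyMeasurable
        (ae_of_all _ fun s => ?_)
      rw [Real.norm_of_nonneg (by positivity), sq]
      gcongr
      rw [div_le_iff₀ (by positivity), inv_mul_eq_div, le_div_iff₀ hδ]
      nlinarith [sq_nonneg (x - s)]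
    have hp2 : MemLp (fun s : ℝ => ((δ / ((x - s) ^ 2 + δ ^ 2) : ℝ) : ℂ)) 2 volume := hp1.ofReal
    have hinner : ∀ ψ : Lp ℂ 2 (volume : Measure ℝ), inner ℂ (hp2.toLp _) ψ =
        ∫ s : ℝ, (δ / ((x - s) ^ 2 + δ ^ 2)) • ψ s := by
      intro ψ
      rw [L2.inner_def]
      refine integral_congr_ae ?_
      filter_upwards [hp2.coeFn_toLp] with s hs
      rw [hs, Complex.real_smul, RCLike.inner_apply, Complex.conj_ofReal, mul_comm]
    have h1 := hlim (hp2.toLp _)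
    rw [hinner φ] at h1
    refine tendsto_nhds_unique h1 ?_
    have h2 : Tendsto (fun ε : ℝ => Real.pi • Φ (x + (ε + δ : ℝ) * Complex.I)) (𝓝[>] 0)
        (𝓝 (Real.pi • Φ (x + δ * Complex.I))) := by
      have hΦc : ContinuousAt Φ (x + ((0 : ℝ) + δ : ℝ) * Complex.I) := by
        refine hΦd.continuousOn.continuousAt
          ((isOpen_lt continuous_const Complex.continuous_im).mem_nhds ?_)
        show 0 < (x + ((0 : ℝ) + δ : ℝ) * Complex.I : ℂ).im
        simpa using hδ
      have h3 : ContinuousAt (fun ε : ℝ => Real.pi • Φ (x + (ε + δ : ℝ) * Complex.I)) 0 :=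
        ContinuousAt.const_smul (ContinuousAt.comp (f := fun ε : ℝ => (x + (ε + δ : ℝ) * Complex.I : ℂ))
          hΦc (by fun_prop)) Real.pi
      have h4 := h3.tendsto.mono_left (nhdsWithin_le_nhds (s := Ioi 0))
      rwa [zero_add] at h4
    refine Tendsto.congr' ?_ (h2.mono_left hll)
    filter_upwards [hll self_mem_nhdsWithin, hll (Ioc_mem_nhdsGT hδ)] with ε hε hεδ
    have hε : 0 < ε := hε
    rw [hinner, ← integral_poisson_smul_of_differentiableOn hΦd hΦM hε hεδ.2]
    refine integral_congr_ae ?_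
    simp only [u, dif_pos hε]
    filter_upwards [(hL2 ε hε).coeFn_toLp] with s hs
    rw [hs]
  filter_upwards [ae_tendsto_integral_poisson_smul hφm hφi] with x hx
  refine ⟨φ x * (x + Complex.I), ?_⟩
  have h1 : Tendsto (fun ε : ℝ => Φ (x + ε * Complex.I)) (𝓝[>] 0) (𝓝 (φ x)) := by
    have h2 := hx.const_smul Real.pi⁻¹
    rw [inv_smul_smul₀ Real.pi_ne_zero] at h2
    refine h2.congr' ?_
    filter_upwards [self_mem_nhdsWithin] with ε hε
    rw [hpois x ε hε, inv_smul_smul₀ Real.pi_ne_zero]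
  have h3 : Tendsto (fun ε : ℝ => (x + ε * Complex.I + Complex.I : ℂ)) (𝓝[>] 0)
      (𝓝 (x + Complex.I)) := by
    have : Continuous fun ε : ℝ => (x + ε * Complex.I + Complex.I : ℂ) := by fun_prop
    simpa using (this.tendsto 0).mono_left (nhdsWithin_le_nhds (s := Ioi 0))
  refine (h1.mul h3).congr' ?_
  filter_upwards [self_mem_nhdsWithin] with ε hε
  exact div_mul_cancel₀ _ (hne _ (by simpa using hε))

namespace RearrBound

variable {f F : ℝ → ℝ} {B : ℝ}

lemma ae_exists_tendsto_im (h : RearrBound f F) (hfm : Measurable f) (h0 : ∀ y, 0 ≤ f y)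
    (hB : 2 ≤ B) (hfin : ∀ t, 0 < t → hardySum B F t < ∞) :
    ∀ᵐ x : ℝ, ∃ l : ℝ, Tendsto (fun ε : ℝ => (cauchyInt f (x + ε * Complex.I)).im)
      (𝓝[>] 0) (𝓝 l) := by
  have hci := h.cauchyIntegrable hfm h0 hB one_pos (hfin 1 one_pos)
  set w := cauchyInt f with hw
  have hre : ∀ z : ℂ, 0 < z.im → 1 ≤ (1 + w z).re := fun z hz => by
    have := hci.cauchyInt_re_nonneg h0 hz
    simpa using this
  have hne : ∀ z : ℂ, 0 < z.im → 1 + w z ≠ 0 := fun z hz h1 => by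
    have := hre z hz
    rw [h1, Complex.zero_re] at this
    linarith
  have hpos : ∀ (x ε : ℝ), 0 < ε → 0 < (x + ε * Complex.I : ℂ).im := fun x ε hε => by simpa using hε
  have hPd : DifferentiableOn ℂ (fun z => (1 + w z)⁻¹) {z | 0 < z.im} :=
    (hci.differentiableOn.const_add 1).inv hne
  have hPM : ∀ z : ℂ, 0 < z.im → ‖(1 + w z)⁻¹‖ ≤ 1 := fun z hz => by
    rw [norm_inv]
    exact inv_le_one_of_one_le₀ ((hre z hz).trans (Complex.re_le_norm _))
  have hret : ∀ᵐ x : ℝ, ∃ l : ℝ, Tendsto (fun ε : ℝ => (w (x + ε * Complex.I)).re)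
      (𝓝[>] 0) (𝓝 l) := by
    filter_upwards [ae_tendsto_integral_poisson_smul hci.aesm hci.integrable_mul_inv_one_add_sq]
      with x hx
    refine ⟨_, hx.congr' ?_⟩
    filter_upwards [self_mem_nhdsWithin] with ε hε
    rw [hw, hci.cauchyInt_re x hε]
    simp only [smul_eq_mul, mul_comm]
  have hseq : Tendsto (fun n : ℕ => 1 / ((n : ℝ) + 1)) atTop (𝓝[>] 0) :=
    tendsto_nhdsWithin_iff.2 ⟨tendsto_one_div_add_atTop_nhds_zero_nat,
      Eventually.of_forall fun n => by show 0 < 1 / ((n : ℝ) + 1); positivity⟩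
  have hnull : volume {x : ℝ | Tendsto (fun ε : ℝ => (1 + w (x + ε * Complex.I))⁻¹)
      (𝓝[>] 0) (𝓝 0)} = 0 := by
    refine le_antisymm (ge_of_tendsto (x := 𝓝[>] (0 : ℝ)) (f := fun t => ENNReal.ofReal (3 * t))
      ?_ ?_) zero_le
    · have : Continuous fun t : ℝ => ENNReal.ofReal (3 * t) :=
        ENNReal.continuous_ofReal.comp (by fun_prop)
      simpa using (this.tendsto 0).mono_left (nhdsWithin_le_nhds (s := Ioi 0))
    · filter_upwards [self_mem_nhdsWithin] with t ht
      refine volume_le_of_eventually (fun n : ℕ => h.volume_lt_abs_im_le hfm h0 hB ht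
        (ε := 1 / ((n : ℝ) + 1)) (by positivity)) ?_
      filter_upwards [hret] with x ⟨r, hr⟩ hx
      have hx : Tendsto (fun ε : ℝ => (1 + w (x + ε * Complex.I))⁻¹) (𝓝[>] 0) (𝓝 0) := hx
      refine hseq.eventually (p := fun ε : ℝ =>
        x ∈ {x : ℝ | _ < ENNReal.ofReal |(w (x + ε * Complex.I)).im|}) ?_
      have hK : ENNReal.ofReal (32 + 4 * Real.log (384 * B)) * hardySum B F t ≠ ∞ :=
        (ENNReal.mul_lt_top ENNReal.ofReal_lt_top (hfin t ht)).ne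
      set K := (ENNReal.ofReal (32 + 4 * Real.log (384 * B)) * hardySum B F t).toReal
      have hL : 0 < (K + |r| + 3)⁻¹ := by positivity
      filter_upwards [hx.norm.eventually_lt_const (u := (K + |r| + 3)⁻¹) (by rwa [norm_zero]),
        hr.abs.eventually_lt_const (lt_add_one |r|), self_mem_nhdsWithin] with ε h1 h2 hε
      show _ < ENNReal.ofReal |(w (x + ε * Complex.I)).im|
      refine (ENNReal.lt_ofReal_iff_toReal_lt hK).2 ?_
      rw [norm_inv, inv_lt_inv₀ (norm_pos_iff.2 (hne _ (hpos x ε hε))) (by positivity)] at h1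
      have h3 := Complex.norm_le_abs_re_add_abs_im (1 + w (x + ε * Complex.I))
      simp only [Complex.add_re, Complex.one_re, Complex.add_im, Complex.one_im, zero_add] at h3
      have h4 := abs_add_le 1 (w (x + ε * Complex.I)).re
      rw [abs_one] at h4
      show K < _
      linarith
  filter_upwards [ae_exists_tendsto_of_bounded hPd hPM, measure_eq_zero_iff_ae_notMem.1 hnull]
    with x ⟨l, hl⟩ hx
  have hl0 : l ≠ 0 := fun h1 => hx (by rw [h1] at hl; exact hl)
  have h1 := (hl.inv₀ hl0)
  simp only [inv_inv] at h1
  refine ⟨(l⁻¹).im, ((Complex.continuous_im.tendsto _).comp h1).congr fun ε => ?_⟩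
  simp

/-- The conjugate function of `f` exists almost everywhere, with a bound on its distribution. -/
lemma exists_conjugate (h : RearrBound f F) (hfm : Measurable f) (h0 : ∀ y, 0 ≤ f y)
    (hB : 2 ≤ B) (hfin : ∀ t, 0 < t → hardySum B F t < ∞) :
    ∃ v : ℝ → ℝ, AEMeasurable v volume ∧
      (∀ᵐ x : ℝ, Tendsto (fun ε : ℝ => ∫ y in {y : ℝ | ε < |x - y|}, f y / (x - y))
        (𝓝[>] 0) (𝓝 (v x))) ∧
      ∀ t, 0 < t → volume {x | ENNReal.ofReal (32 + 4 * Real.log (384 * B)) * hardySum B F t <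
        ENNReal.ofReal |v x|} ≤ ENNReal.ofReal (3 * t) := by
  have hci := h.cauchyIntegrable hfm h0 hB one_pos (hfin 1 one_pos)
  have hex := h.ae_exists_tendsto_im hfm h0 hB hfin
  classical
  set v : ℝ → ℝ := fun x => if hx : ∃ l : ℝ, Tendsto (fun ε : ℝ =>
    (cauchyInt f (x + ε * Complex.I)).im) (𝓝[>] 0) (𝓝 l) then hx.choose else 0
  have hv : ∀ᵐ x : ℝ, Tendsto (fun ε : ℝ => (cauchyInt f (x + ε * Complex.I)).im)
      (𝓝[>] 0) (𝓝 (v x)) := by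
    filter_upwards [hex] with x hx
    simp only [v, dif_pos hx]
    exact hx.choose_spec
  have hseq : Tendsto (fun n : ℕ => 1 / ((n : ℝ) + 1)) atTop (𝓝[>] 0) :=
    tendsto_nhdsWithin_iff.2 ⟨tendsto_one_div_add_atTop_nhds_zero_nat,
      Eventually.of_forall fun n => by show 0 < 1 / ((n : ℝ) + 1); positivity⟩
  refine ⟨v, ?_, ?_, fun t ht => ?_⟩
  · refine aemeasurable_of_tendsto_metrizable_ae (atTop : Filter ℕ)
      (f := fun (n : ℕ) (x : ℝ) => (cauchyInt f (x + (1 / ((n : ℝ) + 1) : ℝ) * Complex.I)).im)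
      (fun n => ?_) ?_
    · exact (Complex.continuous_im.comp (hci.continuous_line (by positivity))).measurable.aemeasurable
    · filter_upwards [hv] with x hx
      exact hx.comp hseq
  · filter_upwards [hv, ae_tendsto_trunc_sub_im hci] with x h1 h2
    simpa using h2.add h1
  · refine volume_le_of_eventually (fun n : ℕ => h.volume_lt_abs_im_le hfm h0 hB ht
      (ε := 1 / ((n : ℝ) + 1)) (by positivity)) ?_
    filter_upwards [hv] with x hx hxt
    exact (ENNReal.tendsto_ofReal (hx.comp hseq).abs).eventually_const_lt hxt

end RearrBound

namespace RIQB

variable {X : RIQB}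

lemma Nr_const_mul (c : ℝ) (f : ℝ → ℝ) : X.Nr (fun x => c * f x) = ENNReal.ofReal |c| * X.Nr f := by
  rw [Nr, Nr, ← X.norm_smul]
  simp only [abs_mul, ENNReal.ofReal_mul (abs_nonneg c)]

lemma Nr_zero : X.Nr (fun _ => 0) = 0 := by
  have := X.Nr_const_mul 0 (fun _ => 0)
  simpa using this

lemma Nr_add_le {f g : ℝ → ℝ} (hf : AEMeasurable f volume) (hg : AEMeasurable g volume) :
    X.Nr (fun x => f x + g x) ≤ ENNReal.ofReal X.C * (X.Nr f + X.Nr g) := by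
  refine (X.N_mono ((aemeasurable_ofReal_abs hf).add (aemeasurable_ofReal_abs hg))
    (aemeasurable_ofReal_abs (hf.add hg)) fun x => ?_).trans
    (X.N_add_le (aemeasurable_ofReal_abs hf) (aemeasurable_ofReal_abs hg))
  simp only [Pi.add_apply]
  rw [← ENNReal.ofReal_add (abs_nonneg _) (abs_nonneg _)]
  exact ENNReal.ofReal_le_ofReal (abs_add_le _ _)

variable {h : ℕ → ℝ → ℝ} {A : ℝ≥0∞}

lemma Nr_sum_le (hm : ∀ k, AEMeasurable (h k) volume)
    (hN : ∀ k, X.Nr (h k) ≤ ENNReal.ofReal ((2 * X.C)⁻¹ ^ k) * A) (n m : ℕ) :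
    X.Nr (fun x => ∑ i ∈ Finset.range n, h (m + i) x) ≤
      ENNReal.ofReal (2 * X.C * (2 * X.C)⁻¹ ^ m) * A := by
  have hC := X.C_pos
  induction n generalizing m with
  | zero => simp [X.Nr_zero]
  | succ n ih =>
    have e : (fun x => ∑ i ∈ Finset.range (n + 1), h (m + i) x) =
        fun x => h m x + ∑ i ∈ Finset.range n, h (m + 1 + i) x := by
      ext x
      rw [Finset.sum_range_succ', add_zero, add_comm]
      congr 1
      exact Finset.sum_congr rfl fun i _ => by rw [show m + (i + 1) = m + 1 + i by ring]
    rw [e]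
    refine (X.Nr_add_le (hm m) (Finset.aemeasurable_fun_sum _ fun i _ => hm _)).trans ?_
    calc ENNReal.ofReal X.C * (X.Nr (h m) + X.Nr fun x => ∑ i ∈ Finset.range n, h (m + 1 + i) x)
        ≤ ENNReal.ofReal X.C * (ENNReal.ofReal ((2 * X.C)⁻¹ ^ m) * A +
          ENNReal.ofReal (2 * X.C * (2 * X.C)⁻¹ ^ (m + 1)) * A) := by
          gcongr
          · exact hN m
          · exact ih (m + 1)
      _ = _ := by
          rw [← add_mul, ← ENNReal.ofReal_add (by positivity) (by positivity), ← mul_assoc,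
            ← ENNReal.ofReal_mul hC.le]
          congr 2
          rw [pow_succ]
          field_simp
          ring

/-- Countable summation in a quasi-Banach function space. -/
lemma N_tsum_le (hm : ∀ k, AEMeasurable (h k) volume) (h0 : ∀ k x, 0 ≤ h k x)
    (hN : ∀ k, X.Nr (h k) ≤ ENNReal.ofReal ((2 * X.C)⁻¹ ^ k) * A) (hA : A < ∞) :
    X.N (fun x => ∑' k, ENNReal.ofReal (h k x)) ≤ ENNReal.ofReal (2 * X.C ^ 2) * A := by
  have hC := X.C_pos
  have hC1 := X.one_le_C
  set S : ℕ → ℝ → ℝ := fun n x => ∑ i ∈ Finset.range n, h i x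
  have hSm : ∀ n, AEMeasurable (S n) volume := fun n => Finset.aemeasurable_fun_sum _ fun i _ => hm _
  have hS : ∀ n, X.Nr (S n) ≤ ENNReal.ofReal (2 * X.C) * A := fun n => by
    simpa using X.Nr_sum_le hm hN n 0
  have hSS : ∀ m n, X.Nr (fun x => S (m + n) x - S m x) ≤
      ENNReal.ofReal (2 * X.C * (2 * X.C)⁻¹ ^ m) * A := fun m n => by
    simp only [S, Finset.sum_range_add, add_sub_cancel_left]
    exact X.Nr_sum_le hm hN n m
  have hlim : Tendsto (fun m : ℕ => ENNReal.ofReal (2 * X.C * (2 * X.C)⁻¹ ^ m) * A) atTop (𝓝 0) := by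
    have h1 : Tendsto (fun m : ℕ => 2 * X.C * (2 * X.C)⁻¹ ^ m) atTop (𝓝 (2 * X.C * 0)) :=
      (_root_.tendsto_pow_atTop_nhds_zero_of_lt_one (by positivity)
        (inv_lt_one_of_one_lt₀ (by linarith))).const_mul _
    have h2 := ENNReal.Tendsto.mul_const (ENNReal.tendsto_ofReal h1) (Or.inr hA.ne)
    simpa using h2
  obtain ⟨g, hgm, -, hg⟩ := X.complete S
    (fun n => ⟨hSm n, (hS n).trans_lt (ENNReal.mul_lt_top ENNReal.ofReal_lt_top hA)⟩) (by
      intro ε hε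
      obtain ⟨M, hM⟩ := eventually_atTop.1
        (hlim.eventually_lt_const (ENNReal.ofReal_pos.2 hε))
      refine ⟨M, fun m hm n hn => ?_⟩
      rcases le_total m n with hmn | hmn
      · obtain ⟨k, rfl⟩ := Nat.exists_eq_add_of_le hmn
        simp only [abs_sub_comm (S m _)]
        exact (hSS m k).trans_lt (hM m hm)
      · obtain ⟨k, rfl⟩ := Nat.exists_eq_add_of_le hmn
        exact (hSS n k).trans_lt (hM n hn))
  have hle : ∀ n, ∀ᵐ x, S n x ≤ |g x| := by
    intro n
    have hpm : AEMeasurable (fun x => ENNReal.ofReal (S n x - g x)) volume :=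
      ((hSm n).sub hgm).ennreal_ofReal
    have hz : X.N (fun x => ENNReal.ofReal (S n x - g x)) = 0 := by
      refine le_antisymm (ge_of_tendsto hg ?_) zero_le
      filter_upwards [eventually_ge_atTop n] with m hmn
      refine X.N_mono (aemeasurable_ofReal_abs ((hSm m).sub hgm)) hpm fun x => ?_
      refine ENNReal.ofReal_le_ofReal (le_trans ?_ (le_abs_self _))
      show S n x - g x ≤ S m x - g x
      have : S n x ≤ S m x := Finset.sum_le_sum_of_subset_of_nonneg
        (Finset.range_mono hmn) fun i _ _ => h0 i x
      linarith
    filter_upwards [(X.definite _ hpm).1 hz] with x hx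
    have : S n x - g x ≤ 0 := ENNReal.ofReal_eq_zero.1 hx
    linarith [le_abs_self (g x)]
  have hgN : X.Nr g ≤ ENNReal.ofReal (2 * X.C ^ 2) * A := by
    have h1 : ∀ n, X.Nr g ≤ ENNReal.ofReal X.C *
        (X.N (fun x => ENNReal.ofReal |S n x - g x|) + ENNReal.ofReal (2 * X.C) * A) := by
      intro n
      have h2 := X.Nr_add_le (f := fun x => g x - S n x) (hgm.sub (hSm n)) (hSm n)
      simp only [sub_add_cancel] at h2
      have h3 : X.Nr (fun x => g x - S n x) = X.N (fun x => ENNReal.ofReal |S n x - g x|) := by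
        simp only [Nr, abs_sub_comm]
      rw [← h3]
      exact h2.trans (by gcongr; exact hS n)
    have h3 := ENNReal.Tendsto.const_mul (a := ENNReal.ofReal X.C)
      (hg.add_const (ENNReal.ofReal (2 * X.C) * A)) (Or.inr ENNReal.ofReal_ne_top)
    refine (ge_of_tendsto' h3 h1).trans (le_of_eq ?_)
    rw [zero_add, ← mul_assoc, ← ENNReal.ofReal_mul hC.le]
    congr 2
    ring
  refine (X.N_mono_ae (aemeasurable_ofReal_abs hgm)
    (AEMeasurable.tsum fun k => (hm k).ennreal_ofReal) ?_).trans hgN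
  filter_upwards [ae_all_iff.2 hle] with x hx
  refine ENNReal.tsum_le_of_sum_range_le fun n => ?_
  rw [← ENNReal.ofReal_sum_of_nonneg fun i _ => h0 i x]
  exact ENNReal.ofReal_le_ofReal (hx n)

end RIQB

/-! ### Sufficiency of the conditions on the Boyd indices -/

lemma eventually_rpow_neg_le {r ε : ℝ} (hr : 0 < r) (hε : 0 < ε) : ∀ᶠ B : ℝ in atTop, B ^ (-r) ≤ ε :=
  (tendsto_rpow_neg_atTop hr).eventually_le_const hε

namespace RIQB

variable {X : RIQB}

lemma Nr_hardyTerm_le {B : ℝ} {F : ℝ → ℝ} {c₁ c₂ p q : ℝ} (hB : 2 ≤ B) (hc₁ : 0 < c₁)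
    (hc₂ : 0 < c₂) (h₁ : ∀ a : ℝ, 1 < a → X.DilBound a (c₁ * a ^ (-(1 / q))))
    (h₂ : ∀ a : ℝ, 0 < a → a < 1 → X.DilBound a (c₂ * a ^ (-(1 / p))))
    (hBq : B ^ (-(1 / q)) ≤ (4 * X.C)⁻¹) (hBp : B ^ (-(1 - 1 / p)) ≤ (2 * X.C)⁻¹)
    (hF : AEMeasurable F volume) (hN : X.Nr F < ∞) (k : ℕ) :
    X.Nr (hardyTerm B F k) ≤ ENNReal.ofReal ((2 * X.C)⁻¹ ^ k) *
      (ENNReal.ofReal (X.C * (max c₁ 1 + c₂ * B ^ (1 / p))) * X.Nr F) := by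
  have hC := X.C_pos
  have hB0 : 0 < B := by linarith
  have hBk : 0 < B ^ k := by positivity
  have hd₁ : X.DilBound (B ^ k) (max c₁ 1 * (B ^ (-(1 / q))) ^ k) := by
    rcases k.eq_zero_or_pos with rfl | hk
    · simpa using X.dilBound_one.mono_const (le_max_right c₁ 1)
    · refine (h₁ _ (one_lt_pow₀ (by linarith) hk.ne')).mono_const ?_
      rw [← Real.rpow_natCast, ← Real.rpow_natCast, ← Real.rpow_mul hB0.le,
        ← Real.rpow_mul hB0.le, mul_comm (k : ℝ)]
      exact mul_le_mul_of_nonneg_right (le_max_left _ _) (by positivity)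
  have hd₂ := h₂ (B ^ (k + 1))⁻¹ (by positivity)
    (inv_lt_one_of_one_lt₀ (one_lt_pow₀ (by linarith) k.succ_ne_zero))
  have e : hardyTerm B F k = fun t => ((k : ℝ) + 1) * dil (B ^ k) F t +
      (B ^ k)⁻¹ * dil (B ^ (k + 1))⁻¹ F t := rfl
  rw [e]
  refine (X.Nr_add_le ((aemeasurable_dil hF hBk.ne').const_mul _)
    ((aemeasurable_dil hF (by positivity)).const_mul _)).trans ?_
  rw [X.Nr_const_mul, X.Nr_const_mul, abs_of_pos (by positivity), abs_of_pos (by positivity)]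
  have hk : ((k : ℝ) + 1) * (max c₁ 1 * (B ^ (-(1 / q))) ^ k) ≤ max c₁ 1 * (2 * X.C)⁻¹ ^ k := by
    have h2 : (k : ℝ) + 1 ≤ 2 ^ k := by exact_mod_cast Nat.lt_two_pow_self
    calc ((k : ℝ) + 1) * (max c₁ 1 * (B ^ (-(1 / q))) ^ k)
        ≤ 2 ^ k * (max c₁ 1 * (4 * X.C)⁻¹ ^ k) := by gcongr
      _ = max c₁ 1 * (2 * (4 * X.C)⁻¹) ^ k := by rw [mul_pow]; ring
      _ = _ := by congr 2; field_simp; norm_num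
  have hk' : (B ^ k)⁻¹ * (c₂ * (B ^ (k + 1))⁻¹ ^ (-(1 / p))) ≤
      c₂ * B ^ (1 / p) * (2 * X.C)⁻¹ ^ k := by
    calc (B ^ k)⁻¹ * (c₂ * (B ^ (k + 1))⁻¹ ^ (-(1 / p)))
        = c₂ * B ^ (1 / p) * (B ^ (-(1 - 1 / p))) ^ k := by
          rw [Real.inv_rpow (by positivity), ← Real.rpow_neg (by positivity), neg_neg,
            ← Real.rpow_natCast B (k + 1), ← Real.rpow_natCast B k, ← Real.rpow_natCast,
            ← Real.rpow_mul hB0.le, ← Real.rpow_mul hB0.le, ← Real.rpow_neg hB0.le,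
            mul_left_comm, mul_assoc, ← Real.rpow_add hB0, ← Real.rpow_add hB0]
          congr 2
          push_cast
          ring
      _ ≤ _ := by gcongr
  calc ENNReal.ofReal X.C * (ENNReal.ofReal ((k : ℝ) + 1) * X.Nr (dil (B ^ k) F) +
        ENNReal.ofReal (B ^ k)⁻¹ * X.Nr (dil (B ^ (k + 1))⁻¹ F))
      ≤ ENNReal.ofReal X.C * (ENNReal.ofReal ((k : ℝ) + 1) *
          (ENNReal.ofReal (max c₁ 1 * (B ^ (-(1 / q))) ^ k) * X.Nr F) +
        ENNReal.ofReal (B ^ k)⁻¹ *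
          (ENNReal.ofReal (c₂ * (B ^ (k + 1))⁻¹ ^ (-(1 / p))) * X.Nr F)) := by
        gcongr
        · exact hd₁ F hF hN
        · exact hd₂ F hF hN
    _ = ENNReal.ofReal X.C * ((ENNReal.ofReal (((k : ℝ) + 1) *
          (max c₁ 1 * (B ^ (-(1 / q))) ^ k)) +
        ENNReal.ofReal ((B ^ k)⁻¹ * (c₂ * (B ^ (k + 1))⁻¹ ^ (-(1 / p))))) * X.Nr F) := by
        rw [← mul_assoc, ← mul_assoc, ← ENNReal.ofReal_mul (by positivity),
          ← ENNReal.ofReal_mul (by positivity), add_mul (ENNReal.ofReal _)]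
    _ ≤ ENNReal.ofReal X.C * ((ENNReal.ofReal (max c₁ 1 * (2 * X.C)⁻¹ ^ k) +
        ENNReal.ofReal (c₂ * B ^ (1 / p) * (2 * X.C)⁻¹ ^ k)) * X.Nr F) := by gcongr
    _ = _ := by
        rw [← ENNReal.ofReal_add (by positivity) (by positivity), ← mul_assoc, ← mul_assoc,
          ← ENNReal.ofReal_mul hC.le, ← ENNReal.ofReal_mul (by positivity)]
        congr 2
        ring

/-- The discrete Hardy operators are bounded if the Boyd indices are nontrivial. -/
lemma exists_N_hardySum_le (hp : 1 < lowerBoyd X) (hq : upperBoyd X < ∞) :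
    ∃ B K : ℝ, 2 ≤ B ∧ 0 < K ∧ ∀ F : ℝ → ℝ, AEMeasurable F volume → (∀ x, 0 ≤ F x) →
      X.Nr F < ∞ → X.N (hardySum B F) ≤ ENNReal.ofReal K * X.Nr F := by
  have hC := X.C_pos
  obtain ⟨p, c₂, hp1, hc₂, h₂⟩ := exists_dilBound_of_one_lt_lowerBoyd hp
  obtain ⟨q, c₁, hq0, hc₁, h₁⟩ := exists_dilBound_of_upperBoyd_lt_top hq
  have hp' : 0 < 1 - 1 / p := by
    rw [sub_pos, div_lt_one (by linarith)]
    exact hp1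
  obtain ⟨B, hB, hBq, hBp⟩ := ((eventually_ge_atTop (2 : ℝ)).and
    ((eventually_rpow_neg_le (by positivity : 0 < 1 / q) (by positivity : 0 < (4 * X.C)⁻¹)).and
      (eventually_rpow_neg_le hp' (by positivity : 0 < (2 * X.C)⁻¹)))).exists
  have hB0 : 0 < B := by linarith
  refine ⟨B, 2 * X.C ^ 2 * (X.C * (max c₁ 1 + c₂ * B ^ (1 / p))), hB, by positivity,
    fun F hF hF0 hN => ?_⟩
  have hm : ∀ k, AEMeasurable (hardyTerm B F k) volume := fun k =>
    ((aemeasurable_dil hF (by positivity : B ^ k ≠ 0)).const_mul _).add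
      ((aemeasurable_dil hF (by positivity : (B ^ (k + 1))⁻¹ ≠ 0)).const_mul _)
  refine (X.N_tsum_le hm (fun k x => ?_)
    (X.Nr_hardyTerm_le hB hc₁ hc₂ h₁ h₂ hBq hBp hF hN)
    (ENNReal.mul_lt_top ENNReal.ofReal_lt_top hN)).trans (le_of_eq ?_)
  · have h1 := hF0 (B ^ k * x)
    have h2 := hF0 ((B ^ (k + 1))⁻¹ * x)
    rw [hardyTerm]
    positivity
  · rw [← mul_assoc, ← ENNReal.ofReal_mul (by positivity)]

end RIQB

lemma hardySum_antitoneOn {f F : ℝ → ℝ} (h : RearrBound f F) {B s t : ℝ} (hB : 0 < B)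
    (hs : 0 < s) (hst : s ≤ t) : hardySum B F t ≤ hardySum B F s := by
  refine ENNReal.tsum_le_tsum fun k => ENNReal.ofReal_le_ofReal ?_
  have h1 := h.anti (B ^ k * s) (B ^ k * t) (by positivity) (by gcongr)
  have h2 := h.anti ((B ^ (k + 1))⁻¹ * s) ((B ^ (k + 1))⁻¹ * t) (by positivity) (by gcongr)
  rw [hardyTerm, hardyTerm]
  gcongr

lemma measurable_hardySum {B : ℝ} {F : ℝ → ℝ} (hF : Measurable F) : Measurable (hardySum B F) := by
  unfold hardySum hardyTerm
  fun_prop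

lemma hardySum_dil (a B : ℝ) (F : ℝ → ℝ) (t : ℝ) :
    hardySum B (dil a F) t = hardySum B F (a * t) := by
  simp only [hardySum, hardyTerm, dil]
  congr! 6 <;> ring

lemma CauchyIntegrable.integrableOn_trunc {f : ℝ → ℝ} (hf : CauchyIntegrable f) (x : ℝ) {ε : ℝ}
    (hε : 0 < ε) : IntegrableOn (fun y => f y / (x - y)) {y | ε < |x - y|} volume := by
  have hms : MeasurableSet {y : ℝ | ε < |x - y|} :=
    measurableSet_lt measurable_const (by fun_prop)
  refine Integrable.mono' ((Integrable.norm hf).const_mul ((1 + |x|) / ε + 1)).integrableOn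
    (hf.aesm.restrict.div₀ (Measurable.aestronglyMeasurable (by fun_prop))) ?_
  refine (ae_restrict_iff' hms).2 (ae_of_all _ fun y (hy : ε < |x - y|) => ?_)
  have hpos : 0 < |x - y| := hε.trans hy
  have h1 : 1 + |y| ≤ ((1 + |x|) / ε + 1) * |x - y| := by
    have h2 : |y| ≤ |x| + |x - y| := by
      have := abs_sub x (x - y)
      simpa using this
    have h3 : 1 + |x| ≤ (1 + |x|) / ε * |x - y| := by
      rw [div_mul_eq_mul_div, le_div_iff₀ hε]
      gcongr
    linarith
  rw [norm_div, norm_mul, Real.norm_eq_abs (x - y),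
    Real.norm_of_nonneg (by positivity : 0 ≤ (1 + |y|)⁻¹), mul_left_comm, div_eq_mul_inv]
  gcongr
  rw [← div_eq_mul_inv, le_div_iff₀ (by positivity), inv_mul_le_iff₀ hpos, mul_comm]
  exact h1

lemma RearrBound.of_le {f g : ℝ → ℝ} {F : ℝ → ℝ} (h : RearrBound f F) (hg : ∀ x, g x ≤ f x) :
    RearrBound g F :=
  ⟨h.nonneg, h.anti, fun s hs =>
    (measure_mono fun x (hx : F s < g x) => hx.trans_le (hg x)).trans (h.dist s hs)⟩

lemma volume_lt_sub_le {v w : ℝ → ℝ} {M m : ℝ≥0∞} (hv : volume {x | M < ENNReal.ofReal |v x|} ≤ m)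
    (hw : volume {x | M < ENNReal.ofReal |w x|} ≤ m) :
    volume {x | 2 * M < ENNReal.ofReal |v x - w x|} ≤ 2 * m := by
  rw [two_mul m]
  refine (measure_mono fun x (hx : 2 * M < ENNReal.ofReal |v x - w x|) => ?_).trans
    ((measure_union_le _ _).trans (add_le_add hv hw))
  by_contra hc
  have h1 : ENNReal.ofReal |v x| ≤ M := not_lt.1 fun h => hc (Or.inl h)
  have h2 : ENNReal.ofReal |w x| ≤ M := not_lt.1 fun h => hc (Or.inr h)
  refine hx.not_ge ?_
  calc ENNReal.ofReal |v x - w x| ≤ ENNReal.ofReal (|v x| + |w x|) :=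
        ENNReal.ofReal_le_ofReal (abs_sub _ _)
    _ ≤ ENNReal.ofReal |v x| + ENNReal.ofReal |w x| := ENNReal.ofReal_add_le
    _ ≤ 2 * M := by rw [two_mul]; exact add_le_add h1 h2

namespace RIQB

variable {X : RIQB}

lemma rearrBound_starReal {f : ℝ → ℝ} (hf : AEMeasurable f volume) (hN : X.Nr f < ∞) :
    RearrBound (fun x => |f x|) (starReal f) where
  nonneg := starReal_nonneg f
  anti _ _ hs hst := starReal_antitoneOn hf hN hs hst
  dist s hs := by
    refine (measure_mono fun x (hx : starReal f s < |f x|) => ?_).trans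
      (volume_starHL_lt_le (fun y => ENNReal.ofReal |f y|) hs)
    show starHL (fun y => ENNReal.ofReal |f y|) s < ENNReal.ofReal |f x|
    rw [← ofReal_starReal hf hN]
    exact (ENNReal.ofReal_lt_ofReal_iff_of_nonneg (starReal_nonneg f s)).2 hx

lemma hardySum_lt_top {f F : ℝ → ℝ} {B t : ℝ} (h : RearrBound f F) (hB : 0 < B)
    (hF : Measurable F) (hN : X.N (hardySum B F) < ∞) (ht : 0 < t) : hardySum B F t < ∞ := by
  have h1 := X.ae_lt_top_of_N_lt_top (measurable_hardySum hF).aemeasurable hN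
  obtain ⟨s, hs, hs'⟩ : ∃ s ∈ Ioo 0 t, hardySum B F s < ∞ := by
    by_contra! hc
    have h2 : volume (Ioo 0 t) ≤ 0 := by
      rw [← ae_iff.1 h1]
      exact measure_mono fun s hs => not_lt.2 (hc s hs)
    rw [Real.volume_Ioo, sub_zero, nonpos_iff_eq_zero, ENNReal.ofReal_eq_zero] at h2
    linarith
  exact (hardySum_antitoneOn h hB hs.1 hs.2.le).trans_lt hs'

/-- The Hilbert transform is bounded if the Boyd indices are nontrivial. -/
lemma exists_hilbertBound (hp : 1 < lowerBoyd X) (hq : upperBoyd X < ∞) :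
    ∃ c : ℝ, 0 < c ∧ X.HilbertBound c := by
  obtain ⟨B, K, hB, hK, hBK⟩ := exists_N_hardySum_le hp hq
  obtain ⟨L, hL, hdil⟩ := X.exists_dilBound (by norm_num : (0 : ℝ) < 1 / 6)
  have hB0 : 0 < B := by linarith
  set κ : ℝ := 32 + 4 * Real.log (384 * B) with hκ
  have hκ0 : 0 < κ := by
    have := Real.log_nonneg (by linarith : 1 ≤ 384 * B)
    positivity
  refine ⟨2 * κ * (K * L), by positivity, fun f ⟨hf, hN⟩ => ?_⟩
  set f₀ := hf.mk f with hf₀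
  have hm : Measurable f₀ := hf.measurable_mk
  have hff₀ : f =ᵐ[volume] f₀ := hf.ae_eq_mk
  have hNeq : X.Nr f₀ = X.Nr f := X.N_congr_ae (aemeasurable_ofReal_abs hf) (by
    filter_upwards [hff₀] with x hx
    rw [hx])
  rw [← hNeq] at hN
  have hR := rearrBound_starReal hm.aemeasurable hN
  set F := starReal f₀ with hFdef
  have hFm : Measurable F := measurable_starReal f₀
  have hNF : X.Nr F = X.Nr f₀ := Nr_starReal hm.aemeasurable hN
  have hfin : ∀ t, 0 < t → hardySum B F t < ∞ := fun t ht => by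
    refine hardySum_lt_top (X := X) hR hB0 hFm ?_ ht
    exact (hBK F hFm.aemeasurable hR.nonneg (hNF ▸ hN)).trans_lt
      (ENNReal.mul_lt_top ENNReal.ofReal_lt_top (hNF ▸ hN))
  have hRp : RearrBound (fun x => max (f₀ x) 0) F :=
    hR.of_le fun x => max_le (le_abs_self _) (abs_nonneg _)
  have hRn : RearrBound (fun x => max (-f₀ x) 0) F :=
    hR.of_le fun x => max_le (neg_le_abs _) (abs_nonneg _)
  have hmp : Measurable fun x => max (f₀ x) 0 := by fun_prop
  have hmn : Measurable fun x => max (-f₀ x) 0 := by fun_prop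
  have hcp := hRp.cauchyIntegrable hmp (fun _ => le_max_right _ _) hB one_pos (hfin 1 one_pos)
  have hcn := hRn.cauchyIntegrable hmn (fun _ => le_max_right _ _) hB one_pos (hfin 1 one_pos)
  obtain ⟨v, hv, hvlim, hvd⟩ := hRp.exists_conjugate hmp (fun _ => le_max_right _ _) hB hfin
  obtain ⟨w, hw, hwlim, hwd⟩ := hRn.exists_conjugate hmn (fun _ => le_max_right _ _) hB hfin
  refine ⟨fun x => v x - w x, hv.sub hw, ?_, ?_⟩
  · filter_upwards [hvlim, hwlim] with x hx hx'
    refine (hx.sub hx').congr' ?_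
    filter_upwards [self_mem_nhdsWithin] with ε (hε : 0 < ε)
    rw [← integral_sub (hcp.integrableOn_trunc x hε) (hcn.integrableOn_trunc x hε)]
    refine integral_congr_ae (ae_restrict_of_ae ?_)
    filter_upwards [hff₀] with y hy
    rw [← sub_div, hy]
    congr 1
    rcases le_total (f₀ y) 0 with h | h
    · rw [max_eq_right h, max_eq_left (by linarith)]; ring
    · rw [max_eq_left h, max_eq_right (by linarith)]; ring
  · have hF6 : Measurable (dil (1 / 6) F) := hFm.comp (measurable_const_mul _)
    have hG : AEMeasurable (fun x => ENNReal.ofReal (2 * κ) * hardySum B (dil (1 / 6) F) x)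
      volume := ((measurable_hardySum hF6).const_mul _).aemeasurable
    have hle : X.Nr (fun x => v x - w x) ≤
        X.N (fun x => ENNReal.ofReal (2 * κ) * hardySum B (dil (1 / 6) F) x) := by
      refine X.N_le_of_dist hG (aemeasurable_ofReal_abs (hv.sub hw))
        (dist_le_of_forall_volume_le fun t ht => ?_)
      have h1 := volume_lt_sub_le (hvd (1 / 6 * t) (by positivity)) (hwd (1 / 6 * t) (by positivity))
      refine le_trans (le_of_eq ?_) (h1.trans (le_of_eq ?_))
      · simp only [hardySum_dil, ENNReal.ofReal_mul zero_le_two, ENNReal.ofReal_ofNat, mul_assoc]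
        rfl
      · rw [← ENNReal.ofReal_ofNat, ← ENNReal.ofReal_mul (by norm_num)]
        congr 1
        ring
    have hN6 : X.Nr (dil (1 / 6) F) ≤ ENNReal.ofReal L * X.Nr f₀ := by
      rw [Nr_dil_starReal hm.aemeasurable hN (by norm_num)]
      exact hdil f₀ hm.aemeasurable hN
    refine hle.trans ?_
    rw [X.norm_smul, ← hNeq, ENNReal.ofReal_mul (p := 2 * κ) (by positivity), mul_assoc,
      ENNReal.ofReal_mul hK.le, mul_assoc]
    gcongr
    refine (hBK _ hF6.aemeasurable (fun x => hR.nonneg _)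
      (hN6.trans_lt (ENNReal.mul_lt_top ENNReal.ofReal_lt_top hN))).trans ?_
    gcongr

end RIQB

/-- **Theorem 4.** The Hilbert transform (as an a.e. principal value) is bounded on a
rearrangement invariant quasi-Banach space `X` if and only if `p_X > 1` and `q_X < ∞`. -/
theorem hilbert_bounded_iff (X : RIQB) :
    (∃ c : ℝ, 0 < c ∧ ∀ f : ℝ → ℝ, X.mem f →
      ∃ g : ℝ → ℝ, AEMeasurable g volume ∧
        (∀ᵐ x ∂volume,
          Tendsto (fun ε : ℝ => ∫ y in {y : ℝ | ε < |x - y|}, f y / (x - y))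
            (𝓝[>] (0:ℝ)) (𝓝 (g x))) ∧
        X.Nr g ≤ ENNReal.ofReal c * X.Nr f) ↔
    (1 < lowerBoyd X ∧ upperBoyd X < ∞) := by
  constructor
  · rintro ⟨c, hc0, hc⟩
    exact RIQB.HilbertBound.boyd hc hc0
  · rintro ⟨hp, hq⟩
    exact RIQB.exists_hilbertBound hp hq

end
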